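/- Let k be a field and A a finite-dimensional k-algebra such that A/rad(A) is a separable k-algebra. Then the trivial extension algebra T(A) is twisted periodic if and only if every finitely generated T(A)-module has complexity at most one. -/

import Mathlib

open TensorProduct

/-- There is an exact sequence `0 → M → P_n → ⋯ → P_1 → N → 0` of `R`-modules
(so with `n` middle terms) in which each middle term `P_i` is projective. -/
def HasProjExactSeq (R : Type) [Ring R] (M N : ModuleCat R) (n : ℕ) : Prop :=
  ∃ (P : ℕ → ModuleCat R) (d : ∀ i, P (i + 1) →ₗ[R] P i)
    (_ : (P 0 : Type) ≃ₗ[R] N) (_ : (M : Type) ≃ₗ[R] P (n + 1)),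
    (∀ i, 1 ≤ i → i ≤ n → Module.Projective R (P i)) ∧
    Function.Surjective (d 0) ∧ Function.Injective (d n) ∧
    ∀ i < n, LinearMap.range (d (i + 1)) = LinearMap.ker (d i)

/-- The regular bimodule `B` as a module over the enveloping algebra `B ⊗[k] Bᵐᵒᵖ`. -/
noncomputable def regularBimodule (k B : Type) [Field k] [Ring B] [Algebra k B] :
    ModuleCat (B ⊗[k] Bᵐᵒᵖ) :=
  letI : Module (B ⊗[k] Bᵐᵒᵖ) B := TensorProduct.Algebra.module
  ModuleCat.of _ B

/-- The twisted bimodule `₁B_φ` (underlying set `B`, right action twisted by `φ`,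
i.e. `a • x • b = a * x * φ b`) as a module over the enveloping algebra `B ⊗[k] Bᵐᵒᵖ`. -/
noncomputable def twistedBimodule (k B : Type) [Field k] [Ring B] [Algebra k B]
    (φ : B ≃ₐ[k] B) : ModuleCat (B ⊗[k] Bᵐᵒᵖ) :=
  letI : Module (B ⊗[k] Bᵐᵒᵖ) B := TensorProduct.Algebra.module
  letI : Module (B ⊗[k] Bᵐᵒᵖ) B :=
    Module.compHom B
      (Algebra.TensorProduct.map (AlgHom.id k B) (AlgEquiv.op φ).toAlgHom).toRingHom
  ModuleCat.of _ B

/-- A finite-dimensional `k`-algebra `B` is twisted periodic if there are `n ≥ 1`, an algebra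
automorphism `φ` of `B`, and an exact sequence `0 → ₁B_φ → P_{n-1} → ⋯ → P_0 → B → 0` of
bimodules with all `P_i` projective over `B ⊗[k] Bᵐᵒᵖ`. -/
noncomputable def IsTwistedPeriodicAlgebra (k B : Type) [Field k] [Ring B] [Algebra k B] : Prop :=
  ∃ (n : ℕ) (φ : B ≃ₐ[k] B), 1 ≤ n ∧
    HasProjExactSeq (B ⊗[k] Bᵐᵒᵖ) (twistedBimodule k B φ) (regularBimodule k B) n

/-- The dimension over `k` of a module over the `k`-algebra `B`. -/
noncomputable def kDim (k B : Type) [Field k] [Ring B] [Algebra k B]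
    (M : Type) [AddCommGroup M] [Module B M] : ℕ :=
  letI : Module k M := Module.compHom M (algebraMap k B)
  Module.finrank k M

/-- A `B`-module `M` has complexity at most one: there are a constant `C` and a projective
resolution `⋯ → P_1 → P_0 → M → 0` by finitely generated projective `B`-modules with
`dim_k P_t ≤ C` for all `t`. -/
noncomputable def ComplexityLeOne (k B : Type) [Field k] [Ring B] [Algebra k B]
    (M : Type) [AddCommGroup M] [Module B M] : Prop :=
  ∃ (C : ℕ) (P : ℕ → ModuleCat B) (f : ∀ i, P (i + 1) →ₗ[B] P i) (π : (P 0 : Type) →ₗ[B] M),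
    (∀ i, Module.Projective B (P i)) ∧ (∀ i, Module.Finite B (P i)) ∧
    (∀ i, kDim k B (P i) ≤ C) ∧
    Function.Surjective π ∧ LinearMap.range (f 0) = LinearMap.ker π ∧
    ∀ i, LinearMap.range (f (i + 1)) = LinearMap.ker (f i)

section DualBimodule

variable (k A : Type) [Field k] [Ring A] [Algebra k A]

/-- The left `A`-action on `D(A) = Hom_k(A, k)`, given by `(a • f) x = f (x * a)`. -/
noncomputable instance Module.Dual.leftModule : Module A (Module.Dual k A) where
  smul a f := f ∘ₗ LinearMap.mulRight k a
  one_smul f := LinearMap.ext fun x => by show f (x * 1) = f x; rw [mul_one]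
  mul_smul a b f := LinearMap.ext fun x => by
    show f (x * (a * b)) = f (x * a * b); rw [mul_assoc]
  smul_zero a := LinearMap.ext fun x => by show (0 : Module.Dual k A) (x * a) = 0; rfl
  smul_add a f g := LinearMap.ext fun x => by
    show (f + g) (x * a) = f (x * a) + g (x * a); rfl
  add_smul a b f := LinearMap.ext fun x => by
    show f (x * (a + b)) = f (x * a) + f (x * b); rw [mul_add, map_add]
  zero_smul f := LinearMap.ext fun x => by show f (x * 0) = 0; rw [mul_zero, map_zero]

/-- The right `A`-action on `D(A) = Hom_k(A, k)`, given by `(f • op b) x = f (b * x)`. -/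
noncomputable instance Module.Dual.rightModule : Module Aᵐᵒᵖ (Module.Dual k A) where
  smul b f := f ∘ₗ LinearMap.mulLeft k b.unop
  one_smul f := LinearMap.ext fun x => by show f (1 * x) = f x; rw [one_mul]
  mul_smul a b f := LinearMap.ext fun x => by
    show f ((a * b).unop * x) = f (b.unop * (a.unop * x))
    rw [MulOpposite.unop_mul, mul_assoc]
  smul_zero a := LinearMap.ext fun x => by show (0 : Module.Dual k A) (a.unop * x) = 0; rfl
  smul_add a f g := LinearMap.ext fun x => by
    show (f + g) (a.unop * x) = f (a.unop * x) + g (a.unop * x); rfl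
  add_smul a b f := LinearMap.ext fun x => by
    show f ((a + b).unop * x) = f (a.unop * x) + f (b.unop * x)
    rw [MulOpposite.unop_add, add_mul, map_add]
  zero_smul f := LinearMap.ext fun x => by
    show f ((0 : Aᵐᵒᵖ).unop * x) = 0
    rw [MulOpposite.unop_zero, zero_mul, map_zero]

instance : SMulCommClass A Aᵐᵒᵖ (Module.Dual k A) where
  smul_comm a b f := LinearMap.ext fun x => by
    show f (b.unop * (x * a)) = f (b.unop * x * a); rw [mul_assoc]

instance : IsScalarTower k A (Module.Dual k A) where
  smul_assoc c a f := LinearMap.ext fun x => by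
    show f (x * (c • a)) = c • f (x * a)
    rw [mul_smul_comm, map_smul]

instance : IsScalarTower k Aᵐᵒᵖ (Module.Dual k A) where
  smul_assoc c b f := LinearMap.ext fun x => by
    show f ((c • b).unop * x) = c • f (b.unop * x)
    rw [MulOpposite.unop_smul, smul_mul_assoc, map_smul]

/-- The trivial extension algebra `T(A) = A ⊕ D(A)`. -/
noncomputable abbrev TrivialExtension : Type := TrivSqZeroExt A (Module.Dual k A)


end DualBimodule

namespace TE

open Module

section Gen

variable {R : Type} [Ring R]
variable {M N K X Y Q : Type} [AddCommGroup M] [Module R M] [AddCommGroup N] [Module R N]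
  [AddCommGroup K] [Module R K] [AddCommGroup X] [Module R X] [AddCommGroup Y] [Module R Y]
  [AddCommGroup Q] [Module R Q]

theorem ex_desc (p : M →ₗ[R] N) (hp : Function.Surjective p) (F : M →ₗ[R] K)
    (h : ∀ x, p x = 0 → F x = 0) : ∃ f : N →ₗ[R] K, ∀ x, f (p x) = F x := by
  refine ⟨((LinearMap.ker p).liftQ F (fun x hx => h x hx)) ∘ₗ
    (p.quotKerEquivOfSurjective hp).symm.toLinearMap, fun x => ?_⟩
  have : (p.quotKerEquivOfSurjective hp).symm (p x) = Submodule.Quotient.mk x := by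
    rw [LinearEquiv.symm_apply_eq]; rfl
  rw [LinearMap.comp_apply, LinearEquiv.coe_coe, this]; rfl

theorem ex_lift (i : N →ₗ[R] M) (hi : Function.Injective i) (F : K →ₗ[R] M)
    (h : ∀ x, ∃ y, i y = F x) : ∃ f : K →ₗ[R] N, ∀ x, i (f x) = F x := by
  refine ⟨(LinearEquiv.ofInjective i hi).symm.toLinearMap ∘ₗ
    (F.codRestrict (LinearMap.range i) (fun x => by simpa using h x)), fun x => ?_⟩
  have := LinearEquiv.apply_symm_apply (LinearEquiv.ofInjective i hi)
    ((F.codRestrict (LinearMap.range i) (fun x => by simpa using h x)) x)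
  exact congrArg Subtype.val this

theorem proj_lift [Module.Projective R Q] (p : M →ₗ[R] N) (hp : Function.Surjective p)
    (F : Q →ₗ[R] N) : ∃ f : Q →ₗ[R] M, ∀ x, p (f x) = F x := by
  obtain ⟨h, hh⟩ := Module.projective_lifting_property p F hp
  exact ⟨h, fun x => LinearMap.congr_fun hh x⟩

def SZ (f : M →ₗ[R] N) : Prop :=
  ∃ (P : ModuleCat.{0} R) (_ : Module.Projective R P) (_ : Module.Finite R P)
    (a : M →ₗ[R] P) (b : P →ₗ[R] N), ∀ x, f x = b (a x)

theorem SZ.of {P : Type} [AddCommGroup P] [Module R P] [h : Module.Projective R P]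
    [h' : Module.Finite R P] (a : M →ₗ[R] P) (b : P →ₗ[R] N) {f : M →ₗ[R] N}
    (hf : ∀ x, f x = b (a x)) : SZ f :=
  ⟨ModuleCat.of R P, h, h', a, b, hf⟩

theorem SZ.comp_left {f : M →ₗ[R] N} (h : SZ f) (g : N →ₗ[R] K) : SZ (g ∘ₗ f) := by
  obtain ⟨P, h1, h2, a, b, hab⟩ := h
  exact ⟨P, h1, h2, a, g ∘ₗ b, fun x => by simp [hab]⟩

theorem SZ.comp_right {f : M →ₗ[R] N} (h : SZ f) (g : K →ₗ[R] M) : SZ (f ∘ₗ g) := by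
  obtain ⟨P, h1, h2, a, b, hab⟩ := h
  exact ⟨P, h1, h2, a ∘ₗ g, b, fun x => by simp [hab]⟩

theorem SZ.add {f g : M →ₗ[R] N} (hf : SZ f) (hg : SZ g) : SZ (f + g) := by
  obtain ⟨P, h1, h2, a, b, hab⟩ := hf
  obtain ⟨P', h1', h2', a', b', hab'⟩ := hg
  exact SZ.of (P := P × P') (a.prod a') (b.coprod b') (fun x => by simp [hab, hab'])

theorem SZ.zero : SZ (0 : M →ₗ[R] N) :=
  SZ.of (P := Fin 0 → R) 0 0 (fun x => by simp)

def Orth (R : Type) [Ring R] (X Y : Type) [AddCommGroup X] [Module R X] [AddCommGroup Y]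
    [Module R Y] : Prop := ∀ f : X →ₗ[R] Y, SZ f

theorem Orth.congr {X' Y' : Type} [AddCommGroup X'] [Module R X'] [AddCommGroup Y'] [Module R Y']
    (h : Orth R X Y) (e : X' ≃ₗ[R] X) (e' : Y ≃ₗ[R] Y') : Orth R X' Y' := by
  intro f
  have := ((h (e'.symm.toLinearMap ∘ₗ f ∘ₗ e.symm.toLinearMap)).comp_left
    e'.toLinearMap).comp_right e.toLinearMap
  convert this using 1
  ext x; simp

variable (R) in
structure QF : Prop where
  ext : ∀ (X Y : Type) [AddCommGroup X] [Module R X] [AddCommGroup Y] [Module R Y]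
    (i : X →ₗ[R] Y) (_ : Function.Injective i) (f : X →ₗ[R] R), ∃ g : Y →ₗ[R] R, ∀ x, g (i x) = f x
  emb : ∀ (X : Type) [AddCommGroup X] [Module R X] [Module.Finite R X],
    ∃ (n : ℕ) (i : X →ₗ[R] (Fin n → R)), Function.Injective i

theorem QF.extP (h : QF R) [Module.Projective R Q] [Module.Finite R Q] (i : X →ₗ[R] Y)
    (hi : Function.Injective i) (f : X →ₗ[R] Q) : ∃ g : Y →ₗ[R] Q, ∀ x, g (i x) = f x := by
  obtain ⟨n, p, hp⟩ := Module.Finite.exists_fin' R Q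
  obtain ⟨s, hs⟩ := proj_lift p hp (LinearMap.id : Q →ₗ[R] Q)
  choose g hg using fun j : Fin n => h.ext X Y i hi (LinearMap.proj j ∘ₗ s ∘ₗ f)
  refine ⟨p ∘ₗ LinearMap.pi g, fun x => ?_⟩
  have : (LinearMap.pi g) (i x) = s (f x) := by
    ext j; simp [hg]
  simp [this, hs]

theorem QF.sz_ext (h : QF R) {f : X →ₗ[R] N} (hf : SZ f) (i : X →ₗ[R] Y)
    (hi : Function.Injective i) : ∃ g : Y →ₗ[R] N, ∀ x, g (i x) = f x := by
  obtain ⟨P, h1, h2, a, b, hab⟩ := hf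
  obtain ⟨g, hg⟩ := h.extP i hi a
  exact ⟨b ∘ₗ g, fun x => by simp [hg, hab]⟩

theorem sz_lift {f : M →ₗ[R] X} (hf : SZ f) (p : Y →ₗ[R] X)
    (hp : Function.Surjective p) : ∃ g : M →ₗ[R] Y, ∀ x, p (g x) = f x := by
  obtain ⟨P, h1, h2, a, b, hab⟩ := hf
  obtain ⟨g, hg⟩ := proj_lift p hp b
  exact ⟨g ∘ₗ a, fun x => by simp [hg, hab]⟩

def Red (R : Type) [Ring R] (X : Type) [AddCommGroup X] [Module R X] : Prop :=
  ∀ e : X →ₗ[R] X, SZ e → Function.Bijective (LinearMap.id - e : X →ₗ[R] X)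

theorem Red.idem (h : Red R X) (e : X →ₗ[R] X) (he : SZ e) (hi : ∀ x, e (e x) = e x) : e = 0 := by
  ext x
  apply (h e he).1
  simp [hi]

theorem Red.stable_iso (hX : Red R X) (hY : Red R Y) (f : X →ₗ[R] Y) (g : Y →ₗ[R] X)
    (h1 : SZ (LinearMap.id - g ∘ₗ f)) (h2 : SZ (LinearMap.id - f ∘ₗ g)) : Function.Bijective f := by
  have b1 := hX _ h1
  have b2 := hY _ h2
  rw [sub_sub_cancel] at b1 b2
  constructor
  · have := b1.1
    rw [LinearMap.coe_comp] at this
    exact this.of_comp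
  · have := b2.2
    rw [LinearMap.coe_comp] at this
    exact this.of_comp

theorem Red.inj (hX : Red R X) (f : X →ₗ[R] Y) (g : Y →ₗ[R] X)
    (h1 : SZ (LinearMap.id - g ∘ₗ f)) : Function.Injective f := by
  have b1 := hX _ h1
  rw [sub_sub_cancel] at b1
  have := b1.1
  rw [LinearMap.coe_comp] at this
  exact this.of_comp

theorem nak [Module.Finite R M] (N : Submodule R M)
    (h : ∀ x, ∃ y ∈ N, x - y ∈ Ring.jacobson R • (⊤ : Submodule R M)) : N = ⊤ := by
  have : (⊤ : Submodule R (M ⧸ N)) = ⊥ := by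
    apply Submodule.FG.eq_bot_of_le_jacobson_smul Module.Finite.fg_top
    rintro x -
    obtain ⟨x, rfl⟩ := N.mkQ_surjective x
    obtain ⟨y, hy, hxy⟩ := h x
    have h1 : N.mkQ x = N.mkQ (x - y) := by
      rw [map_sub, (by simpa using hy : N.mkQ y = 0), sub_zero]
    rw [h1, ← Submodule.range_mkQ N, LinearMap.range_eq_map, ← Submodule.map_smul'']
    exact Submodule.mem_map_of_mem hxy
  rw [← Submodule.subsingleton_iff_eq_bot] at this
  have h2 : Subsingleton (M ⧸ N) := (Submodule.topEquiv (R := R)).symm.toEquiv.subsingleton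
  exact Submodule.Quotient.subsingleton_iff.mp h2

theorem map_jac (f : M →ₗ[R] N) {x : M} (h : x ∈ Ring.jacobson R • (⊤ : Submodule R M)) :
    f x ∈ Ring.jacobson R • (⊤ : Submodule R N) := by
  have h1 := Submodule.mem_map_of_mem (f := f) h
  rw [Submodule.map_smul''] at h1
  exact Submodule.smul_mono le_rfl le_top h1

end Gen

structure Chain (R : Type) [Ring R] where
  X : ℕ → ModuleCat.{0} R
  P : ℕ → ModuleCat.{0} R
  i : ∀ j, X (j + 1) →ₗ[R] P j
  p : ∀ j, P j →ₗ[R] X j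
  inj : ∀ j, Function.Injective (i j)
  surj : ∀ j, Function.Surjective (p j)
  ex : ∀ j x, p j x = 0 ↔ ∃ y, i j y = x
  proj : ∀ j, Module.Projective R (P j)
  fin : ∀ j, Module.Finite R (P j)

namespace Chain

variable {R : Type} [Ring R]

attribute [instance] Chain.proj Chain.fin

instance finX (c : Chain R) (j : ℕ) : Module.Finite R (c.X j) :=
  Module.Finite.of_surjective (c.p j) (c.surj j)

theorem pi (c : Chain R) (j : ℕ) (x) : c.p j (c.i j x) = 0 := (c.ex j _).2 ⟨x, rfl⟩

def drop (c : Chain R) (n : ℕ) : Chain R where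
  X j := c.X (n + j)
  P j := c.P (n + j)
  i j := c.i (n + j)
  p j := c.p (n + j)
  inj j := c.inj (n + j)
  surj j := c.surj (n + j)
  ex j := c.ex (n + j)
  proj j := c.proj (n + j)
  fin j := c.fin (n + j)

def tail (c : Chain R) : Chain R where
  X j := c.X (j + 1)
  P j := c.P (j + 1)
  i j := c.i (j + 1)
  p j := c.p (j + 1)
  inj j := c.inj (j + 1)
  surj j := c.surj (j + 1)
  ex j := c.ex (j + 1)
  proj j := c.proj (j + 1)
  fin j := c.fin (j + 1)

def prepend (c : Chain R) (M Q : ModuleCat.{0} R) [hQ : Module.Projective R Q]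
    [hQ' : Module.Finite R Q] (i : c.X 0 →ₗ[R] Q) (p : Q →ₗ[R] M) (hi : Function.Injective i)
    (hp : Function.Surjective p) (h : ∀ x, p x = 0 ↔ ∃ y, i y = x) : Chain R where
  X j := match j with
    | 0 => M
    | j + 1 => c.X j
  P j := match j with
    | 0 => Q
    | j + 1 => c.P j
  i j := match j with
    | 0 => i
    | j + 1 => c.i j
  p j := match j with
    | 0 => p
    | j + 1 => c.p j
  inj j := match j with
    | 0 => hi
    | j + 1 => c.inj j
  surj j := match j with
    | 0 => hp
    | j + 1 => c.surj j
  ex j := match j with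
    | 0 => h
    | j + 1 => c.ex j
  proj j := match j with
    | 0 => hQ
    | j + 1 => c.proj j
  fin j := match j with
    | 0 => hQ'
    | j + 1 => c.fin j

def Min (c : Chain R) : Prop :=
  ∀ j x, c.i j x ∈ Ring.jacobson R • (⊤ : Submodule R (c.P j))

def Rel (c c' : Chain R) (n : ℕ) (f : c.X n →ₗ[R] c'.X n) (g : c.X (n + 1) →ₗ[R] c'.X (n + 1)) :
    Prop :=
  ∃ F : c.P n →ₗ[R] c'.P n, (∀ x, c'.p n (F x) = f (c.p n x)) ∧ ∀ x, c'.i n (g x) = F (c.i n x)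

def RelN (c c' : Chain R) : ∀ n, (c.X 0 →ₗ[R] c'.X 0) → (c.X n →ₗ[R] c'.X n) → Prop
  | 0, f, g => f = g
  | n + 1, f, g => ∃ h, RelN c c' n f h ∧ Rel c c' n h g

variable {c c' c'' : Chain R}

theorem Rel.ex_right (n : ℕ) (f : c.X n →ₗ[R] c'.X n) : ∃ g, Rel c c' n f g := by
  obtain ⟨F, hF⟩ := proj_lift (c'.p n) (c'.surj n) (f ∘ₗ c.p n)
  obtain ⟨g, hg⟩ := ex_lift (c'.i n) (c'.inj n) (F ∘ₗ c.i n)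
    (fun x => (c'.ex n _).1 (by simp [hF, c.pi]))
  exact ⟨g, F, hF, hg⟩

theorem Rel.ex_left (h : QF R) (n : ℕ) (g : c.X (n + 1) →ₗ[R] c'.X (n + 1)) :
    ∃ f, Rel c c' n f g := by
  obtain ⟨F, hF⟩ := h.extP (c.i n) (c.inj n) (c'.i n ∘ₗ g)
  obtain ⟨f, hf⟩ := ex_desc (c.p n) (c.surj n) (c'.p n ∘ₗ F)
    (fun x hx => by
      obtain ⟨y, rfl⟩ := (c.ex n x).1 hx
      simp [hF, c'.pi])
  exact ⟨f, F, fun x => (hf x).symm, fun x => (hF x).symm⟩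

theorem Rel.comp {n : ℕ} {f : c.X n →ₗ[R] c'.X n} {g} {f' : c'.X n →ₗ[R] c''.X n} {g'}
    (h : Rel c c' n f g) (h' : Rel c' c'' n f' g') : Rel c c'' n (f' ∘ₗ f) (g' ∘ₗ g) := by
  obtain ⟨F, h1, h2⟩ := h
  obtain ⟨F', h1', h2'⟩ := h'
  exact ⟨F' ∘ₗ F, fun x => by simp [h1', h1], fun x => by simp [h2, h2']⟩

theorem Rel.sub {n : ℕ} {f f' : c.X n →ₗ[R] c'.X n} {g g'}
    (h : Rel c c' n f g) (h' : Rel c c' n f' g') : Rel c c' n (f - f') (g - g') := by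
  obtain ⟨F, h1, h2⟩ := h
  obtain ⟨F', h1', h2'⟩ := h'
  exact ⟨F - F', fun x => by simp [h1', h1], fun x => by simp [h2, h2']⟩

theorem Rel.id (n : ℕ) : Rel c c n LinearMap.id LinearMap.id :=
  ⟨LinearMap.id, fun _ => rfl, fun _ => rfl⟩

theorem Rel.sz_right {n : ℕ} {f : c.X n →ₗ[R] c'.X n} {g} (h : Rel c c' n f g) (hf : SZ f) :
    SZ g := by
  obtain ⟨F, h1, h2⟩ := h
  obtain ⟨b, hb⟩ := sz_lift hf (c'.p n) (c'.surj n)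
  obtain ⟨u, hu⟩ := ex_lift (c'.i n) (c'.inj n) (F - b ∘ₗ c.p n)
    (fun x => (c'.ex n _).1 (by simp [h1, hb]))
  refine SZ.of (c.i n) u (fun x => c'.inj n ?_)
  simp [hu, h2, c.pi]

theorem Rel.sz_left (hq : QF R) {n : ℕ} {f : c.X n →ₗ[R] c'.X n} {g} (h : Rel c c' n f g)
    (hg : SZ g) : SZ f := by
  obtain ⟨F, h1, h2⟩ := h
  obtain ⟨a, ha⟩ := hq.sz_ext hg (c.i n) (c.inj n)
  obtain ⟨v, hv⟩ := ex_desc (c.p n) (c.surj n) (F - c'.i n ∘ₗ a)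
    (fun x hx => by
      obtain ⟨y, rfl⟩ := (c.ex n x).1 hx
      simp [ha, h2])
  refine SZ.of v (c'.p n) (fun x => ?_)
  obtain ⟨x, rfl⟩ := c.surj n x
  simp [hv, h1, c'.pi]

theorem RelN.ex_right (n : ℕ) (f : c.X 0 →ₗ[R] c'.X 0) : ∃ g, RelN c c' n f g := by
  induction n with
  | zero => exact ⟨f, rfl⟩
  | succ n ih =>
    obtain ⟨h, hh⟩ := ih
    obtain ⟨g, hg⟩ := Rel.ex_right n h
    exact ⟨g, h, hh, hg⟩

theorem RelN.ex_left (hq : QF R) (n : ℕ) (g : c.X n →ₗ[R] c'.X n) : ∃ f, RelN c c' n f g := by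
  induction n with
  | zero => exact ⟨g, rfl⟩
  | succ n ih =>
    obtain ⟨h, hh⟩ := Rel.ex_left hq n g
    obtain ⟨f, hf⟩ := ih h
    exact ⟨f, h, hf, hh⟩

theorem RelN.comp {n : ℕ} {f : c.X 0 →ₗ[R] c'.X 0} {g} {f' : c'.X 0 →ₗ[R] c''.X 0} {g'}
    (h : RelN c c' n f g) (h' : RelN c' c'' n f' g') : RelN c c'' n (f' ∘ₗ f) (g' ∘ₗ g) := by
  induction n with
  | zero => simp only [RelN] at *; rw [h, h']
  | succ n ih =>
    obtain ⟨u, hu, hu'⟩ := h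
    obtain ⟨v, hv, hv'⟩ := h'
    exact ⟨_, ih hu hv, hu'.comp hv'⟩

theorem RelN.sub {n : ℕ} {f f' : c.X 0 →ₗ[R] c'.X 0} {g g'}
    (h : RelN c c' n f g) (h' : RelN c c' n f' g') : RelN c c' n (f - f') (g - g') := by
  induction n with
  | zero => simp only [RelN] at *; rw [h, h']
  | succ n ih =>
    obtain ⟨u, hu, hu'⟩ := h
    obtain ⟨v, hv, hv'⟩ := h'
    exact ⟨_, ih hu hv, hu'.sub hv'⟩

theorem RelN.id (n : ℕ) : RelN c c n LinearMap.id LinearMap.id := by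
  induction n with
  | zero => rfl
  | succ n ih => exact ⟨_, ih, Rel.id n⟩

theorem RelN.sz_right {n : ℕ} {f : c.X 0 →ₗ[R] c'.X 0} {g} (h : RelN c c' n f g) (hf : SZ f) :
    SZ g := by
  induction n with
  | zero => rw [RelN] at h; exact h ▸ hf
  | succ n ih =>
    obtain ⟨u, hu, hu'⟩ := h
    exact hu'.sz_right (ih hu)

theorem RelN.sz_left (hq : QF R) {n : ℕ} {f : c.X 0 →ₗ[R] c'.X 0} {g} (h : RelN c c' n f g)
    (hg : SZ g) : SZ f := by
  induction n with
  | zero => rw [RelN] at h; exact h ▸ hg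
  | succ n ih =>
    obtain ⟨u, hu, hu'⟩ := h
    exact ih hu (hu'.sz_left hq hg)

theorem orth_iff (hq : QF R) (c c' : Chain R) (n : ℕ) :
    Orth R (c.X 0) (c'.X 0) ↔ Orth R (c.X n) (c'.X n) := by
  constructor
  · intro h g
    obtain ⟨f, hf⟩ := RelN.ex_left hq n g
    exact hf.sz_right (h f)
  · intro h f
    obtain ⟨g, hg⟩ := RelN.ex_right n f
    exact hg.sz_left hq (h g)

theorem stable_down (hq : QF R) (c c' : Chain R) (n : ℕ) (e : c.X n ≃ₗ[R] c'.X n)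
    (h : Red R (c.X 0)) (h' : Red R (c'.X 0)) : Nonempty (c.X 0 ≃ₗ[R] c'.X 0) := by
  obtain ⟨f, hf⟩ := RelN.ex_left hq n e.toLinearMap
  obtain ⟨g, hg⟩ := RelN.ex_left hq n e.symm.toLinearMap
  have h1 := (RelN.id n).sub (hf.comp hg)
  have h2 := (RelN.id n).sub (hg.comp hf)
  have z1 : SZ (LinearMap.id - e.symm.toLinearMap ∘ₗ e.toLinearMap) := by
    convert SZ.zero using 1; ext; simp
  have z2 : SZ (LinearMap.id - e.toLinearMap ∘ₗ e.symm.toLinearMap) := by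
    convert SZ.zero using 1; ext; simp
  exact ⟨LinearEquiv.ofBijective f (h.stable_iso h' f g (h1.sz_left hq z1) (h2.sz_left hq z2))⟩

theorem sz_jac (hq : QF R) (hc : c.Min) {M : Type} [AddCommGroup M] [Module R M] (j : ℕ)
    (f : c.X (j + 1) →ₗ[R] M) (hf : SZ f) (x) : f x ∈ Ring.jacobson R • (⊤ : Submodule R M) := by
  obtain ⟨g, hg⟩ := hq.sz_ext hf (c.i j) (c.inj j)
  rw [← hg]
  exact map_jac g (hc j x)

theorem red [IsNoetherianRing R] (hq : QF R) (hc : c.Min) (j : ℕ) : Red R (c.X (j + 1)) := by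
  intro e he
  have hs : Function.Surjective (LinearMap.id - e : c.X (j+1) →ₗ[R] c.X (j+1)) := by
    rw [← LinearMap.range_eq_top]
    apply nak
    intro x
    refine ⟨_, ⟨x, rfl⟩, ?_⟩
    simpa using sz_jac hq hc j e he x
  exact ⟨IsNoetherian.injective_of_surjective_endomorphism _ hs, hs⟩

theorem ex_inj [IsNoetherianRing R] (hq : QF R) (hc : c.Min) (e : c.X 0 ≃ₗ[R] c'.X 0) (j : ℕ) :
    ∃ f : c.X j →ₗ[R] c'.X j, Function.Injective f := by
  cases j with
  | zero => exact ⟨e.toLinearMap, e.injective⟩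
  | succ j =>
    obtain ⟨f, hf⟩ := RelN.ex_right (j + 1) e.toLinearMap
    obtain ⟨g, hg⟩ := RelN.ex_right (j + 1) e.symm.toLinearMap
    have h1 := (RelN.id (j + 1)).sub (hf.comp hg)
    have z1 : SZ (LinearMap.id - e.symm.toLinearMap ∘ₗ e.toLinearMap) := by
      convert SZ.zero using 1; ext; simp
    exact ⟨f, (red hq hc j).inj f g (h1.sz_right z1)⟩

theorem uniq [IsNoetherianRing R] (hq : QF R) (hc : c.Min) (hc' : c'.Min)
    (e : c.X 0 ≃ₗ[R] c'.X 0) (j : ℕ) : Nonempty (c.X j ≃ₗ[R] c'.X j) := by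
  cases j with
  | zero => exact ⟨e⟩
  | succ j =>
    obtain ⟨f, hf⟩ := RelN.ex_right (j + 1) e.toLinearMap
    obtain ⟨g, hg⟩ := RelN.ex_right (j + 1) e.symm.toLinearMap
    have h1 := (RelN.id (j + 1)).sub (hf.comp hg)
    have h2 := (RelN.id (j + 1)).sub (hg.comp hf)
    have z1 : SZ (LinearMap.id - e.symm.toLinearMap ∘ₗ e.toLinearMap) := by
      convert SZ.zero using 1; ext; simp
    have z2 : SZ (LinearMap.id - e.toLinearMap ∘ₗ e.symm.toLinearMap) := by
      convert SZ.zero using 1; ext; simp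
    exact ⟨LinearEquiv.ofBijective f ((red hq hc j).stable_iso (red hq hc' j) f g
      (h1.sz_right z1) (h2.sz_right z2))⟩

theorem Min.drop (hc : c.Min) (n : ℕ) : (c.drop n).Min := fun j x => hc (n + j) x

end Chain

section Cover

variable {R : Type} [Ring R] [IsArtinianRing R]

theorem jac_le (M : Type) [AddCommGroup M] [Module R M] [Module.Finite R M] :
    Module.jacobson R M ≤ Ring.jacobson R • (⊤ : Submodule R M) := by
  have hss : IsSemisimpleModule R (R ⧸ Ring.jacobson R) := by
    have hR : IsSemisimpleModule (R ⧸ Ring.jacobson R) (R ⧸ Ring.jacobson R) :=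
      (IsSemiprimaryRing.isSemisimpleRing : IsSemisimpleRing (R ⧸ Ring.jacobson R))
    let l : (R ⧸ Ring.jacobson R) →ₛₗ[Ideal.Quotient.mk (Ring.jacobson R)] (R ⧸ Ring.jacobson R) :=
      { toFun := id, map_add' := fun _ _ => rfl, map_smul' := fun r x => by
          obtain ⟨x, rfl⟩ := Ideal.Quotient.mk_surjective x
          rfl }
    exact (LinearMap.isSemisimpleModule_iff_of_bijective l Function.bijective_id).2 hR
  let Q := M ⧸ (Ring.jacobson R • (⊤ : Submodule R M))
  obtain ⟨n, p, hp⟩ := Module.Finite.exists_fin' R Q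
  have hJ : ∀ r ∈ Ring.jacobson R, ∀ q : Q, r • q = 0 := by
    intro r hr q
    obtain ⟨m, rfl⟩ := Submodule.mkQ_surjective _ q
    rw [← map_smul]
    exact (Submodule.Quotient.mk_eq_zero _).2 (Submodule.smul_mem_smul hr trivial)
  let d : (Fin n → R) →ₗ[R] (Fin n → R ⧸ Ring.jacobson R) :=
    LinearMap.pi fun j => (Submodule.mkQ (Ring.jacobson R)) ∘ₗ LinearMap.proj j
  have hd : Function.Surjective d := by
    intro y
    choose x hx using fun j => Submodule.mkQ_surjective _ (y j)
    exact ⟨x, by ext j; simp only [d, LinearMap.pi_apply, LinearMap.comp_apply,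
      LinearMap.proj_apply]; exact hx j⟩
  obtain ⟨f, hf⟩ := ex_desc d hd p (fun x hx => by
    have hx' : ∀ j, x j ∈ Ring.jacobson R := by
      intro j
      have := congrFun hx j
      exact (Submodule.Quotient.mk_eq_zero _).1 this
    rw [← Finset.univ_sum_single x, map_sum]
    apply Finset.sum_eq_zero
    intro j _
    have : (Pi.single j (x j) : Fin n → R) = x j • Pi.single j 1 := by
      rw [← Pi.single_smul]; simp
    rw [this, map_smul]
    exact hJ _ (hx' j) _)
  have hfs : Function.Surjective f := fun q => by
    obtain ⟨x, rfl⟩ := hp q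
    exact ⟨d x, hf x⟩
  have : IsSemisimpleModule R Q := IsSemisimpleModule.of_surjective f hfs
  have h3 := IsSemisimpleModule.jacobson_le_ker R R M Q
    (Submodule.mkQ (Ring.jacobson R • (⊤ : Submodule R M)))
  rwa [Submodule.ker_mkQ] at h3

theorem ex_cover (M : Type) [AddCommGroup M] [Module R M] [Module.Finite R M] :
    ∃ (P : ModuleCat.{0} R) (p : P →ₗ[R] M), Module.Projective R P ∧ Module.Finite R P ∧
      Function.Surjective p ∧ ∀ x, p x = 0 → x ∈ Ring.jacobson R • (⊤ : Submodule R P) := by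
  obtain ⟨n, q, hq⟩ := Module.Finite.exists_fin' R M
  obtain ⟨P, hP, hmin⟩ := WellFounded.has_min (wellFounded_lt (α := Submodule R (Fin n → R)))
    {P | Submodule.map q P = ⊤} ⟨⊤, by simpa [LinearMap.range_eq_top] using hq⟩
  let p : P →ₗ[R] M := q ∘ₗ P.subtype
  have hp : Function.Surjective p := by
    rw [← LinearMap.range_eq_top, LinearMap.range_comp, Submodule.range_subtype]; exact hP
  have hess : ∀ N : Submodule R P, Submodule.map p N = ⊤ → N = ⊤ := by
    intro N hN
    by_contra hne
    refine hmin (N.map P.subtype) (by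
      show Submodule.map q _ = ⊤
      rw [← Submodule.map_comp]; exact hN) ?_
    refine lt_of_le_of_ne (Submodule.map_subtype_le _ _) (fun h => hne ?_)
    apply Submodule.map_injective_of_injective P.subtype_injective
    rw [h]; simp
  obtain ⟨l, hl⟩ := proj_lift p hp q
  have hls : Function.Surjective (l ∘ₗ P.subtype) := by
    rw [← LinearMap.range_eq_top]
    apply hess
    rw [← LinearMap.range_comp, LinearMap.range_eq_top]
    intro m
    obtain ⟨x, rfl⟩ := hp m
    exact ⟨x, hl x⟩
  have hli := IsNoetherian.injective_of_surjective_endomorphism _ hls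
  let e := LinearEquiv.ofBijective _ ⟨hli, hls⟩
  have hproj : Module.Projective R P := by
    refine Module.Projective.of_split (M := Fin n → R) P.subtype (e.symm.toLinearMap ∘ₗ l) ?_
    ext x : 1
    show e.symm ((l ∘ₗ P.subtype) x) = x
    exact e.symm_apply_apply x
  refine ⟨ModuleCat.of R P, p, hproj, inferInstanceAs (Module.Finite R P), hp, fun x hx => ?_⟩
  apply jac_le (R := R) P
  show x ∈ Module.jacobson R P
  rw [Module.jacobson, Submodule.mem_sInf]
  intro N hN
  by_contra hxN
  apply hN.1
  apply hess
  have h2 : N ⊔ LinearMap.ker p = ⊤ := by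
    apply hN.2
    refine lt_of_le_of_ne le_sup_left (fun h => hxN ?_)
    rw [h]
    exact Submodule.mem_sup_right hx
  have h3 := congrArg (Submodule.map p) h2
  rw [Submodule.map_sup] at h3
  have h4 : Submodule.map p (LinearMap.ker p) = ⊥ := by
    rw [eq_bot_iff]
    rintro _ ⟨y, hy, rfl⟩
    exact hy
  rw [h4, sup_bot_eq] at h3
  rw [h3, Submodule.map_top, LinearMap.range_eq_top]
  exact hp

theorem ex_chain (M : Type) [AddCommGroup M] [Module R M] [Module.Finite R M] :
    ∃ c : Chain R, c.X 0 = ModuleCat.of R M ∧ c.Min := by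
  let T := {M : ModuleCat.{0} R // Module.Finite R M}
  have H := fun M : T => @ex_cover R _ _ M.1 _ _ M.2
  choose P p h1 h2 h3 h4 using H
  let nx : T → T := fun M => ⟨ModuleCat.of R (LinearMap.ker (p M)),
    haveI := h2 M; inferInstanceAs (Module.Finite R (LinearMap.ker (p M)))⟩
  let X : ℕ → T := fun n => Nat.rec ⟨ModuleCat.of R M, ‹_›⟩ (fun _ M => nx M) n
  refine ⟨⟨fun j => (X j).1, fun j => P (X j), fun j => (LinearMap.ker (p (X j))).subtype,
    fun j => p (X j), fun j => Submodule.subtype_injective _, fun j => h3 (X j),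
    fun j x => ⟨fun h => ⟨⟨x, h⟩, rfl⟩, ?_⟩, fun j => h1 _, fun j => h2 _⟩, rfl, ?_⟩
  · rintro ⟨y, rfl⟩; exact y.2
  · intro j x
    exact h4 _ _ x.2

end Cover

end TE

namespace TE

noncomputable section

open Module

section Frob

variable {R : Type} [Ring R]

theorem QF.of_frob (k : Type) [Field k] [Algebra k R] [FiniteDimensional k R] (lam : R →ₗ[k] k)
    (h : ∀ φ : R →ₗ[k] k, ∃ y, ∀ r, lam (r * y) = φ r) : QF R := by
  let T : R →ₗ[k] (R →ₗ[k] k) :=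
    { toFun := fun y => lam ∘ₗ LinearMap.mulRight k y
      map_add' := fun x y => by ext; simp [mul_add]
      map_smul' := fun c y => by ext; simp }
  have hTs : Function.Surjective T := fun φ => by
    obtain ⟨y, hy⟩ := h φ
    exact ⟨y, by ext r; exact hy r⟩
  have hTi : Function.Injective T :=
    (LinearMap.injective_iff_surjective_of_finrank_eq_finrank
      (Subspace.dual_finrank_eq).symm).2 hTs
  have inj : ∀ x y : R, (∀ r, lam (r * x) = lam (r * y)) → x = y := fun x y hxy =>
    hTi (by ext r; exact hxy r)
  have key : ∀ (Y : Type) [AddCommGroup Y] [Module R Y] [Module k Y] [IsScalarTower k R Y]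
      (φ : Y →ₗ[k] k), ∃ g : Y →ₗ[R] R, ∀ y r, lam (r * g y) = φ (r • y) := by
    intro Y _ _ _ _ φ
    choose g hg using fun y : Y => h (φ ∘ₗ (LinearMap.toSpanSingleton R Y y).restrictScalars k)
    refine ⟨⟨⟨g, fun x y => inj _ _ fun r => ?_⟩, fun s x => inj _ _ fun r => ?_⟩, hg⟩
    · rw [mul_add, map_add, hg, hg, hg]; simp
    · rw [hg, RingHom.id_apply, smul_eq_mul, ← mul_assoc, hg]; simp [mul_smul]
  constructor
  · intro X Y _ _ _ _ i hi f
    let : Module k X := Module.compHom X (algebraMap k R)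
    let : Module k Y := Module.compHom Y (algebraMap k R)
    have : IsScalarTower k R X := IsScalarTower.of_compHom k R X
    have : IsScalarTower k R Y := IsScalarTower.of_compHom k R Y
    obtain ⟨p, hp⟩ := LinearMap.exists_leftInverse_of_injective (i.restrictScalars k)
      (LinearMap.ker_eq_bot.2 hi)
    obtain ⟨g, hg⟩ := key Y ((lam ∘ₗ f.restrictScalars k) ∘ₗ p)
    refine ⟨g, fun x => inj _ _ fun r => ?_⟩
    have : p (i (r • x)) = r • x := LinearMap.congr_fun hp (r • x)
    rw [hg, ← map_smul]
    show lam (f (p (i (r • x)))) = _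
    rw [this, map_smul, smul_eq_mul]
  · intro X _ _ _
    let : Module k X := Module.compHom X (algebraMap k R)
    have : IsScalarTower k R X := IsScalarTower.of_compHom k R X
    have : Module.Finite k X := Module.Finite.trans R X
    let b := Module.finBasis k X
    choose g hg using fun j => key X (b.coord j)
    refine ⟨_, LinearMap.pi g, (injective_iff_map_eq_zero _).2 fun x hx => ?_⟩
    apply b.ext_elem
    intro j
    have h1 : g j x = 0 := congrFun hx j
    have h2 := hg j x 1
    rw [h1] at h2
    simpa using h2.symm

end Frob

section Res

variable {R R' : Type} [Ring R] [Ring R'] (ρ : R' →+* R)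

abbrev rs (M : ModuleCat.{0} R) : ModuleCat.{0} R' := (ModuleCat.restrictScalars ρ).obj M

def rsm {M N : ModuleCat.{0} R} (f : M →ₗ[R] N) : rs ρ M →ₗ[R'] rs ρ N where
  toFun := f
  map_add' := f.map_add
  map_smul' r x := f.map_smul (ρ r) x

structure Good : Prop where
  proj : Module.Projective R' (rs ρ (ModuleCat.of R R))
  fin : Module.Finite R' (rs ρ (ModuleCat.of R R))
  jac : ∀ r ∈ Ring.jacobson R, ∃ (ι : Type) (_ : Fintype ι) (g : ι → R') (s : ι → R),
    (∀ i, g i ∈ Ring.jacobson R') ∧ r = ∑ i, ρ (g i) * s i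

variable {ρ}

theorem Good.projP (h : Good ρ) (P : ModuleCat.{0} R) [Module.Projective R P] [Module.Finite R P] :
    Module.Projective R' (rs ρ P) ∧ Module.Finite R' (rs ρ P) := by
  obtain ⟨n, p, hp⟩ := Module.Finite.exists_fin' R P
  obtain ⟨s, hs⟩ := proj_lift p hp (LinearMap.id : P →ₗ[R] P)
  have := h.proj
  have := h.fin
  let W := Fin n → rs ρ (ModuleCat.of R R)
  have hW : Module.Projective R' W :=
    Module.Projective.of_equiv (M := Π₀ _ : Fin n, rs ρ (ModuleCat.of R R))
      (DFinsupp.linearEquivFunOnFintype (R := R'))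
  have hWf : Module.Finite R' W := inferInstance
  let a : rs ρ P →ₗ[R'] W := ⟨⟨s, s.map_add⟩, fun r x => s.map_smul (ρ r) x⟩
  let b : W →ₗ[R'] rs ρ P := ⟨⟨p, p.map_add⟩, fun r x => p.map_smul (ρ r) x⟩
  exact ⟨Module.Projective.of_split a b (by ext x; exact hs x),
    Module.Finite.of_surjective b hp⟩

def Chain.res (h : Good ρ) (c : Chain R) : Chain R' where
  X j := rs ρ (c.X j)
  P j := rs ρ (c.P j)
  i j := rsm ρ (c.i j)
  p j := rsm ρ (c.p j)
  inj j := c.inj j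
  surj j := c.surj j
  ex j := c.ex j
  proj j := (h.projP (c.P j)).1
  fin j := (h.projP (c.P j)).2

theorem Chain.res_min (h : Good ρ) {c : Chain R} (hc : c.Min) : (c.res h).Min := by
  intro j x
  have key : ∀ y : c.P j, y ∈ Ring.jacobson R • (⊤ : Submodule R (c.P j)) →
      (show rs ρ (c.P j) from y) ∈ Ring.jacobson R' • (⊤ : Submodule R' (rs ρ (c.P j))) := by
    intro y hy
    refine Submodule.smul_induction_on hy ?_ ?_
    · intro r hr n _
      obtain ⟨ι, _, g, s, hg, rfl⟩ := h.jac r hr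
      rw [Finset.sum_smul]
      apply Submodule.sum_mem
      intro l _
      rw [mul_smul]
      exact Submodule.smul_mem_smul (N := (⊤ : Submodule R' (rs ρ (c.P j)))) (hg l)
        (n := (s l • n)) trivial
    · intro x y hx hy
      exact Submodule.add_mem _ hx hy
  exact key _ (hc j x)

end Res

def GR (k A : Type) [Field k] [Ring A] [Algebra k A] (m : ℕ) : Type :=
  (ZMod m → A) × (ZMod m → Module.Dual k A)

namespace GR

variable {k A : Type} [Field k] [Ring A] [Algebra k A] {m : ℕ}

def a (x : GR k A m) (i : ZMod m) : A := x.1 i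
def f (x : GR k A m) (i : ZMod m) : Module.Dual k A := x.2 i

def mk (u : ZMod m → A) (v : ZMod m → Module.Dual k A) : GR k A m := (u, v)

@[simp] theorem mk_a (u : ZMod m → A) (v : ZMod m → Module.Dual k A) (i) : (mk u v).a i = u i := rfl
@[simp] theorem mk_f (u : ZMod m → A) (v : ZMod m → Module.Dual k A) (i) : (mk u v).f i = v i := rfl

theorem ext' {x y : GR k A m} (h1 : ∀ i, x.a i = y.a i) (h2 : ∀ i z, x.f i z = y.f i z) : x = y :=
  Prod.ext (funext h1) (funext fun i => LinearMap.ext (h2 i))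

instance : AddCommGroup (GR k A m) :=
  inferInstanceAs (AddCommGroup ((ZMod m → A) × (ZMod m → Module.Dual k A)))
instance : Module k (GR k A m) :=
  inferInstanceAs (Module k ((ZMod m → A) × (ZMod m → Module.Dual k A)))
instance [NeZero m] [FiniteDimensional k A] : FiniteDimensional k (GR k A m) :=
  inferInstanceAs (FiniteDimensional k ((ZMod m → A) × (ZMod m → Module.Dual k A)))

@[simp] theorem add_a (x y : GR k A m) (i) : (x + y).a i = x.a i + y.a i := rfl
@[simp] theorem add_f (x y : GR k A m) (i) : (x + y).f i = x.f i + y.f i := rfl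
@[simp] theorem zero_a (i) : (0 : GR k A m).a i = 0 := rfl
@[simp] theorem zero_f (i) : (0 : GR k A m).f i = 0 := rfl
@[simp] theorem smul_a (c : k) (x : GR k A m) (i) : (c • x).a i = c • x.a i := rfl
@[simp] theorem smul_f (c : k) (x : GR k A m) (i) (z) : (c • x).f i z = c • x.f i z := rfl

instance : Mul (GR k A m) := ⟨fun x y => mk (fun i => x.a i * y.a i)
  (fun i => y.f i ∘ₗ LinearMap.mulRight k (x.a i) + x.f i ∘ₗ LinearMap.mulLeft k (y.a (i - 1)))⟩
instance : One (GR k A m) := ⟨mk (fun _ => 1) (fun _ => 0)⟩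

@[simp] theorem one_a (i) : (1 : GR k A m).a i = 1 := rfl
@[simp] theorem one_f (i) : (1 : GR k A m).f i = 0 := rfl
@[simp] theorem mul_a (x y : GR k A m) (i) : (x * y).a i = x.a i * y.a i := rfl
@[simp] theorem mul_f (x y : GR k A m) (i) (z) :
    (x * y).f i z = y.f i (z * x.a i) + x.f i (y.a (i - 1) * z) := rfl

instance : Ring (GR k A m) :=
  { (inferInstance : AddCommGroup (GR k A m)) with
    mul := (· * ·)
    one := 1
    left_distrib := fun x y z => ext' (by simp [mul_add]) (by
      intros; simp [add_mul]; abel)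
    right_distrib := fun x y z => ext' (by simp [add_mul]) (by
      intros; simp [mul_add]; abel)
    zero_mul := fun x => ext' (by simp) (by intros; simp)
    mul_zero := fun x => ext' (by simp) (by intros; simp)
    mul_assoc := fun x y z => ext' (by simp [mul_assoc]) (by
      intros; simp [mul_assoc, add_assoc])
    one_mul := fun x => ext' (by simp) (by intros; simp)
    mul_one := fun x => ext' (by simp) (by intros; simp) }

instance : Algebra k (GR k A m) :=
  Algebra.ofModule (fun c x y => ext' (by simp) (by intros; simp [mul_add]))
    (fun c x y => ext' (by simp) (by intros; simp [mul_add]))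

@[simp] theorem neg_a (x : GR k A m) (i) : (-x).a i = - x.a i := rfl
@[simp] theorem sub_a (x y : GR k A m) (i) : (x - y).a i = x.a i - y.a i := rfl

def ev (i : ZMod m) : GR k A m →ₐ[k] A :=
  AlgHom.ofLinearMap ⟨⟨fun x => x.a i, fun _ _ => rfl⟩, fun _ _ => rfl⟩ rfl (fun _ _ => rfl)

@[simp] theorem ev_apply (i : ZMod m) (x : GR k A m) : ev i x = x.a i := rfl

@[simp] theorem sum_a {ι : Type} (s : Finset ι) (x : ι → GR k A m) (i) :
    (∑ j ∈ s, x j).a i = ∑ j ∈ s, (x j).a i := map_sum (ev i) x s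

def evf (i : ZMod m) : GR k A m →ₗ[k] Module.Dual k A :=
  ⟨⟨fun x => x.f i, fun _ _ => rfl⟩, fun _ _ => rfl⟩

@[simp] theorem sum_f {ι : Type} (s : Finset ι) (x : ι → GR k A m) (i) :
    (∑ j ∈ s, x j).f i = ∑ j ∈ s, (x j).f i := map_sum (evf i) x s

theorem pow_a (x : GR k A m) (i) (n : ℕ) : (x ^ n).a i = x.a i ^ n := map_pow (ev i) x n

def e (d : ZMod m) : GR k A m := mk (Pi.single d 1) 0

theorem e_a (d i : ZMod m) : (e d : GR k A m).a i = if i = d then 1 else 0 := by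
  simp [e, Pi.single_apply]
@[simp] theorem e_f (d i : ZMod m) : (e d : GR k A m).f i = 0 := rfl

theorem e_mul_e (d d' : ZMod m) : (e d * e d' : GR k A m) = if d = d' then e d else 0 := by
  apply ext'
  · intro i; split_ifs with h <;> simp [e_a] <;> grind
  · intro i z; split_ifs with h <;> simp

theorem e_idem (d : ZMod m) : (e d * e d : GR k A m) = e d := by simp [e_mul_e]

theorem sum_e [NeZero m] : ∑ d, (e d : GR k A m) = 1 :=
  ext' (by intro i; simp [e_a]) (by intro i z; simp)

def cst (m : ℕ) (u : A) (v : Module.Dual k A) : GR k A m := mk (fun _ => u) (fun _ => v)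

theorem mul_e (x : GR k A m) (d : ZMod m) : x * e d = cst m (x.a d) (x.f (d + 1)) * e d := by
  apply ext'
  · intro i; simp only [mul_a, e_a, cst, mk_a]; split_ifs with h <;> simp [h]
  · intro i z; simp only [mul_f, e_a, e_f, cst, mk_f]; split_ifs with h
    · simp [← h]
    · simp

theorem eq_sum [NeZero m] (x : GR k A m) :
    x = ∑ d, cst m (x.a d) (x.f (d + 1)) * e d := by
  conv_lhs => rw [← mul_one x, ← sum_e, Finset.mul_sum]
  exact Finset.sum_congr rfl fun d _ => mul_e x d

theorem e_mul (x : GR k A m) (d c : ZMod m) (h : c ≠ d) (h' : c ≠ d - 1) : e d * x * e c = 0 := by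
  apply ext'
  · intro i; simp [e_a]; grind
  · intro i z; simp [e_a]; grind

section jac

theorem jac_a {x : GR k A m} (h : x ∈ Ring.jacobson (GR k A m)) (i) : x.a i ∈ Ring.jacobson A := by
  have hs : Function.Surjective (ev i : GR k A m →ₐ[k] A) := fun u => ⟨cst m u 0, rfl⟩
  have : RingHomSurjective (ev i : GR k A m →ₐ[k] A).toRingHom := ⟨hs⟩
  exact Ring.le_comap_jacobson (f := (ev i : GR k A m →ₐ[k] A).toRingHom) h

variable [FiniteDimensional k A]

theorem nil_of [IsArtinianRing A] {x : GR k A m} (h : ∀ i, x.a i ∈ Ring.jacobson A) :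
    IsNilpotent x := by
  obtain ⟨N, hN⟩ := (IsSemiprimaryRing.isNilpotent : IsNilpotent (Ring.jacobson A))
  refine ⟨N * 2, ?_⟩
  have h0 : ∀ i, (x ^ N).a i = 0 := by
    intro i
    rw [pow_a]
    have := Ideal.pow_mem_pow (h i) N
    rw [hN] at this
    simpa using this
  rw [pow_mul, pow_two]
  exact ext' (by intro i; simp [h0]) (by intro i z; simp [h0])

theorem mem_jac [IsArtinianRing A] {x : GR k A m} (h : ∀ i, x.a i ∈ Ring.jacobson A) :
    x ∈ Ring.jacobson (GR k A m) := by
  rw [← Ideal.jacobson_bot, Ideal.mem_jacobson_iff]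
  intro y
  have hn : IsNilpotent (y * x) := nil_of (fun i => by
    rw [mul_a]; exact Ideal.mul_mem_left _ _ (h i))
  obtain ⟨u, hu⟩ := hn.isUnit_one_add
  refine ⟨↑u⁻¹, ?_⟩
  have : (↑u⁻¹ : GR k A m) * (1 + y * x) = 1 := by rw [← hu]; simp
  rw [mul_add, mul_one, ← mul_assoc] at this
  rw [Submodule.mem_bot, ← this]; abel

end jac

variable {n : ℕ}

def pb (q : ZMod n → ZMod m) (hq : ∀ i, q (i - 1) = q i - 1) : GR k A m →ₐ[k] GR k A n :=
  AlgHom.ofLinearMap ⟨⟨fun x => mk (fun i => x.a (q i)) (fun i => x.f (q i)), fun _ _ => rfl⟩,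
    fun _ _ => rfl⟩ rfl (fun x y => ext' (fun i => rfl) (fun i z => by
      show y.f (q i) (z * x.a (q i)) + x.f (q i) (y.a (q i - 1) * z) =
        y.f (q i) (z * x.a (q i)) + x.f (q i) (y.a (q (i - 1)) * z)
      rw [hq]))

section pb
variable (q : ZMod n → ZMod m) (hq : ∀ i, q (i - 1) = q i - 1)

@[simp] theorem pb_a (x : GR k A m) (i) : (pb q hq x).a i = x.a (q i) := rfl
@[simp] theorem pb_f (x : GR k A m) (i) : (pb q hq x).f i = x.f (q i) := rfl

theorem good_pb [NeZero n] [FiniteDimensional k A] :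
    Good (pb q hq : GR k A m →ₐ[k] GR k A n).toRingHom := by
  have hq' : ∀ i, q (i + 1) = q i + 1 := fun i => by
    have := hq (i + 1); rw [add_sub_cancel_right] at this; rw [this, sub_add_cancel]
  have : IsArtinianRing A := IsArtinianRing.of_finite k A
  let ρ := (pb q hq : GR k A m →ₐ[k] GR k A n).toRingHom
  let W := rs ρ (ModuleCat.of (GR k A n) (GR k A n))
  let Ψ : (ZMod n → GR k A m) →ₗ[GR k A m] W :=
    { toFun := fun y => (∑ d, pb q hq (y d) * e d : GR k A n)
      map_add' := fun x y => by
        simp only [Pi.add_apply, map_add, add_mul, Finset.sum_add_distrib]; rfl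
      map_smul' := fun r x => by
        have : (∑ d, pb q hq ((r • x) d) * e d : GR k A n) =
            pb q hq r * ∑ d, pb q hq (x d) * e d := by
          rw [Finset.mul_sum]
          exact Finset.sum_congr rfl fun d _ => by simp [mul_assoc]
        exact this }
  let Φ : W →ₗ[GR k A m] (ZMod n → GR k A m) :=
    { toFun := fun x d => mk (Pi.single (q d) (GR.a (k := k) x d))
        (Pi.single (q d + 1) (GR.f (k := k) x (d + 1)))
      map_add' := fun x y => by
        funext d
        apply ext'
        · intro i
          show (Pi.single (q d) (GR.a (k := k) x d + GR.a (k := k) y d) : ZMod m → A) i =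
            (Pi.single (q d) (GR.a (k := k) x d) : ZMod m → A) i +
            (Pi.single (q d) (GR.a (k := k) y d) : ZMod m → A) i
          rw [Pi.single_add, Pi.add_apply]
        · intro i z
          show (Pi.single (q d + 1) (GR.f (k := k) x (d+1) + GR.f (k := k) y (d+1)) :
              ZMod m → Module.Dual k A) i z =
            (Pi.single (q d + 1) (GR.f (k := k) x (d+1)) : ZMod m → Module.Dual k A) i z +
            (Pi.single (q d + 1) (GR.f (k := k) y (d+1)) : ZMod m → Module.Dual k A) i z
          rw [Pi.single_add, Pi.add_apply]; rfl
      map_smul' := fun r x => by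
        funext d
        obtain ⟨x', hx'⟩ : ∃ x' : GR k A n, x' = x := ⟨x, rfl⟩
        subst hx'
        show (mk (Pi.single (q d) ((pb q hq r * x').a d))
          (Pi.single (q d + 1) ((pb q hq r * x').f (d + 1))) : GR k A m) =
          r * mk (Pi.single (q d) (GR.a (k := k) x' d))
            (Pi.single (q d + 1) (GR.f (k := k) x' (d + 1)))
        apply ext'
        · intro i
          simp only [mk_a, mul_a, pb_a, Pi.single_apply]
          split_ifs with h <;> simp [h]
        · intro i z
          simp only [mk_a, mk_f, mul_a, mul_f, pb_a, Pi.single_apply]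
          by_cases h : i = q d + 1
          · simp [h, hq']
          · have h' : ¬ (i - 1 = q d) := fun hh => h (by rw [← hh]; ring)
            simp [h, h'] }
  have h : Ψ ∘ₗ Φ = LinearMap.id := by
    apply LinearMap.ext
    intro x
    obtain ⟨x', hx'⟩ : ∃ x' : GR k A n, x' = x := ⟨x, rfl⟩
    subst hx'
    show (∑ d, pb q hq (mk (Pi.single (q d) (GR.a (k := k) x' d))
      (Pi.single (q d + 1) (GR.f (k := k) x' (d + 1)))) * e d : GR k A n) = x'
    conv_rhs => rw [eq_sum x']
    refine Finset.sum_congr rfl fun d _ => ?_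
    rw [mul_e]
    simp [hq']
  refine ⟨Module.Projective.of_split Φ Ψ h, Module.Finite.of_surjective Ψ (fun x => ⟨Φ x,
    LinearMap.congr_fun h x⟩), fun r hr => ⟨ZMod n, inferInstance,
    fun d => cst m (r.a d) (r.f (d + 1)), fun d => e d, fun d => mem_jac fun i => jac_a hr d, ?_⟩⟩
  exact eq_sum r

end pb

theorem qf [NeZero m] [FiniteDimensional k A] : QF (GR k A m) := by
  let lam : GR k A m →ₗ[k] k := ∑ i, (LinearMap.applyₗ (1 : A)) ∘ₗ evf i
  have hl : ∀ x : GR k A m, lam x = ∑ i, x.f i 1 := fun x => by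
    simp only [lam, LinearMap.sum_apply]; rfl
  refine QF.of_frob k lam fun φ => ?_
  let ia : ∀ i : ZMod m, A →ₗ[k] GR k A m := fun i =>
    LinearMap.inl k _ _ ∘ₗ LinearMap.single k (fun _ => A) i
  let iF : ∀ i : ZMod m, Module.Dual k A →ₗ[k] GR k A m := fun i =>
    LinearMap.inr k _ _ ∘ₗ LinearMap.single k (fun _ => Module.Dual k A) i
  refine ⟨mk (fun i => (Module.evalEquiv k A).symm (φ ∘ₗ iF (i + 1))) (fun i => φ ∘ₗ ia i),
    fun r => ?_⟩
  have hr : r = ∑ i, (ia i (r.a i) + iF i (r.f i)) := by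
    apply ext'
    · intro i
      rw [sum_a]
      rw [Finset.sum_eq_single i]
      · show _ = (Pi.single i (r.a i) : ZMod m → A) i + 0
        simp
      · intro j _ hj
        show (Pi.single j (r.a j) : ZMod m → A) i + 0 = 0
        simp [hj.symm]
      · simp
    · intro i z
      rw [sum_f]
      rw [Finset.sum_eq_single i]
      · show _ = ((0 : Module.Dual k A) + (Pi.single i (r.f i) : ZMod m → Module.Dual k A) i) z
        simp
      · intro j _ hj
        show ((0 : Module.Dual k A) + (Pi.single j (r.f j) : ZMod m → Module.Dual k A) i) = 0
        simp [hj.symm]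
      · simp
  conv_rhs => rw [hr, map_sum]
  rw [hl]
  refine Finset.sum_congr rfl fun i _ => ?_
  rw [mul_f, map_add]
  simp only [mk_f, mk_a, one_mul, mul_one, sub_add_cancel, LinearMap.comp_apply]
  congr 1
  have := LinearMap.congr_fun ((Module.evalEquiv k A).apply_symm_apply (φ ∘ₗ iF i)) (r.f i)
  simpa using this

theorem soc [NeZero m] [FiniteDimensional k A] {p : GR k A m}
    (h : ∀ j ∈ Ring.jacobson (GR k A m), j * p = 0) :
    ∀ j ∈ Ring.jacobson (GR k A m), p * j = 0 := by
  have : IsArtinianRing A := IsArtinianRing.of_finite k A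
  have ha : ∀ i, p.a i = 0 := by
    intro i
    apply (Module.forall_dual_apply_eq_zero_iff k _).1
    intro g
    have h1 := h (mk 0 (fun _ => g)) (mem_jac fun i => by simp)
    have h2 := congrArg (fun t => GR.f t (i + 1) 1) h1
    simpa using h2
  have hf : ∀ i, ∀ u ∈ Ring.jacobson A, ∀ z, p.f i (z * u) = 0 := by
    intro i u hu z
    have h1 := h (mk (fun _ => u) 0) (mem_jac fun i => by simpa using hu)
    have h2 := congrArg (fun t => GR.f t i z) h1
    simpa using h2
  intro j hj
  apply ext'
  · intro i; simp [ha]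
  · intro i z
    simp only [mul_f, ha, mul_zero, map_zero, zero_add, zero_f, LinearMap.zero_apply]
    have := hf i (j.a (i - 1) * z) (Ideal.mul_mem_right _ _ (jac_a hj _)) 1
    simpa using this

end GR

end

end TE

namespace TE

noncomputable section

open Module

section kd

variable (k : Type) [Field k] {R R' : Type} [Ring R] [Algebra k R] [Ring R'] [Algebra k R']

theorem kDim_inj [FiniteDimensional k R] {X Y : Type} [AddCommGroup X] [Module R X]
    [AddCommGroup Y] [Module R Y] [Module.Finite R Y] (f : X →ₗ[R] Y) (hf : Function.Injective f) :
    kDim k R X ≤ kDim k R Y := by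
  unfold kDim
  let : Module k X := Module.compHom X (algebraMap k R)
  let : Module k Y := Module.compHom Y (algebraMap k R)
  have : IsScalarTower k R X := IsScalarTower.of_compHom k R X
  have : IsScalarTower k R Y := IsScalarTower.of_compHom k R Y
  have : Module.Finite k Y := Module.Finite.trans R Y
  exact LinearMap.finrank_le_finrank_of_injective (f := f.restrictScalars k) hf

theorem kDim_surj [FiniteDimensional k R] {X Y : Type} [AddCommGroup X] [Module R X]
    [AddCommGroup Y] [Module R Y] [Module.Finite R X] (f : X →ₗ[R] Y) (hf : Function.Surjective f) :
    kDim k R Y ≤ kDim k R X := by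
  unfold kDim
  let : Module k X := Module.compHom X (algebraMap k R)
  let : Module k Y := Module.compHom Y (algebraMap k R)
  have : IsScalarTower k R X := IsScalarTower.of_compHom k R X
  have : IsScalarTower k R Y := IsScalarTower.of_compHom k R Y
  have : Module.Finite k X := Module.Finite.trans R X
  exact LinearMap.finrank_le_finrank_of_surjective (f := f.restrictScalars k) hf

theorem kDim_rs (ρ : R' →ₐ[k] R) (X : ModuleCat.{0} R) :
    kDim k R' (rs ρ.toRingHom X) = kDim k R X := by
  unfold kDim
  congr 1
  refine Module.ext ?_
  funext c x
  show (ρ (algebraMap k R' c)) • (show (X : Type) from x) = algebraMap k R c • (show (X : Type) from x)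
  rw [ρ.commutes]

def resChain (M : Type) [AddCommGroup M] [Module R M] (P : ℕ → ModuleCat.{0} R)
    (f : ∀ i, P (i + 1) →ₗ[R] P i) (π : (P 0 : Type) →ₗ[R] M)
    (h1 : ∀ i, Module.Projective R (P i)) (h2 : ∀ i, Module.Finite R (P i))
    (hs : Function.Surjective π) (h0 : LinearMap.range (f 0) = LinearMap.ker π)
    (h : ∀ i, LinearMap.range (f (i + 1)) = LinearMap.ker (f i)) : Chain R where
  X j := match j with
    | 0 => ModuleCat.of R M
    | j + 1 => ModuleCat.of R (LinearMap.range (f j))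
  P := P
  i j := (LinearMap.range (f j)).subtype
  p j := match j with
    | 0 => π
    | j + 1 => (f j).rangeRestrict
  inj j := Submodule.subtype_injective _
  surj j := match j with
    | 0 => hs
    | j + 1 => LinearMap.surjective_rangeRestrict _
  ex j := match j with
    | 0 => fun x => by
      show x ∈ LinearMap.ker π ↔ _
      rw [← h0]
      exact ⟨fun hx => ⟨⟨x, hx⟩, rfl⟩, fun ⟨y, hy⟩ => hy ▸ y.2⟩
    | j + 1 => fun x => by
      have : (f j).rangeRestrict x = 0 ↔ x ∈ LinearMap.ker (f j) := by
        rw [LinearMap.mem_ker, ← Subtype.coe_inj]; rfl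
      refine this.trans ?_
      rw [← h]
      exact ⟨fun hx => ⟨⟨x, hx⟩, rfl⟩, fun ⟨y, hy⟩ => hy ▸ y.2⟩
  proj := h1
  fin := h2

theorem cx_bound [FiniteDimensional k R] (hq : QF R) (M : Type) [AddCommGroup M] [Module R M]
    (h : ComplexityLeOne k R M) : ∃ C : ℕ, ∀ c : Chain R, c.Min → Nonempty (c.X 0 ≃ₗ[R] M) →
      ∀ j, kDim k R (c.X j) ≤ C := by
  obtain ⟨C, P, f, π, h1, h2, h3, h4, h5, h6⟩ := h
  have : IsNoetherianRing R := IsNoetherianRing.of_finite k R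
  refine ⟨C, fun c hc ⟨e⟩ j => ?_⟩
  let L := resChain M P f π h1 h2 h4 h5 h6
  obtain ⟨g, hg⟩ := Chain.ex_inj (c' := L) hq hc e j
  exact (kDim_inj k g hg).trans ((kDim_surj k (L.p j) (L.surj j)).trans (h3 j))

end kd

section eqv

variable {R R' : Type} [Ring R] [Ring R']

theorem good_equiv (ρ : R' ≃+* R) : Good ρ.toRingHom := by
  let e : R' ≃ₗ[R'] rs ρ.toRingHom (ModuleCat.of R R) :=
    { toFun := fun x => (ρ x : R)
      map_add' := fun x y => ρ.map_add x y
      map_smul' := fun r x => ρ.map_mul r x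
      invFun := fun x => ρ.symm (show R from x)
      left_inv := fun x => ρ.symm_apply_apply x
      right_inv := fun x => ρ.apply_symm_apply (show R from x) }
  have : RingHomSurjective ρ.symm.toRingHom := ⟨ρ.symm.surjective⟩
  refine ⟨Module.Projective.of_equiv e, Module.Finite.equiv e, fun r hr =>
    ⟨Unit, inferInstance, fun _ => ρ.symm r, fun _ => 1, fun _ =>
      Ring.le_comap_jacobson (f := ρ.symm.toRingHom) hr, ?_⟩⟩
  simp

theorem QF.equiv (ρ : R' ≃+* R) (h : QF R) : QF R' := by
  have back : ∀ (X : Type) [AddCommGroup X] [Module R' X] (n : ℕ)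
      (f : rs ρ.symm.toRingHom (ModuleCat.of R' X) →ₗ[R] (Fin n → R)),
      ∃ g : X →ₗ[R'] (Fin n → R'), ∀ x j, g x j = ρ.symm (f x j) := by
    intro X _ _ n f
    refine ⟨⟨⟨fun x j => ρ.symm (f x j), fun x y => ?_⟩, fun r x => ?_⟩, fun x j => rfl⟩
    · funext j
      have := congrFun (f.map_add x y) j
      exact (congrArg ρ.symm this).trans (ρ.symm.map_add _ _)
    · funext j
      have h1 := congrFun (f.map_smul (ρ r) x) j
      have h2 : ρ r • (show rs ρ.symm.toRingHom (ModuleCat.of R' X) from x) = (r • (show X from x)) := by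
        show (ρ.symm (ρ r)) • (show X from x) = _
        rw [ρ.symm_apply_apply]
      rw [h2] at h1
      refine (congrArg ρ.symm h1).trans ?_
      simp
  constructor
  · intro X Y _ _ _ _ i hi f
    let f' : rs ρ.symm.toRingHom (ModuleCat.of R' X) →ₗ[R] R :=
      { toFun := fun x => ρ (f x)
        map_add' := fun x y => by
          exact (congrArg ρ (f.map_add x y)).trans (ρ.map_add _ _)
        map_smul' := fun r x => by
          have := f.map_smul (ρ.symm r) x
          refine (congrArg ρ this).trans ?_
          simp }
    obtain ⟨g, hg⟩ := h.ext _ _ (rsm ρ.symm.toRingHom (M := ModuleCat.of R' X)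
      (N := ModuleCat.of R' Y) i) hi f'
    obtain ⟨g', hg'⟩ := back Y 1 (LinearMap.pi fun _ => g)
    refine ⟨LinearMap.proj 0 ∘ₗ g', fun x => ?_⟩
    have := hg' (i x) 0
    refine this.trans ?_
    have h3 : g (i x) = ρ (f x) := hg x
    show ρ.symm (g (i x)) = f x
    rw [h3, ρ.symm_apply_apply]
  · intro X _ _ _
    have : Module.Finite R (rs ρ.symm.toRingHom (ModuleCat.of R' X)) := by
      obtain ⟨n, p, hp⟩ := Module.Finite.exists_fin' R' X
      have hg := (good_equiv ρ.symm).projP (ModuleCat.of R' (Fin n → R'))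
      have := hg.2
      exact Module.Finite.of_surjective (rsm ρ.symm.toRingHom (M := ModuleCat.of R' (Fin n → R'))
        (N := ModuleCat.of R' X) p) hp
    obtain ⟨n, i, hi⟩ := h.emb (rs ρ.symm.toRingHom (ModuleCat.of R' X))
    obtain ⟨g, hg⟩ := back X n i
    refine ⟨n, g, fun x y hxy => hi ?_⟩
    funext j
    have := congrFun hxy j
    rw [hg, hg] at this
    exact ρ.symm.injective this

end eqv

section toGR

variable (k A : Type) [Field k] [Ring A] [Algebra k A]

def toGR : TrivialExtension k A →ₐ[k] GR k A 1 :=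
  AlgHom.ofLinearMap ⟨⟨fun x => GR.cst 1 x.fst x.snd, fun x y => rfl⟩, fun c x => rfl⟩ rfl
    (fun x y => GR.ext' (fun i => rfl) (fun i z => rfl))

theorem toGR_bij : Function.Bijective (toGR k A) := by
  constructor
  · intro x y h
    have h1 : x.fst = y.fst := congrArg (fun t => GR.a t 0) h
    have h2 : x.snd = y.snd := congrArg (fun t => GR.f t 0) h
    exact TrivSqZeroExt.ext h1 h2
  · intro y
    refine ⟨TrivSqZeroExt.inl (y.a 0) + TrivSqZeroExt.inr (y.f 0), GR.ext' (fun i => ?_) fun i z => ?_⟩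
    · obtain rfl : i = 0 := Subsingleton.elim _ _
      show (TrivSqZeroExt.inl (y.a 0) + TrivSqZeroExt.inr (y.f 0) : TrivialExtension k A).fst = _
      simp
    · obtain rfl : i = 0 := Subsingleton.elim _ _
      show (TrivSqZeroExt.inl (y.a 0) + TrivSqZeroExt.inr (y.f 0) : TrivialExtension k A).snd z = _
      simp

def eGR : TrivialExtension k A ≃ₐ[k] GR k A 1 := AlgEquiv.ofBijective (toGR k A) (toGR_bij k A)

theorem qfB [FiniteDimensional k A] : QF (TrivialExtension k A) :=
  QF.equiv (eGR k A).toRingEquiv GR.qf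

theorem goodB : Good (toGR k A).toRingHom := good_equiv (eGR k A).toRingEquiv

end toGR

def Deg {m : ℕ} (_ : ZMod m) (M : Type) : Type := M

section Deg

variable {k A : Type} [Field k] [Ring A] [Algebra k A] {m : ℕ} (d : ZMod m)
  {M N : Type} [AddCommGroup M] [Module A M] [AddCommGroup N] [Module A N]

instance : AddCommGroup (Deg d M) := inferInstanceAs (AddCommGroup M)
instance : Module (GR k A m) (Deg d M) := Module.compHom M (GR.ev d : GR k A m →ₐ[k] A).toRingHom

def Deg.up (x : M) : Deg d M := x
def Deg.dn {d : ZMod m} (x : Deg d M) : M := x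

theorem Deg.smul (r : GR k A m) (x : Deg d M) : r • x = Deg.up d (r.a d • x.dn) := rfl

def degm (f : M →ₗ[A] N) : Deg d M →ₗ[GR k A m] Deg d N where
  toFun x := Deg.up d (f x.dn)
  map_add' x y := f.map_add x y
  map_smul' r x := f.map_smul (r.a d) x

def degm' (f : Deg d M →ₗ[GR k A m] Deg d N) : M →ₗ[A] N where
  toFun x := (f (Deg.up d x)).dn
  map_add' x y := f.map_add x y
  map_smul' r x := f.map_smul (GR.cst m r 0) x

instance [h : Module.Finite A M] : Module.Finite (GR k A m) (Deg d M) := by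
  classical
  obtain ⟨n, s, hs⟩ := Module.Finite.exists_fin (R := A) (M := M)
  refine ⟨⟨Finset.univ.image fun i => Deg.up d (s i), ?_⟩⟩
  rw [eq_top_iff]
  intro x _
  have hx : x.dn ∈ Submodule.span A (Set.range s) := by rw [hs]; trivial
  have key : ∀ y ∈ Submodule.span A (Set.range s),
      Deg.up d y ∈ Submodule.span (GR k A m) (Set.range fun i => Deg.up d (s i)) := by
    intro y hy
    induction hy using Submodule.span_induction with
    | mem y hy => obtain ⟨i, rfl⟩ := hy; exact Submodule.subset_span ⟨i, rfl⟩
    | zero => exact Submodule.zero_mem _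
    | add y z _ _ h1 h2 => exact Submodule.add_mem _ h1 h2
    | smul r y _ h1 => exact Submodule.smul_mem _ (GR.cst m r 0) h1
  have := key _ hx
  rw [Finset.coe_image, Finset.coe_univ, Set.image_univ]
  exact this

theorem sz_deg [FiniteDimensional k A] (f : Deg d M →ₗ[GR k A m] Deg d N) (hf : SZ f) : f = 0 := by
  obtain ⟨P, h1, h2, a, b, hab⟩ := hf
  obtain ⟨n, p, hp⟩ := Module.Finite.exists_fin' (GR k A m) P
  obtain ⟨s, hs⟩ := proj_lift p hp (LinearMap.id : P →ₗ[GR k A m] P)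
  ext x
  have h3 : ∀ j, (s (a x) j).a d = 0 := by
    intro j
    apply (Module.forall_dual_apply_eq_zero_iff k _).1
    intro g
    have h4 : (GR.mk 0 (fun _ => g) : GR k A m) • x = 0 := by
      rw [Deg.smul]; simp; rfl
    have h5 : (GR.mk 0 (fun _ => g) : GR k A m) * s (a x) j = 0 := by
      have := congrArg (fun y => s (a y) j) h4
      simpa using this
    have h6 := congrArg (fun t => GR.f t (d + 1) 1) h5
    simpa using h6
  rw [hab]
  have h7 : a x = p (s (a x)) := (hs _).symm
  have h8 : s (a x) = ∑ j, s (a x) j • (Pi.single j 1 : Fin n → GR k A m) := by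
    conv_lhs => rw [← Finset.univ_sum_single (s (a x))]
    refine Finset.sum_congr rfl fun j _ => ?_
    rw [← Pi.single_smul]; simp
  rw [h7, h8, map_sum, map_sum]
  apply Finset.sum_eq_zero
  intro j _
  rw [map_smul, map_smul, Deg.smul, h3, zero_smul]; rfl

theorem red_deg [FiniteDimensional k A] : Red (GR k A m) (Deg d M) := by
  intro e he
  rw [sz_deg d e he, sub_zero]
  exact Function.bijective_id

theorem sz_soc [NeZero m] [FiniteDimensional k A] {c : Chain (GR k A m)} (hc : c.Min) (j : ℕ)
    {M : Type} [AddCommGroup M] [Module (GR k A m) M]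
    (hM : ∀ r ∈ Ring.jacobson (GR k A m), ∀ x : M, r • x = 0)
    (f : M →ₗ[GR k A m] c.X (j + 1)) (hf : SZ f) : f = 0 := by
  obtain ⟨P, h1, h2, a, b, hab⟩ := hf
  obtain ⟨n, p, hp⟩ := Module.Finite.exists_fin' (GR k A m) P
  obtain ⟨s, hs⟩ := proj_lift p hp (LinearMap.id : P →ₗ[GR k A m] P)
  ext x
  have h3 : ∀ l, ∀ r ∈ Ring.jacobson (GR k A m), s (a x) l * r = 0 := by
    intro l
    apply GR.soc
    intro r hr
    have := congrArg (fun y => s (a y) l) (hM r hr x)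
    simpa using this
  have h7 : a x = p (s (a x)) := (hs _).symm
  have h8 : s (a x) = ∑ j, s (a x) j • (Pi.single j 1 : Fin n → GR k A m) := by
    conv_lhs => rw [← Finset.univ_sum_single (s (a x))]
    refine Finset.sum_congr rfl fun j _ => ?_
    rw [← Pi.single_smul]; simp
  rw [hab, h7, h8, map_sum, map_sum]
  apply Finset.sum_eq_zero
  intro l _
  rw [map_smul, map_smul]
  apply c.inj
  rw [map_smul, map_zero]
  refine Submodule.smul_induction_on (p := fun y => s (a x) l • y = 0)
    (hc j (b (p (Pi.single l 1)))) ?_ ?_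
  · intro r hr y _
    rw [← mul_smul, h3 l r hr, zero_smul]
  · intro y z hy hz
    rw [smul_add, hy, hz, add_zero]

def Van (k A : Type) [Field k] [Ring A] [Algebra k A] {m : ℕ} (X : Type) [AddCommGroup X]
    [Module (GR k A m) X] (d : ZMod m) : Prop := ∀ x : X, (GR.e d : GR k A m) • x = 0

theorem van_deg {c : ZMod m} (h : c ≠ d) : Van k A (Deg d M) c := by
  intro x
  rw [Deg.smul, GR.e_a, if_neg h.symm, zero_smul]; rfl

theorem deg_e (x : Deg d M) : (GR.e d : GR k A m) • x = x := by
  rw [Deg.smul, GR.e_a, if_pos rfl, one_smul]; rfl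

theorem Van.equiv {X Y : Type} [AddCommGroup X] [Module (GR k A m) X] [AddCommGroup Y]
    [Module (GR k A m) Y] {d : ZMod m} (h : Van k A X d) (e : X ≃ₗ[GR k A m] Y) : Van k A Y d := by
  intro y
  have := congrArg e (h (e.symm y))
  simpa using this

theorem sum_e_smul [NeZero m] {X : Type} [AddCommGroup X] [Module (GR k A m) X] (x : X) :
    ∑ c, (GR.e c : GR k A m) • x = x := by
  rw [← Finset.sum_smul, GR.sum_e, one_smul]

theorem supp_step [NeZero m] {c : Chain (GR k A m)} (hc : c.Min) (j : ℕ) (d : ZMod m)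
    (h : Van k A (c.X j) d) (h' : Van k A (c.X j) (d - 1)) :
    Van k A (c.P j) d ∧ Van k A (c.X (j + 1)) d := by
  have hJ : ∀ d, Van k A (c.X j) d → ∀ x : c.P j, (GR.e d : GR k A m) • x ∈
      Ring.jacobson (GR k A m) • (⊤ : Submodule (GR k A m) (c.P j)) := by
    intro d h x
    obtain ⟨y, hy⟩ := (c.ex j ((GR.e d : GR k A m) • x)).1 (by rw [map_smul, h])
    rw [← hy]
    exact hc j y
  have hN := nak (Submodule.span (GR k A m)
    {y : c.P j | ∃ b x, b ≠ d ∧ b ≠ d - 1 ∧ y = (GR.e b : GR k A m) • x}) (fun x => by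
      classical
      refine ⟨∑ b ∈ Finset.univ.filter (fun b => b ≠ d ∧ b ≠ d - 1), (GR.e b : GR k A m) • x,
        Submodule.sum_mem _ fun b hb => Submodule.subset_span ⟨b, x, ?_, ?_, rfl⟩, ?_⟩
      · exact (Finset.mem_filter.1 hb).2.1
      · exact (Finset.mem_filter.1 hb).2.2
      · have hx := sum_e_smul (k := k) (A := A) (m := m) x
        nth_rewrite 1 [← hx]
        rw [← Finset.sum_filter_add_sum_filter_not Finset.univ (fun b => b ≠ d ∧ b ≠ d - 1),
          add_sub_cancel_left]
        apply Submodule.sum_mem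
        intro b hb
        have hb' := (Finset.mem_filter.1 hb).2
        have : b = d ∨ b = d - 1 := by tauto
        rcases this with rfl | rfl
        · exact hJ _ h x
        · exact hJ _ h' x)
  have h1 : Van k A (c.P j) d := by
    have key : ∀ x : c.P j, ∀ r : GR k A m, (GR.e d * r) • x = 0 := by
      intro x
      have hx : x ∈ (⊤ : Submodule (GR k A m) (c.P j)) := trivial
      rw [← hN] at hx
      induction hx using Submodule.span_induction with
      | mem x hx =>
        obtain ⟨b, y, hb, hb', rfl⟩ := hx
        intro r
        rw [← mul_smul, GR.e_mul _ _ _ hb hb', zero_smul]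
      | zero => intro r; simp
      | add x y _ _ hx hy => intro r; rw [smul_add, hx, hy, add_zero]
      | smul s x _ hx => intro r; rw [← mul_smul, mul_assoc, hx]
    intro x
    simpa using key x 1
  refine ⟨h1, fun x => c.inj j ?_⟩
  rw [map_smul, map_zero, h1]

theorem van_A [NeZero m] (hm : (1 : ZMod m) ≠ 0) {c : Chain (GR k A m)} (hc : c.Min)
    (e : c.X 0 ≃ₗ[GR k A m] Deg d A) : Van k A (c.X 1) d := by
  obtain ⟨p', hp'⟩ := c.surj 0 (e.symm (Deg.up d (1 : A)))
  obtain ⟨p0, hp0⟩ : ∃ p0 : c.P 0, p0 = (GR.e d : GR k A m) • p' := ⟨_, rfl⟩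
  have hp1 : e (c.p 0 p0) = Deg.up d (1 : A) := by
    rw [hp0, map_smul, map_smul, hp', e.apply_symm_apply, deg_e]
  have hN := nak (Submodule.span (GR k A m) {p0}) (fun x => by
    refine ⟨GR.cst m (e (c.p 0 x)).dn 0 • p0, Submodule.smul_mem _ _
      (Submodule.subset_span rfl), ?_⟩
    obtain ⟨y, hy⟩ := (c.ex 0 (x - GR.cst m (e (c.p 0 x)).dn 0 • p0)).1 (by
      apply e.injective
      rw [map_sub, map_sub, map_smul, map_smul, hp1, Deg.smul, map_zero, sub_eq_zero]
      show _ = Deg.up d ((e (c.p 0 x)).dn • (1 : A))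
      rw [smul_eq_mul, mul_one]; rfl)
    rw [← hy]
    exact hc 0 y)
  intro x
  apply c.inj 0
  rw [map_smul, map_zero]
  have hx : c.i 0 x ∈ Submodule.span (GR k A m) {p0} := by rw [hN]; trivial
  obtain ⟨r, hr⟩ := Submodule.mem_span_singleton.1 hx
  have h0 : r.a d = 0 := by
    have h1 := congrArg (fun y => (e (c.p 0 y)).dn) hr
    simp only [map_smul, hp1, c.pi, map_zero] at h1
    have h2 : r.a d • (1 : A) = 0 := h1
    simpa using h2
  have h3 : (GR.e d * r * GR.e d : GR k A m) = 0 := by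
    apply GR.ext'
    · intro i; simp [GR.e_a]; grind
    · intro i z
      have : ¬ (i = d ∧ i - 1 = d) := by
        rintro ⟨rfl, h⟩
        apply hm
        simpa using h
      simp [GR.e_a]; grind
  have h4 : (GR.e d : GR k A m) • p0 = p0 := by rw [hp0, ← mul_smul, GR.e_idem]
  rw [← hr, ← h4, ← mul_smul, ← mul_smul, h3, zero_smul]

theorem orth_of_van {X : Type} [AddCommGroup X] [Module (GR k A m) X] (h : Van k A X d) :
    Orth (GR k A m) X (Deg d M) := by
  intro f
  have : f = 0 := by
    ext x
    rw [← deg_e (k := k) (A := A) d (f x), ← map_smul, h, map_zero]; rfl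
  rw [this]; exact SZ.zero

end Deg

def Rigid (R : Type) [Ring R] (X : Type) [AddCommGroup X] [Module R X] : Prop :=
  ∀ (E : Type) [AddCommGroup E] [Module R E] (i : X →ₗ[R] E) (q : E →ₗ[R] X),
    Function.Injective i → Function.Surjective q → (∀ x, q x = 0 ↔ ∃ y, i y = x) →
    ∃ s : X →ₗ[R] E, ∀ x, q (s x) = x

theorem rigid_of_orth {R : Type} [Ring R] (hq : QF R) (c : Chain R) (j : ℕ)
    (h : Orth R (c.X (j + 1)) (c.X j)) : Rigid R (c.X j) := by
  intro E _ _ i q hi hs hex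
  obtain ⟨F, hF⟩ := proj_lift q hs (c.p j)
  obtain ⟨g, hg⟩ := ex_lift i hi (F ∘ₗ c.i j) (fun x => (hex _).1 (by simp [hF, c.pi]))
  obtain ⟨g', hg'⟩ := hq.sz_ext (h g) (c.i j) (c.inj j)
  obtain ⟨s, hs'⟩ := ex_desc (c.p j) (c.surj j) (F - i ∘ₗ g') (fun x hx => by
    obtain ⟨y, rfl⟩ := (c.ex j x).1 hx
    simp [hg', hg])
  refine ⟨s, fun x => ?_⟩
  obtain ⟨x, rfl⟩ := c.surj j x
  rw [hs']
  simp [hF, (hex _).2 ⟨_, rfl⟩]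

theorem rigid_A {k A : Type} [Field k] [Ring A] [Algebra k A] [FiniteDimensional k A] {m : ℕ}
    [NeZero m] (hm : (1 : ZMod m) ≠ 0) (d : ZMod m) {c : Chain (GR k A m)} (hc : c.Min)
    (e : c.X 0 ≃ₗ[GR k A m] Deg d A) (j : ℕ) : Rigid (GR k A m) (c.X j) := by
  apply rigid_of_orth GR.qf
  refine (Chain.orth_iff GR.qf c.tail c j).1 ?_
  exact (orth_of_van (M := A) d (van_A d hm hc e)).congr (LinearEquiv.refl _ _) e.symm

def PD {A : Type} [Ring A] : ℕ → ModuleCat.{0} A → Prop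
  | 0, M => Subsingleton M
  | g + 1, M => ∃ (P N : ModuleCat.{0} A) (i : N →ₗ[A] P) (p : P →ₗ[A] M),
      Module.Projective A P ∧ Module.Finite A P ∧ Function.Injective i ∧ Function.Surjective p ∧
      (∀ x, p x = 0 ↔ ∃ y, i y = x) ∧ PD g N

theorem orth_pd {k A : Type} [Field k] [Ring A] [Algebra k A] [FiniteDimensional k A] {m : ℕ}
    [NeZero m] (d : ZMod m) (g : ℕ) (M : ModuleCat.{0} A) (hM : PD g M) (c : Chain (GR k A m))
    (h : ∀ r < g, Orth (GR k A m) (c.X r) (Deg d A)) : Orth (GR k A m) (c.X 0) (Deg d M) := by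
  induction g generalizing M c with
  | zero =>
    intro f
    have : Subsingleton M := hM
    have : f = 0 := by ext x; exact Subsingleton.elim (α := M) _ _
    rw [this]; exact SZ.zero
  | succ g ih =>
    obtain ⟨P, N, i, p, h1, h2, h3, h4, h5, h6⟩ := hM
    have hN : Orth (GR k A m) (c.X 1) (Deg d N) :=
      ih N h6 c.tail (fun r hr => h (r + 1) (by omega))
    have hP : Orth (GR k A m) (c.X 0) (Deg d P) := by
      intro f
      obtain ⟨n, q, hq⟩ := Module.Finite.exists_fin' A P
      obtain ⟨s, hs⟩ := proj_lift q hq (LinearMap.id : P →ₗ[A] P)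
      have h7 : f = ∑ l : Fin n, degm (k := k) d (q ∘ₗ LinearMap.single A (fun _ => A) l) ∘ₗ
          (degm (k := k) d (LinearMap.proj l ∘ₗ s) ∘ₗ f) := by
        ext x
        have h8 := hs (f x).dn
        have h9 := congrArg q (Finset.univ_sum_single (s (f x).dn))
        rw [map_sum] at h9
        rw [LinearMap.sum_apply]
        exact (h9.trans h8).symm
      rw [h7]
      refine Finset.sum_induction _ (fun t => SZ t) (fun _ _ => SZ.add) SZ.zero ?_
      intro l _
      exact (h 0 (by omega) _).comp_left _
    intro f
    obtain ⟨F, hF⟩ := proj_lift (degm (k := k) d p) h4 (f ∘ₗ c.p 0)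
    obtain ⟨u, hu⟩ := ex_lift (degm (k := k) d i) h3 (F ∘ₗ c.i 0) (fun x => (h5 _).1 (by
      have := hF (c.i 0 x)
      rw [LinearMap.comp_apply, c.pi, map_zero] at this
      exact this))
    obtain ⟨u', hu'⟩ := (GR.qf (k := k) (A := A) (m := m)).sz_ext (hN u) (c.i 0) (c.inj 0)
    obtain ⟨v, hv⟩ := ex_desc (c.p 0) (c.surj 0) (F - degm (k := k) d i ∘ₗ u') (fun x hx => by
      obtain ⟨y, rfl⟩ := (c.ex 0 x).1 hx
      simp [hu', hu])
    have : f = degm (k := k) d p ∘ₗ v := by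
      ext x
      obtain ⟨x, rfl⟩ := c.surj 0 x
      rw [LinearMap.comp_apply, hv, LinearMap.sub_apply, map_sub, hF]
      have h9 : degm (k := k) d p ((degm (k := k) d i ∘ₗ u') x) = 0 := (h5 _).2 ⟨_, rfl⟩
      rw [h9, sub_zero]; rfl
    rw [this]
    exact (hP v).comp_left _

end

end TE

namespace TE

noncomputable section

open Module

section lin

variable {k : Type} [Field k]

theorem pinv {V W : Type} [AddCommGroup V] [Module k V] [AddCommGroup W] [Module k W]
    (f : V →ₗ[k] W) : ∃ h : W →ₗ[k] V, ∀ x, f (h (f x)) = f x := by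
  obtain ⟨s, hs⟩ := f.rangeRestrict.exists_rightInverse_of_surjective
    (LinearMap.range_eq_top.2 f.surjective_rangeRestrict)
  obtain ⟨p, hp⟩ := (LinearMap.range f).subtype.exists_leftInverse_of_injective (by simp)
  refine ⟨s ∘ₗ p, fun x => ?_⟩
  have h1 : p (f x) = ⟨f x, x, rfl⟩ := LinearMap.congr_fun hp ⟨f x, x, rfl⟩
  have h2 := LinearMap.congr_fun hs ⟨f x, x, rfl⟩
  rw [LinearMap.comp_apply, h1]
  exact congrArg Subtype.val h2

theorem htpy {n0 n1 n2 : Type} [Fintype n0] [Fintype n1] [Fintype n2] [DecidableEq n0]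
    [DecidableEq n1] [DecidableEq n2]
    (d0 : Matrix n1 n0 k) (d1 : Matrix n2 n1 k)
    (h : ∀ c, d1.mulVec c = 0 → ∃ t, d0.mulVec t = c) :
    ∃ (h1 : Matrix n0 n1 k) (h2 : Matrix n1 n2 k), d0 * h1 + h2 * d1 = 1 := by
  obtain ⟨a, ha⟩ := pinv (Matrix.toLin' d0)
  obtain ⟨b, hb⟩ := pinv (Matrix.toLin' d1)
  refine ⟨LinearMap.toMatrix' (a ∘ₗ (LinearMap.id - b ∘ₗ Matrix.toLin' d1)), LinearMap.toMatrix' b, ?_⟩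
  apply (Matrix.toLin' (R := k)).injective
  rw [map_add, Matrix.toLin'_mul, Matrix.toLin'_mul, Matrix.toLin'_toMatrix', Matrix.toLin'_toMatrix',
    Matrix.toLin'_one]
  refine LinearMap.ext fun x => ?_
  obtain ⟨t, ht⟩ := h (x - b (Matrix.toLin' d1 x)) (by
    rw [← Matrix.toLin'_apply, map_sub, hb, sub_self])
  rw [← Matrix.toLin'_apply] at ht
  simp only [LinearMap.add_apply, LinearMap.comp_apply, LinearMap.sub_apply, LinearMap.id_apply]
  rw [← ht, ha, ht]
  simp

theorem open_lemma {ι n0 n1 n2 : Type} [Fintype n0] [Fintype n1] [Fintype n2] [DecidableEq n0]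
    [DecidableEq n1] [DecidableEq n2] (D0 : Matrix n1 n0 (MvPolynomial ι k))
    (D1 : Matrix n2 n1 (MvPolynomial ι k)) (u : n0 → k) (x : ι → k)
    (hx : ∀ c, (D1.map (MvPolynomial.eval x)).mulVec c = 0 →
      ∃ t, (D0.map (MvPolynomial.eval x)).mulVec t = c)
    (hu : (D0.map (MvPolynomial.eval x)).mulVec u = 0) (G : MvPolynomial n0 k)
    (hG : MvPolynomial.eval u G ≠ 0) :
    ∃ F : MvPolynomial ι k, MvPolynomial.eval x F ≠ 0 ∧ ∀ y, MvPolynomial.eval y F ≠ 0 →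
      D1.map (MvPolynomial.eval y) * D0.map (MvPolynomial.eval y) = 0 →
      ∃ t, (D0.map (MvPolynomial.eval y)).mulVec t = 0 ∧ MvPolynomial.eval t G ≠ 0 := by
  obtain ⟨h1, h2, hh⟩ := htpy _ _ hx
  let H1 := h1.map (MvPolynomial.C (σ := ι))
  let H2 := h2.map (MvPolynomial.C (σ := ι))
  have e1 : ∀ y, H1.map (MvPolynomial.eval y) = h1 := by intro y; ext; simp [H1]
  have e2 : ∀ y, H2.map (MvPolynomial.eval y) = h2 := by intro y; ext; simp [H2]
  let Θ := D0 * H1 + H2 * D1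
  let U : n0 → MvPolynomial ι k := fun i => MvPolynomial.C (u i)
  let T : n0 → MvPolynomial ι k := Θ.det • U - H1.mulVec (Θ.adjugate.mulVec (D0.mulVec U))
  have eΘ : ∀ y, Θ.map (MvPolynomial.eval y) = D0.map (MvPolynomial.eval y) * h1 +
      h2 * D1.map (MvPolynomial.eval y) := by
    intro y
    rw [← e1 y, ← e2 y, ← Matrix.map_mul, ← Matrix.map_mul, ← Matrix.map_add]
    exact fun a b => map_add _ a b
  have eT : ∀ y i, MvPolynomial.eval y (T i) = (Θ.map (MvPolynomial.eval y)).det * u i -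
      h1.mulVec ((Θ.map (MvPolynomial.eval y)).adjugate.mulVec
        ((D0.map (MvPolynomial.eval y)).mulVec u)) i := by
    intro y i
    have a1 : (MvPolynomial.eval y) Θ.det = (Θ.map (MvPolynomial.eval y)).det :=
      RingHom.map_det _ _
    have a2 : (Θ.adjugate).map (MvPolynomial.eval y) = (Θ.map (MvPolynomial.eval y)).adjugate :=
      RingHom.map_adjugate _ _
    have a3 : ((MvPolynomial.eval y) ∘ U : n0 → k) = u := by ext i; simp [U]
    have b1 : (MvPolynomial.eval y) ∘ (D0.mulVec U) = (D0.map (MvPolynomial.eval y)).mulVec u := by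
      ext i; rw [Function.comp_apply, RingHom.map_mulVec, a3]
    have b2 : (MvPolynomial.eval y) ∘ (Θ.adjugate.mulVec (D0.mulVec U)) =
        (Θ.map (MvPolynomial.eval y)).adjugate.mulVec
        ((D0.map (MvPolynomial.eval y)).mulVec u) := by
      ext i; rw [Function.comp_apply, RingHom.map_mulVec, b1, a2]
    simp only [T, Pi.sub_apply, Pi.smul_apply, map_sub, smul_eq_mul, map_mul, a1]
    rw [RingHom.map_mulVec, b2, e1]
    simp [U]
  have eG : ∀ y, MvPolynomial.eval y (MvPolynomial.aeval T G) =
      MvPolynomial.eval (fun i => MvPolynomial.eval y (T i)) G := by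
    intro y
    have : (MvPolynomial.eval y).comp (MvPolynomial.aeval T).toRingHom =
        MvPolynomial.eval (fun i => MvPolynomial.eval y (T i)) := by
      apply MvPolynomial.ringHom_ext
      · intro a; simp
      · intro i; simp
    exact RingHom.congr_fun this G
  refine ⟨Θ.det * MvPolynomial.aeval T G, ?_, ?_⟩
  · have hΘ : Θ.map (MvPolynomial.eval x) = 1 := by rw [eΘ, hh]
    have a1 : (MvPolynomial.eval x) Θ.det = 1 := by
      have : (MvPolynomial.eval x) Θ.det = (Θ.map (MvPolynomial.eval x)).det :=
        RingHom.map_det _ _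
      rw [this, hΘ, Matrix.det_one]
    rw [map_mul, a1, one_mul, eG]
    have : (fun i => MvPolynomial.eval x (T i)) = u := by
      ext i
      rw [eT, hu, hΘ]; simp
    rwa [this]
  · intro y hy hd
    rw [map_mul, eG] at hy
    have hdet : (Θ.map (MvPolynomial.eval y)).det ≠ 0 := by
      have : (MvPolynomial.eval y) Θ.det = (Θ.map (MvPolynomial.eval y)).det :=
        RingHom.map_det _ _
      rw [← this]
      exact left_ne_zero_of_mul hy
    refine ⟨_, ?_, right_ne_zero_of_mul hy⟩
    obtain ⟨d0, hd0⟩ : ∃ d0, d0 = D0.map (MvPolynomial.eval y) := ⟨_, rfl⟩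
    obtain ⟨d1, hd1⟩ : ∃ d1, d1 = D1.map (MvPolynomial.eval y) := ⟨_, rfl⟩
    obtain ⟨th, hth⟩ : ∃ th, th = Θ.map (MvPolynomial.eval y) := ⟨_, rfl⟩
    have et := eΘ y
    have eT' : (fun i => MvPolynomial.eval y (T i)) =
      th.det • u - h1.mulVec (th.adjugate.mulVec (d0.mulVec u)) := by
      ext i; rw [eT y i, hth, hd0]; rfl
    rw [eT', ← hd0]
    rw [← hth, ← hd0, ← hd1] at et
    rw [← hd0, ← hd1] at hd
    rw [← hth] at hdet
    have hz : d1.mulVec (th.adjugate.mulVec (d0.mulVec u)) = 0 := by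
      let Z := LinearMap.ker (Matrix.toLin' d1)
      have hinj : Function.Injective (Matrix.toLin' th) := by
        intro v w hvw
        have := congrArg (fun t => th⁻¹.mulVec t) hvw
        simpa [Matrix.nonsing_inv_mul th (isUnit_iff_ne_zero.2 hdet)] using this
      have hmap : ∀ z ∈ Z, Matrix.toLin' th z ∈ Z := by
        intro z hz
        have hz' : d1.mulVec z = 0 := hz
        show d1.mulVec (th.mulVec z) = 0
        rw [et, Matrix.add_mulVec, ← Matrix.mulVec_mulVec _ h2, hz', Matrix.mulVec_zero, add_zero,
          Matrix.mulVec_mulVec, ← Matrix.mul_assoc, hd, Matrix.zero_mul, Matrix.zero_mulVec]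
      let r := (Matrix.toLin' th).restrict hmap
      have hr : Function.Surjective r := LinearMap.surjective_of_injective (f := r) (fun v w h =>
        Subtype.ext (hinj (congrArg Subtype.val h)))
      obtain ⟨⟨z, hz⟩, hz2⟩ := hr ⟨th.det • d0.mulVec u, by
        show d1.mulVec (th.det • d0.mulVec u) = 0
        rw [Matrix.mulVec_smul, Matrix.mulVec_mulVec, hd, Matrix.zero_mulVec, smul_zero]⟩
      have hz3 : th.mulVec z = th.det • d0.mulVec u := congrArg Subtype.val hz2
      have hz4 : z = th.adjugate.mulVec (d0.mulVec u) := by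
        apply hinj
        show th.mulVec z = th.mulVec _
        rw [hz3, Matrix.mulVec_mulVec, Matrix.mul_adjugate, Matrix.smul_mulVec, Matrix.one_mulVec]
      rw [← hz4]; exact hz
    have hw : th.mulVec (th.adjugate.mulVec (d0.mulVec u)) = th.det • d0.mulVec u := by
      rw [Matrix.mulVec_mulVec, Matrix.mul_adjugate, Matrix.smul_mulVec, Matrix.one_mulVec]
    rw [Matrix.mulVec_sub, Matrix.mulVec_smul, ← hw]
    nth_rewrite 1 [et]
    rw [Matrix.add_mulVec, ← Matrix.mulVec_mulVec _ h2, hz, Matrix.mulVec_zero, add_zero,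
      ← Matrix.mulVec_mulVec, sub_self]

end lin

section rep

variable {k Λ : Type} [Field k] [Ring Λ] [Algebra k Λ] {d r : ℕ}

def RigM (ρ : Λ →ₐ[k] Matrix (Fin d) (Fin d) k) : Prop :=
  ∀ c : Λ →ₗ[k] Matrix (Fin d) (Fin d) k, (∀ a b, c (a * b) = ρ a * c b + c a * ρ b) →
    ∃ T : Matrix (Fin d) (Fin d) k, ∀ a, c a = T * ρ a - ρ a * T

def pt (b : Basis (Fin r) k Λ) (ρ : Λ →ₐ[k] Matrix (Fin d) (Fin d) k) :
    Fin r × Fin d × Fin d → k := fun t => ρ (b t.1) t.2.1 t.2.2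

def D0 (b : Basis (Fin r) k Λ) (ρ : Λ →ₐ[k] Matrix (Fin d) (Fin d) k) :
    Matrix (Fin r × Fin d × Fin d) (Fin d × Fin d) (MvPolynomial (Fin r × Fin d × Fin d) k) :=
  fun t v => (if t.2.1 = v.1 then MvPolynomial.C (ρ (b t.1) v.2 t.2.2) else 0) -
    (if t.2.2 = v.2 then MvPolynomial.X (t.1, t.2.1, v.1) else 0)

def D1 (b : Basis (Fin r) k Λ) (ρ : Λ →ₐ[k] Matrix (Fin d) (Fin d) k) :
    Matrix ((Fin r × Fin r) × Fin d × Fin d) (Fin r × Fin d × Fin d)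
      (MvPolynomial (Fin r × Fin d × Fin d) k) :=
  fun t v => (if v.1 = t.1.2 ∧ t.2.2 = v.2.2 then MvPolynomial.X (t.1.1, t.2.1, v.2.1) else 0) -
    (if t.2.1 = v.2.1 ∧ t.2.2 = v.2.2 then
      MvPolynomial.C (b.repr (b t.1.1 * b t.1.2) v.1) else 0) +
    (if v.1 = t.1.1 ∧ t.2.1 = v.2.1 then MvPolynomial.C (ρ (b t.1.2) v.2.2 t.2.2) else 0)

def mt (t : Fin d × Fin d → k) : Matrix (Fin d) (Fin d) k := fun i j => t (i, j)

def lm (b : Basis (Fin r) k Λ) (c : Fin r × Fin d × Fin d → k) : Λ →ₗ[k] Matrix (Fin d) (Fin d) k :=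
  b.constr k (fun s => (fun i j => c (s, i, j) : Matrix (Fin d) (Fin d) k))

theorem lm_b (b : Basis (Fin r) k Λ) (c : Fin r × Fin d × Fin d → k) (s : Fin r) :
    lm b c (b s) = Matrix.of fun i j => c (s, i, j) := b.constr_basis k _ s

theorem D0_apply (b : Basis (Fin r) k Λ) (ρ σ : Λ →ₐ[k] Matrix (Fin d) (Fin d) k) (t) (s p q) :
    ((D0 b ρ).map (MvPolynomial.eval (pt b σ))).mulVec t (s, p, q) =
      (mt t * ρ (b s) - σ (b s) * mt t) p q := by
  have : ∀ v : Fin d × Fin d, (MvPolynomial.eval (pt b σ)) (D0 b ρ (s, p, q) v) =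
    (if p = v.1 then ρ (b s) v.2 q else 0) - (if q = v.2 then σ (b s) p v.1 else 0) := by
    intro v
    simp only [D0, map_sub, apply_ite (MvPolynomial.eval (pt b σ)), map_zero,
      MvPolynomial.eval_C, MvPolynomial.eval_X]
    rfl
  simp only [Matrix.mulVec, dotProduct, Matrix.map_apply, this, Fintype.sum_prod_type, sub_mul,
    Finset.sum_sub_distrib, Matrix.sub_apply, Matrix.mul_apply, mt, ite_mul, zero_mul]
  congr 1
  · rw [Finset.sum_comm]
    simp [mul_comm]
  · simp

theorem D1_apply (b : Basis (Fin r) k Λ) (ρ σ : Λ →ₐ[k] Matrix (Fin d) (Fin d) k) (c) (s s' p q) :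
    ((D1 b ρ).map (MvPolynomial.eval (pt b σ))).mulVec c ((s, s'), p, q) =
      (σ (b s) * lm b c (b s') - lm b c (b s * b s') + lm b c (b s) * ρ (b s')) p q := by
  have : ∀ v : Fin r × Fin d × Fin d, (MvPolynomial.eval (pt b σ)) (D1 b ρ ((s, s'), p, q) v) =
    (if v.1 = s' ∧ q = v.2.2 then σ (b s) p v.2.1 else 0) -
    (if p = v.2.1 ∧ q = v.2.2 then b.repr (b s * b s') v.1 else 0) +
    (if v.1 = s ∧ p = v.2.1 then ρ (b s') v.2.2 q else 0) := by
    intro v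
    simp only [D1, map_sub, map_add, apply_ite (MvPolynomial.eval (pt b σ)), map_zero,
      MvPolynomial.eval_C, MvPolynomial.eval_X]
    rfl
  have h2 : ∀ x, lm b c (b x) = Matrix.of fun i j => c (x, i, j) := fun x => lm_b b c x
  have h3 : lm b c (b s * b s') p q = ∑ u, b.repr (b s * b s') u * c (u, p, q) := by
    conv_lhs => rw [← b.sum_repr (b s * b s'), map_sum]
    rw [Matrix.sum_apply]
    refine Finset.sum_congr rfl fun u _ => ?_
    rw [map_smul, h2]; rfl
  rw [Matrix.add_apply, Matrix.sub_apply, h3, h2, h2]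
  simp only [Matrix.mulVec, dotProduct, Matrix.map_apply, this, Fintype.sum_prod_type, sub_mul,
    add_mul, Finset.sum_add_distrib,
    Finset.sum_sub_distrib, Matrix.mul_apply, ite_mul, zero_mul, ite_and]
  congr 1
  · congr 1
    · simp [Matrix.mul_apply]
    · simp
  · simp [mul_comm, Matrix.mul_apply]

theorem orbit_open (b : Basis (Fin r) k Λ) (ρ : Λ →ₐ[k] Matrix (Fin d) (Fin d) k) (hρ : RigM ρ) :
    ∃ F : MvPolynomial (Fin r × Fin d × Fin d) k, MvPolynomial.eval (pt b ρ) F ≠ 0 ∧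
      ∀ σ : Λ →ₐ[k] Matrix (Fin d) (Fin d) k, MvPolynomial.eval (pt b σ) F ≠ 0 →
        ∃ T : Matrix (Fin d) (Fin d) k, T.det ≠ 0 ∧ ∀ a, T * ρ a = σ a * T := by
  let GM : Matrix (Fin d) (Fin d) (MvPolynomial (Fin d × Fin d) k) :=
    fun i j => MvPolynomial.X (i, j)
  have hGM : ∀ t : Fin d × Fin d → k, MvPolynomial.eval t GM.det = (mt t).det := by
    intro t
    rw [RingHom.map_det]
    congr 1
    ext i j
    show MvPolynomial.eval t (MvPolynomial.X (i, j)) = t (i, j)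
    simp
  obtain ⟨F, h1, h2⟩ := open_lemma (D0 b ρ) (D1 b ρ) (fun v => (1 : Matrix (Fin d) (Fin d) k) v.1 v.2)
    (pt b ρ) (by
      intro c hc
      have hc' : ∀ s s', lm b c (b s * b s') = ρ (b s) * lm b c (b s') + lm b c (b s) * ρ (b s') := by
        intro s s'
        ext p q
        have := congrFun hc ((s, s'), p, q)
        rw [D1_apply] at this
        simp only [Matrix.add_apply, Matrix.sub_apply, Pi.zero_apply] at this ⊢
        linear_combination -this
      obtain ⟨T, hT⟩ := hρ (lm b c) (by
        have : (LinearMap.mul k Λ).compr₂ (lm b c) =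
            ((LinearMap.mul k (Matrix (Fin d) (Fin d) k)).compl₁₂ ρ.toLinearMap (lm b c) +
            (LinearMap.mul k (Matrix (Fin d) (Fin d) k)).compl₁₂ (lm b c) ρ.toLinearMap) := by
          apply b.ext; intro s
          apply b.ext; intro s'
          simpa using hc' s s'
        intro x y
        exact LinearMap.congr_fun (LinearMap.congr_fun this x) y)
      refine ⟨fun v => T v.1 v.2, ?_⟩
      funext ⟨s, p, q⟩
      rw [D0_apply]
      have := hT (b s)
      have h3 : lm b c (b s) p q = c (s, p, q) := by rw [lm_b]; rfl
      rw [← h3, this]; rfl)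
    (by
      funext ⟨s, p, q⟩
      rw [D0_apply]
      have : (mt fun v => (1 : Matrix (Fin d) (Fin d) k) v.1 v.2) = 1 := rfl
      rw [this]; simp) GM.det (by
      rw [hGM]
      have : (mt fun v => (1 : Matrix (Fin d) (Fin d) k) v.1 v.2) = 1 := rfl
      rw [this]; simp)
  refine ⟨F, h1, fun σ hσ => ?_⟩
  obtain ⟨t, ht, hdet⟩ := h2 (pt b σ) hσ (by
    apply Matrix.toLin'.injective
    rw [Matrix.toLin'_mul, map_zero]
    refine LinearMap.ext fun t => ?_
    funext ⟨⟨s, s'⟩, p, q⟩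
    rw [LinearMap.comp_apply, Matrix.toLin'_apply, D1_apply, Matrix.toLin'_apply]
    have : lm b (((D0 b ρ).map (MvPolynomial.eval (pt b σ))).mulVec t) =
        LinearMap.mulLeft k (mt t) ∘ₗ ρ.toLinearMap - LinearMap.mulRight k (mt t) ∘ₗ σ.toLinearMap := by
      apply b.ext
      intro s
      ext p q
      have h3 : ∀ c, lm b c (b s) p q = c (s, p, q) := fun c => by rw [lm_b]; rfl
      rw [h3, D0_apply]
      simp
    rw [this]
    have h4 : ∀ x y, (σ x * (LinearMap.mulLeft k (mt t) ∘ₗ ρ.toLinearMap -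
        LinearMap.mulRight k (mt t) ∘ₗ σ.toLinearMap) y -
        (LinearMap.mulLeft k (mt t) ∘ₗ ρ.toLinearMap -
        LinearMap.mulRight k (mt t) ∘ₗ σ.toLinearMap) (x * y) +
        (LinearMap.mulLeft k (mt t) ∘ₗ ρ.toLinearMap -
        LinearMap.mulRight k (mt t) ∘ₗ σ.toLinearMap) x * ρ y) = 0 := by
      intro x y
      simp
      noncomm_ring
    rw [h4]; rfl)
  rw [hGM] at hdet
  refine ⟨mt t, hdet, ?_⟩
  have : LinearMap.mulLeft k (mt t) ∘ₗ ρ.toLinearMap =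
      LinearMap.mulRight k (mt t) ∘ₗ σ.toLinearMap := by
    apply b.ext
    intro s
    ext p q
    have := congrFun ht (s, p, q)
    rw [D0_apply, Matrix.sub_apply] at this
    exact sub_eq_zero.1 this
  exact fun a => LinearMap.congr_fun this a

theorem pigeonM [FiniteDimensional k Λ] (ρ : ℕ → (Λ →ₐ[k] Matrix (Fin d) (Fin d) k))
    (h : ∀ i, RigM (ρ i)) : ∃ i j, i < j ∧ ∃ T : Matrix (Fin d) (Fin d) k, T.det ≠ 0 ∧
      ∀ a, T * ρ i a = ρ j a * T := by
  let b := Module.finBasis k Λ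
  choose F h1 h2 using fun i => orbit_open b (ρ i) (h i)
  have hN : IsNoetherian (MvPolynomial (Fin (finrank k Λ) × Fin d × Fin d) k)
    (MvPolynomial (Fin (finrank k Λ) × Fin d × Fin d) k) := inferInstance
  let I : ℕ →o Ideal (MvPolynomial (Fin (finrank k Λ) × Fin d × Fin d) k) :=
    ⟨fun n => Ideal.span (F '' {i | i < n}), fun n m hnm => Ideal.span_mono
      (Set.image_mono fun i (hi : i < n) => lt_of_lt_of_le hi hnm)⟩
  obtain ⟨n, hn⟩ := monotone_stabilizes_iff_noetherian.2 hN I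
  have hmem : F n ∈ I n := by
    rw [hn (n + 1) (by omega)]
    exact Ideal.subset_span ⟨n, Nat.lt_succ_self n, rfl⟩
  by_contra hcon
  push Not at hcon
  have hle : I n ≤ RingHom.ker (MvPolynomial.eval (pt b (ρ n))) := by
    refine Ideal.span_le.2 ?_
    rintro _ ⟨i, hi, rfl⟩
    show MvPolynomial.eval (pt b (ρ n)) (F i) = 0
    by_contra h3
    obtain ⟨T, h4, h5⟩ := h2 i (ρ n) h3
    obtain ⟨a, ha⟩ := hcon i n hi T h4
    exact ha (h5 a)
  exact h1 n (hle hmem)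

theorem ex_rep {X : Type} [AddCommGroup X] [Module Λ X] [FiniteDimensional k Λ]
    [Module.Finite Λ X] (hd : kDim k Λ X = d) :
    ∃ (ρ : Λ →ₐ[k] Matrix (Fin d) (Fin d) k) (e : X ≃+ (Fin d → k)),
      ∀ a x, e (a • x) = (ρ a).mulVec (e x) := by
  let : Module k X := Module.compHom X (algebraMap k Λ)
  have : IsScalarTower k Λ X := IsScalarTower.of_compHom k Λ X
  have : Module.Finite k X := Module.Finite.trans Λ X
  have hd' : finrank k X = d := hd
  let e := (Module.finBasisOfFinrankEq k X hd').equivFun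
  refine ⟨AlgHom.comp (LinearMap.toMatrixAlgEquiv'.toAlgHom) ((e.conjAlgEquiv k).toAlgHom.comp (Algebra.lsmul k k X)), e.toAddEquiv, fun a x => ?_⟩
  rw [← Matrix.toLin'_apply]
  simp [LinearMap.toMatrixAlgEquiv']

theorem rigM_of_rigid {X : Type} [AddCommGroup X] [Module Λ X]
    (ρ : Λ →ₐ[k] Matrix (Fin d) (Fin d) k) (e : X ≃+ (Fin d → k))
    (he : ∀ a x, e (a • x) = (ρ a).mulVec (e x)) (h : Rigid Λ X) : RigM ρ := by
  intro c hc
  have c1 : c 1 = 0 := by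
    have := hc 1 1
    simpa using this
  let E := (Fin d → k) × (Fin d → k)
  let : Module Λ E :=
    { smul := fun a z => ((ρ a).mulVec z.1 + (c a).mulVec z.2, (ρ a).mulVec z.2)
      one_smul := fun z => by
        show ((ρ 1).mulVec z.1 + (c 1).mulVec z.2, (ρ 1).mulVec z.2) = z
        simp [c1]
      mul_smul := fun a b z => by
        show ((ρ (a * b)).mulVec z.1 + (c (a * b)).mulVec z.2, (ρ (a * b)).mulVec z.2) =
          ((ρ a).mulVec ((ρ b).mulVec z.1 + (c b).mulVec z.2) + (c a).mulVec ((ρ b).mulVec z.2),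
            (ρ a).mulVec ((ρ b).mulVec z.2))
        simp [hc, Matrix.mulVec_add, Matrix.add_mulVec, add_assoc]
      smul_zero := fun a => by
        show ((ρ a).mulVec 0 + (c a).mulVec 0, (ρ a).mulVec 0) = ((0, 0) : E)
        simp
      smul_add := fun a y z => by
        show ((ρ a).mulVec (y.1 + z.1) + (c a).mulVec (y.2 + z.2), (ρ a).mulVec (y.2 + z.2)) =
          (((ρ a).mulVec y.1 + (c a).mulVec y.2) + ((ρ a).mulVec z.1 + (c a).mulVec z.2),
            (ρ a).mulVec y.2 + (ρ a).mulVec z.2)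
        simp only [Matrix.mulVec_add]
        congr 1
        abel
      add_smul := fun a b z => by
        show ((ρ (a + b)).mulVec z.1 + (c (a + b)).mulVec z.2, (ρ (a + b)).mulVec z.2) =
          (((ρ a).mulVec z.1 + (c a).mulVec z.2) + ((ρ b).mulVec z.1 + (c b).mulVec z.2),
            (ρ a).mulVec z.2 + (ρ b).mulVec z.2)
        simp only [Matrix.add_mulVec, map_add]
        congr 1
        abel
      zero_smul := fun z => by
        show ((ρ 0).mulVec z.1 + (c 0).mulVec z.2, (ρ 0).mulVec z.2) = ((0, 0) : E)
        simp }
  have hsm : ∀ (a : Λ) (z : E), a • z =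
    ((ρ a).mulVec z.1 + (c a).mulVec z.2, (ρ a).mulVec z.2) := fun a z => rfl
  obtain ⟨s, hs⟩ := h E
    { toFun := fun x => (e x, 0)
      map_add' := fun x y => by
        rw [map_add]
        exact Prod.ext rfl (add_zero _).symm
      map_smul' := fun a x => by rw [hsm]; simp [he] }
    { toFun := fun z => e.symm z.2
      map_add' := fun x y => e.symm.map_add x.2 y.2
      map_smul' := fun a x => by
        apply e.injective
        rw [hsm]; simp [he] }
    (fun x y hxy => e.injective (congrArg Prod.fst hxy))
    (fun x => ⟨(0, e x), by simp⟩)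
    (fun z => by
      constructor
      · intro hz
        have hz' : e.symm z.2 = 0 := hz
        refine ⟨e.symm z.1, ?_⟩
        refine Prod.ext ?_ ?_
        · exact e.apply_symm_apply _
        · exact (e.symm.map_eq_zero_iff.1 hz').symm
      · rintro ⟨y, rfl⟩
        exact e.symm.map_zero)
  have hs2 : ∀ x, (s x).2 = e x := fun x => e.symm.injective ((hs x).trans (by simp))
  have hsym : ∀ (a : Λ) v, e.symm ((ρ a).mulVec v) = a • e.symm v := by
    intro a v
    apply e.injective
    rw [he]; simp
  let t : (Fin d → k) →ₗ[k] (Fin d → k) :=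
    { toFun := fun v => (s (e.symm v)).1
      map_add' := fun v w => by
        rw [map_add, map_add]; rfl
      map_smul' := fun r v => by
        have h1 : e.symm (r • v) = algebraMap k Λ r • e.symm v := by
          rw [← hsym, AlgHom.commutes]
          simp [Algebra.algebraMap_eq_smul_one, Matrix.smul_mulVec]
        rw [h1, map_smul, hsm]
        simp [Algebra.algebraMap_eq_smul_one, c1, Matrix.smul_mulVec] }
  refine ⟨LinearMap.toMatrix' t, fun a => ?_⟩
  apply Matrix.toLin'.injective
  rw [map_sub, Matrix.toLin'_mul, Matrix.toLin'_mul, Matrix.toLin'_toMatrix']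
  refine LinearMap.ext fun v => ?_
  have h1 := congrArg Prod.fst (s.map_smul a (e.symm v))
  rw [hsm, ← hsym, hs2] at h1
  have h2 : t ((ρ a).mulVec v) = (ρ a).mulVec (t v) + (c a).mulVec v := by
    refine h1.trans ?_
    simp [t]
  simp [h2]

theorem pigeon [FiniteDimensional k Λ] (X : ℕ → ModuleCat.{0} Λ) (hf : ∀ i, Module.Finite Λ (X i))
    (C : ℕ) (hC : ∀ i, kDim k Λ (X i) ≤ C) (hr : ∀ i, Rigid Λ (X i)) :
    ∃ i n, 1 ≤ n ∧ Nonempty (X i ≃ₗ[Λ] X (n + i)) := by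
  obtain ⟨d, hd⟩ := Finite.exists_infinite_fiber
    (fun i : ℕ => (⟨kDim k Λ (X i), Nat.lt_succ_of_le (hC i)⟩ : Fin (C + 1)))
  have hinf : Set.Infinite {i | kDim k Λ (X i) = d.1} := by
    rw [← Set.infinite_coe_iff]
    convert hd using 2
    ext i
    simp [Fin.ext_iff]
  let u := Nat.nth (fun i => kDim k Λ (X i) = d.1)
  have hu : ∀ j, kDim k Λ (X (u j)) = d.1 := fun j => Nat.nth_mem_of_infinite hinf j
  have hmono : StrictMono u := Nat.nth_strictMono hinf
  choose ρ e he using fun j => ex_rep (k := k) (hu j)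
  obtain ⟨i, j, hij, T, hT, h⟩ := pigeonM ρ (fun j => rigM_of_rigid (ρ j) (e j) (he j) (hr _))
  have hlt := hmono hij
  refine ⟨u i, u j - u i, by omega, ?_⟩
  rw [Nat.sub_add_cancel hlt.le]
  let f : X (u i) →ₗ[Λ] X (u j) :=
    { toFun := fun x => (e j).symm (T.mulVec (e i x))
      map_add' := fun x y => by simp [Matrix.mulVec_add]
      map_smul' := fun a x => by
        apply (e j).injective
        rw [(e j).apply_symm_apply, he, he, RingHom.id_apply, (e j).apply_symm_apply, Matrix.mulVec_mulVec, h,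
          Matrix.mulVec_mulVec] }
  refine ⟨LinearEquiv.ofBijective f ?_⟩
  have hb : Function.Bijective T.mulVec := by
    have hu : IsUnit T := (Matrix.isUnit_iff_isUnit_det T).2 (isUnit_iff_ne_zero.2 hT)
    exact ⟨Matrix.mulVec_injective_iff_isUnit.2 hu, Matrix.mulVec_surjective_iff_isUnit.2 hu⟩
  exact (e j).symm.bijective.comp (hb.comp (e i).bijective)

end rep

end

end TE

namespace TE

noncomputable section

open Module

section bw

variable {k A : Type} [Field k] [Ring A] [Algebra k A]

def unrs {R R' : Type} [Ring R] [Ring R'] (ρ : R' →+* R) (hρ : Function.Surjective ρ)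
    (X Y : ModuleCat.{0} R) (e : rs ρ X ≃ₗ[R'] rs ρ Y) : X ≃ₗ[R] Y where
  toFun := e
  map_add' := e.map_add
  map_smul' r x := by
    obtain ⟨r, rfl⟩ := hρ r
    exact e.map_smul r x
  invFun := e.symm
  left_inv := e.left_inv
  right_inv := e.right_inv

def IsCh {m : ℕ} (c : Chain (GR k A m)) (d : ZMod m) (M : Type) [AddCommGroup M] [Module A M] :
    Prop := c.Min ∧ Nonempty (c.X 0 ≃ₗ[GR k A m] Deg d M)

theorem Red.congr {R X Y : Type} [Ring R] [AddCommGroup X] [Module R X] [AddCommGroup Y]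
    [Module R Y] (h : Red R X) (u : X ≃ₗ[R] Y) : Red R Y := by
  intro e he
  have h1 := h (u.symm.toLinearMap ∘ₗ e ∘ₗ u.toLinearMap) ((he.comp_right _).comp_left _)
  have : (LinearMap.id - e : Y →ₗ[R] Y) = u.toLinearMap ∘ₗ
      (LinearMap.id - u.symm.toLinearMap ∘ₗ e ∘ₗ u.toLinearMap) ∘ₗ u.symm.toLinearMap := by
    ext x; simp
  rw [this]
  exact u.bijective.comp (h1.comp u.symm.bijective)

section fd
variable [FiniteDimensional k A]

instance artGR (m : ℕ) [NeZero m] : IsArtinianRing (GR k A m) := IsArtinianRing.of_finite k _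
instance noethGR (m : ℕ) [NeZero m] : IsNoetherianRing (GR k A m) := IsNoetherianRing.of_finite k _

theorem ex_ch (m : ℕ) [NeZero m] (d : ZMod m) (M : Type) [AddCommGroup M] [Module A M]
    [Module.Finite A M] : ∃ c : Chain (GR k A m), IsCh c d M := by
  obtain ⟨c, h, hc⟩ := ex_chain (R := GR k A m) (Deg d M)
  exact ⟨c, hc, ⟨h ▸ LinearEquiv.refl _ _⟩⟩

variable {m : ℕ} [NeZero m]

theorem IsCh.res {n : ℕ} [NeZero n] (q : ZMod n → ZMod m)
    (hq : ∀ i, q (i - 1) = q i - 1)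
    {c : Chain (GR k A n)} {d : ZMod n} {M : Type} [AddCommGroup M] [Module A M]
    (h : IsCh c d M) : IsCh (c.res (GR.good_pb q hq)) (q d) M := by
  obtain ⟨h1, ⟨e⟩⟩ := h
  refine ⟨Chain.res_min _ h1, ⟨?_⟩⟩
  exact { toFun := fun x => Deg.up _ (e x).dn
          map_add' := fun x y => e.map_add x y
          map_smul' := fun r x => (e.map_smul (GR.pb q hq r) x).trans rfl
          invFun := fun x => e.symm (Deg.up _ x.dn)
          left_inv := fun x => e.left_inv x
          right_inv := fun x => e.right_inv x }

theorem bound (hB : ∀ (M : Type) [AddCommGroup M] [Module (TrivialExtension k A) M],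
        Module.Finite (TrivialExtension k A) M → ComplexityLeOne k (TrivialExtension k A) M)
    (M : Type) [AddCommGroup M] [Module A M] [Module.Finite A M] :
    ∃ C : ℕ, ∀ (m : ℕ) [NeZero m] (d : ZMod m) (c : Chain (GR k A m)), IsCh c d M →
      ∀ j, kDim k (GR k A m) (c.X j) ≤ C := by
  have : FiniteDimensional k (TrivialExtension k A) :=
    Module.Finite.equiv (eGR k A).symm.toLinearEquiv
  let M' := rs (toGR k A).toRingHom (ModuleCat.of (GR k A 1) (Deg (0 : ZMod 1) M))
  obtain ⟨c0, hc0⟩ := ex_ch (k := k) (A := A) 1 0 M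
  obtain ⟨e0⟩ := hc0.2
  have hfin : Module.Finite (TrivialExtension k A) M' :=
    Module.Finite.equiv (M := (c0.res (goodB k A)).X 0)
      { toFun := e0, map_add' := e0.map_add, map_smul' := fun r x => e0.map_smul (toGR k A r) x
        invFun := e0.symm, left_inv := e0.left_inv, right_inv := e0.right_inv }
  obtain ⟨C, hC⟩ := cx_bound k (qfB k A) M' (hB M' hfin)
  refine ⟨C, fun m _ d c hc j => ?_⟩
  have h1 := hc.res (m := 1) (fun _ => 0) (fun _ => rfl)
  have h2 := Chain.res_min (goodB k A) h1.1
  obtain ⟨e⟩ := h1.2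
  have h3 := hC _ h2 ⟨{ toFun := e, map_add' := e.map_add, map_smul' := fun r x => e.map_smul (toGR k A r) x
                        invFun := e.symm, left_inv := e.left_inv, right_inv := e.right_inv }⟩ j
  have h4 := kDim_rs k (toGR k A) (rs (GR.pb (k := k) (A := A) (fun _ : ZMod m => (0 : ZMod 1)) (fun _ => rfl)).toRingHom (c.X j))
  have h5 := kDim_rs k (GR.pb (k := k) (A := A) (fun _ : ZMod m => (0 : ZMod 1)) (fun _ => rfl)) (c.X j)
  rw [← h5, ← h4]
  exact h3

theorem supp_aux {c : Chain (GR k A m)} {d : ZMod m} {M : Type} [AddCommGroup M] [Module A M]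
    (h : IsCh c d M) (j t : ℕ) (h1 : j < t) (h2 : t < m) : Van k A (c.X j) (d + (t : ZMod m)) ∧
      (j + 1 < t → Van k A (c.P j) (d + (t : ZMod m))) := by
  have key : ∀ j t : ℕ, j < t → t < m → Van k A (c.X j) (d + (t : ZMod m)) := by
    intro j
    induction j with
    | zero =>
      intro t h1 h2
      obtain ⟨e⟩ := h.2
      refine (van_deg (k := k) (A := A) (M := M) d ?_).equiv e.symm
      intro h3
      have h4 : (t : ZMod m) = 0 := by simpa using h3
      rw [ZMod.natCast_eq_zero_iff] at h4
      exact absurd (Nat.le_of_dvd h1 h4) (by omega)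
    | succ j ih =>
      intro t h1 h2
      refine (supp_step h.1 j _ (ih t (by omega) h2) ?_).2
      have := ih (t - 1) (by omega) (by omega)
      rwa [Nat.cast_sub (by omega), Nat.cast_one, ← add_sub_assoc] at this
  refine ⟨key j t h1 h2, fun h3 => ?_⟩
  refine (supp_step h.1 j _ (key j t (by omega) h2) ?_).1
  have := key j (t - 1) (by omega) (by omega)
  rwa [Nat.cast_sub (by omega), Nat.cast_one, ← add_sub_assoc] at this

theorem supp_A {c : Chain (GR k A m)} {d : ZMod m}
    (h : IsCh c d A) (j : ℕ) (h1 : j + 1 < m) : Van k A (c.X (j + 1)) d := by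
  have hm : (1 : ZMod m) ≠ 0 := by
    have : Fact (1 < m) := ⟨by omega⟩
    exact one_ne_zero
  induction j with
  | zero =>
    obtain ⟨e⟩ := h.2
    exact van_A d hm h.1 e
  | succ j ih =>
    refine (supp_step h.1 (j + 1) d (ih (by omega)) ?_).2
    have := (supp_aux h (j + 1) (m - 1) (by omega) (by omega)).1
    rw [Nat.cast_sub (by omega), Nat.cast_one, ZMod.natCast_self, zero_sub, ← sub_eq_add_neg] at this
    exact this

theorem period (hm : 2 ≤ m) (C : ℕ)
    (hC : ∀ (d : ZMod m) (c : Chain (GR k A m)), IsCh c d A →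
      ∀ j, kDim k (GR k A m) (c.X j) ≤ C) :
    ∃ n, 1 ≤ n ∧ ∀ (d : ZMod m) (c : Chain (GR k A m)), IsCh c d A →
      Nonempty (c.X n ≃ₗ[GR k A m] Deg d A) := by
  have hm1 : (1 : ZMod m) ≠ 0 := by
    have : Fact (1 < m) := ⟨by omega⟩
    exact one_ne_zero
  obtain ⟨c, hc⟩ := ex_ch (k := k) (A := A) m 0 A
  obtain ⟨u⟩ := hc.2
  obtain ⟨i, n, hn, ⟨e⟩⟩ := pigeon (k := k) c.X (fun j => inferInstance) C (hC 0 c hc)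
    (fun j => rigid_A hm1 0 hc.1 u j)
  refine ⟨n, hn, fun d c' hc' => ?_⟩
  obtain ⟨n, rfl⟩ : ∃ n', n = n' + 1 := ⟨n - 1, by omega⟩
  obtain ⟨f⟩ := Chain.stable_down GR.qf c (c.drop (n + 1)) i e ((red_deg 0).congr u.symm)
    (Chain.red (R := GR k A m) GR.qf hc.1 n)
  have hq : ∀ i : ZMod m, (i - 1) - d = (i - d) - 1 := fun i => by ring
  have h1 := hc'.res (fun x => x - d) hq
  obtain ⟨u'⟩ := h1.2
  have hd0 : d - d = 0 := sub_self d
  obtain ⟨u''⟩ : Nonempty (Deg (d - d) A ≃ₗ[GR k A m] Deg (0 : ZMod m) A) := by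
    rw [hd0]; exact ⟨LinearEquiv.refl _ _⟩
  obtain ⟨w⟩ := Chain.uniq GR.qf hc.1 h1.1 (u.trans (u''.symm.trans u'.symm)) (n + 1)
  have hs : Function.Surjective (GR.pb (k := k) (A := A) (fun x => x - d) hq).toRingHom := by
    intro y
    refine ⟨GR.pb (fun x => x + d) (fun i => by ring) y, GR.ext' (fun i => ?_) (fun i z => ?_)⟩
    · show y.a (i - d + d) = y.a i
      rw [sub_add_cancel]
    · show y.f (i - d + d) z = y.f i z
      rw [sub_add_cancel]
  obtain ⟨v⟩ := hc'.2
  exact ⟨(unrs _ hs (c'.X 0) (c'.X (n + 1)) (((u'.trans u'').trans u.symm).trans (f.trans w))).symm.trans v⟩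

theorem gap {X : Type} [AddCommGroup X] [Module (GR k A m) X] [Module.Finite (GR k A m) X] (C : ℕ)
    (hC : kDim k (GR k A m) X ≤ C) (hm : C < m) (c : ZMod m) :
    ∃ u : ℕ, u ≤ C ∧ Van k A X (c + (u : ZMod m)) := by
  by_contra hcon
  push Not at hcon
  have h1 : ∀ u : Fin (C + 1), ∃ x : X, (GR.e (c + ((u : ℕ) : ZMod m)) : GR k A m) • x ≠ 0 := fun u => by
    have := hcon u (by omega)
    unfold Van at this
    push Not at this
    exact this
  choose x hx using h1
  unfold kDim at hC
  let : Module k X := Module.compHom X (algebraMap k (GR k A m))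
  have : IsScalarTower k (GR k A m) X := IsScalarTower.of_compHom k _ X
  have : Module.Finite k X := Module.Finite.trans (GR k A m) X
  have hinj : ∀ u v : Fin (C + 1), c + ((u : ℕ) : ZMod m) = c + ((v : ℕ) : ZMod m) → u = v := by
    intro u v h
    have h2 := (ZMod.natCast_eq_natCast_iff' _ _ _).1 (add_left_cancel h)
    rw [Nat.mod_eq_of_lt (by omega), Nat.mod_eq_of_lt (by omega)] at h2
    exact Fin.ext h2
  have hli : LinearIndependent k fun u : Fin (C + 1) => (GR.e (c + ((u : ℕ) : ZMod m)) : GR k A m) • x u := by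
    rw [Fintype.linearIndependent_iff]
    intro g hg v
    have h3 := congrArg (fun y => (GR.e (c + ((v : ℕ) : ZMod m)) : GR k A m) • y) hg
    simp only [Finset.smul_sum, smul_zero] at h3
    rw [Finset.sum_eq_single v] at h3
    · rw [smul_comm, ← mul_smul, GR.e_idem] at h3
      exact (smul_eq_zero.1 h3).resolve_right (hx v)
    · intro u _ huv
      rw [smul_comm, ← mul_smul, GR.e_mul_e, if_neg, zero_smul, smul_zero]
      exact fun h => huv (hinj _ _ h.symm)
    · simp
  have := hli.fintype_card_le_finrank
  rw [Fintype.card_fin] at this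
  omega

end fd
end bw
end
end TE

namespace TE

noncomputable section

open Module

section st1

variable {k A : Type} [Field k] [Ring A] [Algebra k A] [FiniteDimensional k A]

theorem PD.congr {A : Type} [Ring A] {g : ℕ} {M N : ModuleCat.{0} A} (h : PD g M) (e : M ≃ₗ[A] N) :
    PD g N := by
  cases g with
  | zero =>
    have : Subsingleton M := h
    exact e.symm.injective.subsingleton
  | succ g =>
    obtain ⟨P, N', i, p, h1, h2, h3, h4, h5, h6⟩ := h
    refine ⟨P, N', i, e.toLinearMap ∘ₗ p, h1, h2, h3, e.surjective.comp h4, fun x => ?_, h6⟩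
    rw [LinearMap.comp_apply, LinearEquiv.coe_coe, LinearEquiv.map_eq_zero_iff]
    exact h5 x

theorem fin_rs {R R' : Type} [Ring R] [Algebra k R] [Ring R'] [Algebra k R'] [FiniteDimensional k R]
    (ρ : R' →ₐ[k] R) (X : ModuleCat.{0} R) [Module.Finite R X] :
    Module.Finite R' (rs ρ.toRingHom X) := by
  let : Module k X := Module.compHom X (algebraMap k R)
  have : IsScalarTower k R X := IsScalarTower.of_compHom k R X
  have : Module.Finite k X := Module.Finite.trans R X
  let : Module k (rs ρ.toRingHom X) := inferInstanceAs (Module k X)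
  have : Module.Finite k (rs ρ.toRingHom X) := inferInstanceAs (Module.Finite k X)
  have : IsScalarTower k R' (rs ρ.toRingHom X) := ⟨fun c r x => by
    show ρ (c • r) • (show (X : Type) from x) = c • (ρ r • (show (X : Type) from x))
    rw [map_smul, smul_assoc]⟩
  exact Module.Finite.of_restrictScalars_finite k R' _

variable {m : ℕ}

def dg (m : ℕ) : A →ₐ[k] GR k A m :=
  AlgHom.ofLinearMap ⟨⟨fun x => GR.cst m x 0, fun x y => GR.ext' (fun i => rfl)
    (fun i z => by show (0 : k) = 0 + 0; simp)⟩, fun c x => GR.ext' (fun i => rfl)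
    (fun i z => by show (0 : k) = c • 0; simp)⟩ rfl
    (fun x y => GR.ext' (fun i => rfl) (fun i z => by show (0 : k) = 0 + 0; simp))

theorem dg_a (x : A) (i : ZMod m) : (dg (k := k) m x).a i = x := rfl
theorem dg_f (x : A) (i : ZMod m) : (dg (k := k) m x).f i = 0 := rfl

theorem dg_comm (x : A) (d : ZMod m) : (dg (k := k) m x) * GR.e d = GR.e d * dg m x :=
  GR.ext' (fun i => by simp [dg_a, GR.e_a]) (fun i z => by simp [dg_f])

theorem e_mul' [NeZero m] (hm : (1 : ZMod m) ≠ 0) (d : ZMod m) (x : GR k A m) :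
    GR.e d * x = dg m (x.a d) * GR.e d + GR.e d * x * GR.e (d - 1) := by
  have hd : ∀ i : ZMod m, i - 1 ≠ i := fun i h => hm (by simpa using h)
  apply GR.ext'
  · intro i
    have := hd i
    simp [dg_a, GR.e_a]; grind
  · intro i z
    have := hd i
    simp [dg_f, dg_a, GR.e_a]; grind

def E0s (d : ZMod m) (X : ModuleCat.{0} (GR k A m)) : Submodule A (rs (dg (k := k) (A := A) m).toRingHom X) where
  carrier := {x | (GR.e d : GR k A m) • (show (X : Type) from x) = x}
  add_mem' {x y} hx hy := (smul_add (GR.e d : GR k A m) (show (X : Type) from x) y).trans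
    (congrArg₂ _ hx hy)
  zero_mem' := by
    show (GR.e d : GR k A m) • (0 : (X : Type)) = 0
    exact smul_zero _
  smul_mem' a x hx := by
    show (GR.e d : GR k A m) • (dg (k := k) m a • (show (X : Type) from x)) = dg (k := k) m a • (show (X : Type) from x)
    rw [← mul_smul, ← dg_comm, mul_smul]
    exact congrArg _ hx

def E0 (d : ZMod m) (X : ModuleCat.{0} (GR k A m)) : ModuleCat.{0} A := ModuleCat.of A (E0s d X)

def E0v {d : ZMod m} {X : ModuleCat.{0} (GR k A m)} (x : E0 d X) : X := Subtype.val (p := fun y => y ∈ E0s d X) x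
def E0.w {d : ZMod m} {X : ModuleCat.{0} (GR k A m)} (x : X) (h : (GR.e d : GR k A m) • x = x) : E0 d X :=
  (⟨x, h⟩ : E0s d X)

theorem E0.ev {d : ZMod m} {X : ModuleCat.{0} (GR k A m)} (x : E0 d X) :
    (GR.e d : GR k A m) • (E0v x) = (E0v x) := x.2
theorem E0.ext {d : ZMod m} {X : ModuleCat.{0} (GR k A m)} {x y : E0 d X} (h : (E0v x) = (E0v y)) : x = y :=
  Subtype.ext h
theorem E0.v_add {d : ZMod m} {X : ModuleCat.{0} (GR k A m)} (x y : E0 d X) : (E0v (x + y)) = (E0v x) + (E0v y) := rfl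

theorem E0.v_smul {d : ZMod m} {X : ModuleCat.{0} (GR k A m)} (a : A) (x : E0 d X) :
    (E0v (a • x)) = dg (k := k) m a • (E0v x) := rfl

def E0.map {d : ZMod m} {X Y : ModuleCat.{0} (GR k A m)} (f : X →ₗ[GR k A m] Y) : E0 d X →ₗ[A] E0 d Y where
  toFun x := E0.w (f (E0v x)) (by rw [← map_smul, (E0.ev x)])
  map_add' x y := E0.ext (f.map_add _ _)
  map_smul' a x := E0.ext (f.map_smul _ _)

theorem E0.v_map {d : ZMod m} {X Y : ModuleCat.{0} (GR k A m)} (f : X →ₗ[GR k A m] Y) (x : E0 d X) :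
    (E0v (E0.map f x)) = f (E0v x) := rfl

def E0.pr (d : ZMod m) {X : ModuleCat.{0} (GR k A m)} (x : X) : E0 d X :=
  E0.w ((GR.e d : GR k A m) • x) (by rw [← mul_smul, GR.e_idem])

theorem E0.v_pr (d : ZMod m) {X : ModuleCat.{0} (GR k A m)} (x : X) :
    (E0v (E0.pr d x)) = (GR.e d : GR k A m) • x := rfl

theorem E0.out [NeZero m] (hm : (1 : ZMod m) ≠ 0) (d : ZMod m) (X : ModuleCat.{0} (GR k A m)) (hX : Van k A X (d - 1))
    {N : Type} [AddCommGroup N] [Module A N] (g : E0 d X →ₗ[A] N) :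
    ∃ G : X →ₗ[GR k A m] Deg d N, ∀ x, G x = Deg.up d (g (E0.pr d x)) := by
  refine ⟨⟨⟨fun x => Deg.up d (g (E0.pr d x)), fun x y => ?_⟩, fun r x => ?_⟩, fun _ => rfl⟩
  · have : (E0.pr d (x + y)) = E0.pr d x + E0.pr d y := E0.ext (by
      rw [E0.v_add, E0.v_pr, E0.v_pr, E0.v_pr, smul_add])
    rw [this, map_add]; rfl
  · have : E0.pr d (r • x) = r.a d • E0.pr d x := E0.ext (by
      rw [E0.v_smul, E0.v_pr, E0.v_pr, ← mul_smul, e_mul' hm, add_smul, mul_smul, mul_smul (GR.e d * r),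
        hX, smul_zero, add_zero])
    show Deg.up d (g (E0.pr d (r • x))) = Deg.up d (r.a d • g (E0.pr d x))
    rw [this, map_smul]

theorem E0.pr_v {d : ZMod m} {X : ModuleCat.{0} (GR k A m)} (x : E0 d X) : E0.pr d (E0v x) = x :=
  E0.ext (by rw [E0.v_pr, E0.ev])

instance E0.fin [NeZero m] (d : ZMod m) (X : ModuleCat.{0} (GR k A m)) [Module.Finite (GR k A m) X] :
    Module.Finite A (E0 d X) := by
  have : IsNoetherianRing A := IsNoetherianRing.of_finite k A
  have := fin_rs (dg (k := k) (A := A) m) X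
  exact inferInstanceAs (Module.Finite A (E0s d X))

theorem E0.proj [NeZero m] (hm : (1 : ZMod m) ≠ 0) (d : ZMod m) (X : ModuleCat.{0} (GR k A m)) (hX : Van k A X (d - 1))
    [Module.Projective (GR k A m) X] : Module.Projective A (E0 d X) := by
  apply Module.Projective.of_lifting_property
  intro M N _ _ _ _ f g hf
  obtain ⟨G, hG⟩ := E0.out hm d X hX g
  obtain ⟨H, hH⟩ := proj_lift (degm (k := k) d f) hf G
  refine ⟨⟨⟨fun x => (H (E0v x)).dn, fun x y => ?_⟩, fun a x => ?_⟩, ?_⟩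
  · exact H.map_add (E0v x) (E0v y)
  · exact H.map_smul (dg m a) (E0v x)
  · ext x
    have h1 := hH (E0v x)
    rw [hG, E0.pr_v] at h1
    exact h1

theorem pd_of_van [NeZero m] (c : Chain (GR k A m)) (M : ModuleCat.{0} A) (hc : IsCh c (0 : ZMod m) M) (n : ℕ)
    (hn : n + 2 < m) (hX : Van k A (c.X n) (0 : ZMod m)) : PD n M := by
  have hm : (1 : ZMod m) ≠ 0 := by
    have : Fact (1 < m) := ⟨by omega⟩
    exact one_ne_zero
  have key : ∀ g j, j + g = n → PD g (E0 (0 : ZMod m) (c.X j)) := by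
    intro g
    induction g with
    | zero =>
      intro j hj
      obtain rfl : j = n := by omega
      refine ⟨fun x y => E0.ext ?_⟩
      rw [← (E0.ev x), ← (E0.ev y), hX, hX]
    | succ g ih =>
      intro j hj
      have hV : Van k A (c.P j) ((0 : ZMod m) - 1) := by
        have := (supp_aux hc j (m - 1) (by omega) (by omega)).2 (by omega)
        rw [Nat.cast_sub (by omega), Nat.cast_one, ZMod.natCast_self, zero_add] at this
        exact this
      refine ⟨E0 0 (c.P j), E0 0 (c.X (j + 1)), E0.map (c.i j), E0.map (c.p j), E0.proj hm 0 _ hV,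
        inferInstance, ?_, ?_, ?_, ih (j + 1) (by omega)⟩
      · intro x y h
        exact E0.ext (c.inj j (congrArg E0v h))
      · intro x
        obtain ⟨y, hy⟩ := c.surj j (E0v x)
        refine ⟨E0.pr 0 y, E0.ext ?_⟩
        rw [E0.v_map, E0.v_pr, map_smul, hy, E0.ev]
      · intro x
        constructor
        · intro h
          obtain ⟨y, hy⟩ := (c.ex j (E0v x)).1 (congrArg E0v h)
          refine ⟨E0.pr 0 y, E0.ext ?_⟩
          rw [E0.v_map, E0.v_pr, map_smul, hy, E0.ev]
        · rintro ⟨y, rfl⟩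
          exact E0.ext (c.pi j _)
  obtain ⟨e⟩ := hc.2
  refine (key n 0 (by omega)).congr ?_
  refine LinearEquiv.ofBijective (⟨⟨fun x => (e (E0v x)).dn, fun x y => e.map_add (E0v x) (E0v y)⟩, fun a x => e.map_smul (dg m a) (E0v x)⟩ : E0 (0 : ZMod m) (c.X 0) →ₗ[A] M) ⟨?_, ?_⟩
  · intro x y h
    exact E0.ext (e.injective h)
  · intro y
    refine ⟨E0.w (e.symm (Deg.up 0 y)) ?_, ?_⟩
    · rw [← map_smul, deg_e]
    · show (e (e.symm _)).dn = y
      rw [e.apply_symm_apply]; rfl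

theorem cut [NeZero m] {X : Type} [AddCommGroup X] [Module (GR k A m) X] (S : Finset (ZMod m))
    (h : ∀ d, (d ∈ S ↔ d - 1 ∈ S) ∨ Van k A X d ∨ Van k A X (d - 1)) :
    ∃ ε : X →ₗ[GR k A m] X, ∀ x, ε x = ∑ d ∈ S, (GR.e d : GR k A m) • x := by
  classical
  have hd : ∀ (r : GR k A m) (d b : ZMod m) (x : X), (d ∈ S ↔ b ∈ S) ∨
      (GR.e d * r * GR.e b : GR k A m) • x = 0 := by
    intro r d b x
    by_cases h1 : b = d
    · left; rw [h1]
    by_cases h2 : b = d - 1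
    · subst h2
      rcases h d with h | h | h
      · exact Or.inl h
      · right; rw [mul_assoc, mul_smul, h]
      · right; rw [mul_smul, h, smul_zero]
    · right; rw [GR.e_mul _ _ _ h1 h2, zero_smul]
  refine ⟨⟨⟨fun x => ∑ d ∈ S, (GR.e d : GR k A m) • x, fun x y => ?_⟩, fun r x => ?_⟩, fun _ => rfl⟩
  · rw [← Finset.sum_add_distrib]; simp [smul_add]
  · show ∑ d ∈ S, (GR.e d : GR k A m) • r • x = r • ∑ d ∈ S, (GR.e d : GR k A m) • x
    have h1 : ∑ d ∈ S, (GR.e d : GR k A m) • r • x =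
        ∑ d ∈ S, ∑ b ∈ S, (GR.e d * r * GR.e b : GR k A m) • x := by
      refine Finset.sum_congr rfl fun d hdS => ?_
      conv_lhs => rw [← mul_smul, ← sum_e_smul (k := k) (A := A) (m := m) x, Finset.smul_sum]
      rw [Finset.sum_subset (Finset.subset_univ S)]
      · exact Finset.sum_congr rfl fun b _ => (mul_smul _ _ _).symm
      · intro b _ hb
        rcases hd r d b x with h | h
        · exact absurd (h.1 hdS) hb
        · exact h
    have h2 : r • ∑ b ∈ S, (GR.e b : GR k A m) • x =
        ∑ b ∈ S, ∑ d ∈ S, (GR.e d * r * GR.e b : GR k A m) • x := by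
      rw [Finset.smul_sum]
      refine Finset.sum_congr rfl fun b hbS => ?_
      rw [← sum_e_smul (k := k) (A := A) (m := m) (r • (GR.e b : GR k A m) • x)]
      symm
      rw [Finset.sum_subset (Finset.subset_univ S)]
      · exact Finset.sum_congr rfl fun b _ => by rw [mul_smul, mul_smul]
      · intro d _ hdS
        rcases hd r d b x with h | h
        · exact absurd (h.2 hbS) hdS
        · exact h
    rw [h1, h2, Finset.sum_comm]

theorem e_pb [NeZero m] {M : ℕ} [NeZero M] (q : ZMod M → ZMod m) (hq : ∀ i, q (i - 1) = q i - 1) (d : ZMod M) :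
    (GR.e d : GR k A M) * GR.pb q hq (GR.e (q d)) = GR.e d :=
  GR.ext' (fun i => by rw [GR.mul_a, GR.pb_a, GR.e_a, GR.e_a]; grind)
    (fun i z => by
      have : (GR.pb q hq (GR.e (q d) : GR k A m)).f i = 0 := GR.e_f (q d) (q i)
      simp [this])

theorem step1 (M : Type) [AddCommGroup M] [Module A M] [Module.Finite A M] (π : A →ₗ[A] M)
    (hπ : Function.Surjective π) (C : ℕ)
    (hA : ∀ (m : ℕ) [NeZero m] (d : ZMod m) (c : Chain (GR k A m)), IsCh c d A →
      ∀ j, kDim k (GR k A m) (c.X j) ≤ C)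
    (hM : ∀ (m : ℕ) [NeZero m] (d : ZMod m) (c : Chain (GR k A m)), IsCh c d M →
      ∀ j, kDim k (GR k A m) (c.X j) ≤ C) :
    ∃ g, PD g (ModuleCat.of A M) := by
  obtain ⟨n, hn, hper⟩ := period (k := k) (A := A) (m := C + 2) (by omega) C (hA (C + 2))
  let m := C + 2
  let N := m * (n + 2)
  have hN1 : C + 2 + n < N := by
    show C + 2 + n < (C + 2) * (n + 2)
    nlinarith [Nat.zero_le (C * n)]
  have : NeZero N := ⟨by omega⟩
  obtain ⟨V, hV⟩ := ex_ch (k := k) (A := A) N 0 A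
  obtain ⟨X, hX⟩ := ex_ch (k := k) (A := A) N 0 M
  have hdvd : m ∣ N := ⟨n + 2, rfl⟩
  let q : ZMod N → ZMod m := ZMod.castHom hdvd (ZMod m)
  have hq : ∀ i, q (i - 1) = q i - 1 := fun i => by simp only [q, map_sub, map_one]
  have hV1 : ∀ d : ZMod N, q d ≠ 0 → Van k A (V.X n) d := by
    intro d hd x
    have h1 := hV.res q hq
    have hq0 : q 0 = 0 := by simp [q]
    obtain ⟨e⟩ := hper (q 0) _ h1
    have h2 : Van k A ((V.res (GR.good_pb (k := k) (A := A) q hq)).X n) (q d) :=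
      (van_deg (k := k) (A := A) (M := A) (q 0) (by rwa [hq0])).equiv e.symm
    have h3 : GR.pb q hq (GR.e (q d) : GR k A m) • x = 0 := h2 x
    rw [← e_pb q hq d, mul_smul, h3, smul_zero]
  have hV0 : Van k A (V.X n) (0 : ZMod N) := by
    obtain ⟨n, rfl⟩ : ∃ n', n = n' + 1 := ⟨n - 1, by omega⟩
    exact supp_A hV n (by omega)
  obtain ⟨γ, hγ, hγX⟩ := gap C (hM N 0 X hX n) (by omega) (0 : ZMod N)
  rw [zero_add] at hγX
  refine ⟨n, pd_of_van X _ hX n (by omega) ?_⟩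
  rcases Nat.eq_zero_or_pos γ with rfl | hγ0
  · simpa using hγX
  have hX1 : Van k A (X.X n) ((0 : ZMod N) - 1) := by
    have := (supp_aux hX n (N - 1) (by omega) (by omega)).1
    rw [Nat.cast_sub (by omega), Nat.cast_one, ZMod.natCast_self, zero_add] at this
    exact this
  obtain ⟨ε, hε⟩ := cut (k := k) (A := A) (X := X.X n) (Finset.univ.filter fun d : ZMod N => d.val < γ) (by
    intro d
    rw [Finset.mem_filter, Finset.mem_filter]
    simp only [Finset.mem_univ, true_and]
    by_cases hd0 : d = 0
    · right; right; rw [hd0]; exact hX1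
    by_cases hdg : d = γ
    · right; left; rw [hdg]; exact hγX
    left
    have h1 : (d - 1).val = d.val - 1 := by
      have hd1 : d.val ≠ 0 := fun h => hd0 ((ZMod.val_eq_zero d).1 h)
      have h5 := d.val_lt
      have : d - 1 = ((d.val - 1 : ℕ) : ZMod N) := by
        rw [Nat.cast_sub (by omega), ZMod.natCast_zmod_val, Nat.cast_one]
      rw [this, ZMod.val_natCast, Nat.mod_eq_of_lt (by omega)]
    have h2 : d.val ≠ γ := fun h => hdg (by rw [← h, ZMod.natCast_zmod_val])
    rw [h1]; omega)
  obtain ⟨ε0, hε0⟩ := Chain.RelN.ex_left GR.qf n ε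
  obtain ⟨u⟩ := hV.2
  obtain ⟨w⟩ := hX.2
  obtain ⟨h, hh⟩ := Chain.RelN.ex_right (c := V) (c' := X) n
    (w.symm.toLinearMap ∘ₗ degm (k := k) 0 π ∘ₗ u.toLinearMap)
  have hεh : ε ∘ₗ h = 0 := by
    ext x
    rw [LinearMap.comp_apply, hε, LinearMap.zero_apply]
    apply Finset.sum_eq_zero
    intro d hd
    have hd := (Finset.mem_filter.1 hd).2
    rw [← map_smul]
    by_cases hd0 : d = 0
    · rw [hd0, hV0, map_zero]
    · rw [hV1 d, map_zero]
      intro hqd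
      have h1 : ((d.val : ℕ) : ZMod m) = 0 := by
        rw [← hqd]; simp [q]
      rw [ZMod.natCast_eq_zero_iff] at h1
      have hd1 : d.val ≠ 0 := fun h => hd0 ((ZMod.val_eq_zero d).1 h)
      have h3 := Nat.le_of_dvd (by omega) h1
      have h4 : C + 2 ≤ d.val := h3
      omega
  have hz := (hh.comp hε0).sz_left GR.qf (by rw [hεh]; exact SZ.zero)
  have hz2 := sz_deg (0 : ZMod N) _ ((hz.comp_left w.toLinearMap).comp_right u.symm.toLinearMap)
  have hε00 : ε0 = 0 := by
    ext x
    obtain ⟨y, hy⟩ := hπ (w x).dn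
    have h1 := LinearMap.congr_fun hz2 (Deg.up 0 y)
    simp only [LinearMap.comp_apply, LinearEquiv.coe_coe, u.apply_symm_apply, LinearMap.zero_apply,
      LinearEquiv.map_eq_zero_iff] at h1
    have h2 : degm (k := k) 0 π (Deg.up (0 : ZMod N) y) = w x := hy
    rw [h2, w.symm_apply_apply] at h1
    exact h1
  have hεz : SZ ε := hε0.sz_right (by rw [hε00]; exact SZ.zero)
  have h0S : (0 : ZMod N) ∈ Finset.univ.filter fun d : ZMod N => d.val < γ := by
    simp [hγ0]
  have hidem : ∀ (d : ZMod N) (x : X.X n), d ∈ (Finset.univ.filter fun d : ZMod N => d.val < γ) →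
      (GR.e d : GR k A N) • ε x = (GR.e d : GR k A N) • x := by
    intro d x hd
    rw [hε, Finset.smul_sum, Finset.sum_eq_single d]
    · rw [← mul_smul, GR.e_idem]
    · intro b _ hb
      rw [← mul_smul, GR.e_mul_e, if_neg hb.symm, zero_smul]
    · exact fun h => absurd hd h
  have hred : Red (GR k A N) (X.X n) := by
    obtain ⟨n, rfl⟩ : ∃ n', n = n' + 1 := ⟨n - 1, by omega⟩
    exact Chain.red GR.qf hX.1 n
  have hε0' : ε = 0 := by
    refine hred.idem ε hεz ?_
    intro x
    rw [hε (ε x), hε x]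
    exact Finset.sum_congr rfl fun d hd => by rw [← hε, hidem d x hd]
  intro x
  rw [← hidem 0 x h0S, hε0', LinearMap.zero_apply, smul_zero]

end st1
end
end TE

namespace TE

noncomputable section

open Module

section ss

variable {R : Type} [Ring R] [IsArtinianRing R]

abbrev SQ (R : Type) [Ring R] : Type := R ⧸ Ring.jacobson R

theorem ss_quot : IsSemisimpleModule R (SQ R) := by
  have hR : IsSemisimpleModule (R ⧸ Ring.jacobson R) (R ⧸ Ring.jacobson R) :=
    (IsSemiprimaryRing.isSemisimpleRing : IsSemisimpleRing (R ⧸ Ring.jacobson R))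
  let l : (R ⧸ Ring.jacobson R) →ₛₗ[Ideal.Quotient.mk (Ring.jacobson R)] (R ⧸ Ring.jacobson R) :=
    { toFun := id, map_add' := fun _ _ => rfl, map_smul' := fun r x => by
        obtain ⟨x, rfl⟩ := Ideal.Quotient.mk_surjective x
        rfl }
  exact (LinearMap.isSemisimpleModule_iff_of_bijective l Function.bijective_id).2 hR

theorem SQ.smul {r : R} (hr : r ∈ Ring.jacobson R) (x : SQ R) : r • x = 0 := by
  obtain ⟨x, rfl⟩ := Submodule.mkQ_surjective _ x
  rw [← map_smul]
  exact (Submodule.Quotient.mk_eq_zero _).2 (Ideal.mul_mem_right _ _ hr)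

theorem simple_jac (T : Type) [AddCommGroup T] [Module R T] [IsSimpleModule R T] {r : R}
    (hr : r ∈ Ring.jacobson R) (x : T) : r • x = 0 := by
  rcases eq_bot_or_eq_top (Ring.jacobson R • (⊤ : Submodule R T)) with h | h
  · have : r • x ∈ Ring.jacobson R • (⊤ : Submodule R T) := Submodule.smul_mem_smul hr trivial
    rw [h] at this
    simpa using this
  · have h1 := nak (⊥ : Submodule R T) (fun x => ⟨0, by simp, by rw [h]; trivial⟩)
    have h2 : IsSimpleOrder (Submodule R T) := inferInstance
    exact absurd h1 bot_ne_top

theorem desc_SQ (T : Type) [AddCommGroup T] [Module R T] (x : T) (hx : ∀ r ∈ Ring.jacobson R, r • x = 0) :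
    ∃ f : SQ R →ₗ[R] T, ∀ r, f (Submodule.mkQ _ r) = r • x := by
  obtain ⟨f, hf⟩ := ex_desc (Submodule.mkQ (Ring.jacobson R)) (Submodule.mkQ_surjective _)
    (LinearMap.toSpanSingleton R T x) (fun r hr => hx r ((Submodule.Quotient.mk_eq_zero _).1 hr))
  exact ⟨f, hf⟩

theorem ex_to_SQ (E : Type) [AddCommGroup E] [Module R E] [Module.Finite R E] [Nontrivial E] :
    ∃ g : E →ₗ[R] SQ R, g ≠ 0 := by
  obtain ⟨N, hN⟩ := IsCoatomic.exists_coatom (Submodule R E)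
  have : IsSimpleModule R (E ⧸ N) := isSimpleModule_iff_isCoatom.2 hN
  have : Nontrivial (E ⧸ N) := IsSimpleModule.nontrivial R _
  obtain ⟨x, hx⟩ := exists_ne (0 : E ⧸ N)
  obtain ⟨f, hf⟩ := desc_SQ (E ⧸ N) x (fun r hr => simple_jac (R := R) (E ⧸ N) hr x)
  have hs : Function.Surjective f := by
    intro y
    obtain ⟨r, hr⟩ := (IsSimpleModule.toSpanSingleton_surjective R hx) y
    exact ⟨_, (hf r).trans hr⟩
  have := ss_quot (R := R)
  obtain ⟨s, hs⟩ := IsSemisimpleModule.lifting_property f hs LinearMap.id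
  refine ⟨s ∘ₗ N.mkQ, fun h => ?_⟩
  obtain ⟨y, rfl⟩ := N.mkQ_surjective x
  apply hx
  have h1 := LinearMap.congr_fun hs (N.mkQ y)
  have h2 : s (N.mkQ y) = 0 := LinearMap.congr_fun h y
  rw [LinearMap.comp_apply, h2, map_zero] at h1
  exact h1.symm

theorem ex_from_SQ (E : Type) [AddCommGroup E] [Module R E] [Module.Finite R E] [Nontrivial E] :
    ∃ g : SQ R →ₗ[R] E, g ≠ 0 := by
  obtain ⟨N, hN⟩ := IsAtomic.exists_atom (Submodule R E)
  have : IsSimpleModule R N := isSimpleModule_iff_isAtom.2 hN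
  have : Nontrivial N := IsSimpleModule.nontrivial R _
  obtain ⟨x, hx⟩ := exists_ne (0 : N)
  obtain ⟨f, hf⟩ := desc_SQ N x (fun r hr => simple_jac (R := R) N hr x)
  refine ⟨N.subtype ∘ₗ f, fun h => ?_⟩
  apply hx
  have h1 := LinearMap.congr_fun h (Submodule.mkQ _ 1)
  rw [LinearMap.comp_apply, hf, one_smul] at h1
  exact Subtype.ext h1

end ss

section st2

variable {k A : Type} [Field k] [Ring A] [Algebra k A] [FiniteDimensional k A]

theorem cosyz {R : Type} [Ring R] (hq : QF R) (n : ℕ) (c : Chain R) :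
    ∃ Y : Chain R, ∀ r, Nonempty (Y.X (r + n) ≃ₗ[R] c.X r) := by
  induction n with
  | zero => exact ⟨c, fun r => ⟨LinearEquiv.refl _ _⟩⟩
  | succ n ih =>
    obtain ⟨Y, hY⟩ := ih
    obtain ⟨N, i, hi⟩ := hq.emb (Y.X 0)
    refine ⟨Y.prepend (ModuleCat.of R ((Fin N → R) ⧸ LinearMap.range i)) (ModuleCat.of R (Fin N → R))
      (hQ := inferInstanceAs (Module.Projective R (Fin N → R)))
      (hQ' := inferInstanceAs (Module.Finite R (Fin N → R))) i
      (LinearMap.range i).mkQ hi (Submodule.mkQ_surjective _) (fun x => ?_), hY⟩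
    exact (Submodule.Quotient.mk_eq_zero _)

variable {m : ℕ} [NeZero m]

theorem jac_deg (d : ZMod m) {r : GR k A m} (hr : r ∈ Ring.jacobson (GR k A m)) (x : Deg d (SQ A)) :
    r • x = 0 := by
  have : IsArtinianRing A := IsArtinianRing.of_finite k A
  exact SQ.smul (GR.jac_a hr d) x.dn

theorem E0.into (hm : (1 : ZMod m) ≠ 0) (d : ZMod m) (X : ModuleCat.{0} (GR k A m)) (hX : Van k A X (d + 1))
    {N : Type} [AddCommGroup N] [Module A N] (g : N →ₗ[A] E0 d X) :
    ∃ G : Deg d N →ₗ[GR k A m] X, ∀ x, G x = E0v (g x.dn) := by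
  refine ⟨⟨⟨fun x => E0v (g x.dn), fun x y => ?_⟩, fun r x => ?_⟩, fun _ => rfl⟩
  · exact congrArg E0v (g.map_add x.dn y.dn)
  · have h1 : E0v (g (r.a d • x.dn)) = dg (k := k) m (r.a d) • E0v (g x.dn) := by
      rw [map_smul]; rfl
    refine h1.trans ?_
    show _ = r • E0v (g x.dn)
    generalize hy : g x.dn = y
    have h2 : ∀ b, b ≠ d → (GR.e b * r * GR.e d : GR k A m) • (E0v y) = 0 := by
      intro b hb
      by_cases h3 : b = d + 1
      · rw [h3, mul_assoc, mul_smul, hX]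
      · rw [GR.e_mul _ _ _ hb.symm (fun h => h3 (by rw [h]; ring)), zero_smul]
    rw [← sum_e_smul (k := k) (A := A) (m := m) (r • E0v y), Finset.sum_eq_single d]
    · rw [← mul_smul, e_mul' hm, add_smul, mul_smul, E0.ev, mul_smul (GR.e d * r)]
      nth_rewrite 3 [← E0.ev]
      rw [← mul_smul (GR.e (d - 1)), GR.e_mul_e, if_neg, zero_smul, smul_zero, add_zero]
      exact fun h => hm (by simpa using h)
    · intro b _ hb
      rw [← E0.ev y, ← mul_smul, ← mul_smul, h2 b hb]
    · simp

theorem step2 (g C n : ℕ) (hg : PD g (ModuleCat.of A (SQ A))) (hn : 1 ≤ n) (hmC : C + 2 * g + 3 ≤ m)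
    (hper : ∀ (d : ZMod m) (c : Chain (GR k A m)), IsCh c d A →
      Nonempty (c.X n ≃ₗ[GR k A m] Deg d A))
    (X : Chain (GR k A m)) (hX : IsCh X 0 (SQ A))
    (hC : kDim k (GR k A m) (X.X n) ≤ C) (s : ZMod m) (hs : s ≠ 0) : Van k A (X.X n) s := by
  have : IsArtinianRing A := IsArtinianRing.of_finite k A
  have hm : (1 : ZMod m) ≠ 0 := by
    have : Fact (1 < m) := ⟨by omega⟩
    exact one_ne_zero
  have low : ∀ d : ZMod m, g < d.val → Orth (GR k A m) (X.X n) (Deg d (SQ A)) := by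
    intro d hd
    refine orth_pd d g (ModuleCat.of A (SQ A)) hg (X.drop n) (fun r hr => ?_)
    obtain ⟨V, hV⟩ := ex_ch (k := k) (A := A) m d A
    obtain ⟨e⟩ := hper d V hV
    obtain ⟨e0⟩ := hV.2
    have h1 : Van k A (X.X r) d := by
      have := (supp_aux hX r d.val (by omega) d.val_lt).1
      rwa [zero_add, ZMod.natCast_zmod_val] at this
    have h2 := (orth_of_van (M := A) d h1).congr (LinearEquiv.refl _ _) e0.symm
    have h3 := (Chain.orth_iff GR.qf (X.drop r) V n).1 h2
    have h4 := h3.congr (LinearEquiv.refl _ _) e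
    have h5 : n + r = r + n := Nat.add_comm n r
    show Orth (GR k A m) (X.X (n + r)) (Deg d A)
    rw [h5]
    exact h4
  have up : ∀ t : ZMod m, g < (-t).val → Orth (GR k A m) (Deg t (SQ A)) (X.X n) := by
    intro t ht
    obtain ⟨c, hc⟩ := ex_ch (k := k) (A := A) m t (SQ A)
    obtain ⟨Y, hY⟩ := cosyz GR.qf n c
    obtain ⟨V, hV⟩ := ex_ch (k := k) (A := A) m 0 A
    obtain ⟨e⟩ := hper 0 V hV
    obtain ⟨e0⟩ := hV.2
    have h0 : Orth (GR k A m) (Y.X 0) (Deg (0 : ZMod m) (SQ A)) := by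
      refine orth_pd 0 g (ModuleCat.of A (SQ A)) hg Y (fun r hr => ?_)
      have h1 : Van k A (c.X r) (0 : ZMod m) := by
        have := (supp_aux hc r (-t).val (by omega) (-t).val_lt).1
        rwa [ZMod.natCast_zmod_val, add_neg_cancel] at this
      obtain ⟨w⟩ := hY r
      have h2 := (orth_of_van (M := A) 0 h1).congr w e.symm
      exact ((Chain.orth_iff GR.qf (Y.drop r) V n).2 h2).congr (LinearEquiv.refl _ _) e0
    obtain ⟨x0⟩ := hX.2
    have h1 := (Chain.orth_iff GR.qf Y X n).1 (h0.congr (LinearEquiv.refl _ _) x0.symm)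
    obtain ⟨w⟩ := hY 0
    rw [Nat.zero_add] at w
    obtain ⟨c0⟩ := hc.2
    exact h1.congr (w.trans c0).symm (LinearEquiv.refl _ _)
  obtain ⟨n, rfl⟩ : ∃ n', n = n' + 1 := ⟨n - 1, by omega⟩
  have bot : ∀ c : ZMod m, ¬ Van k A (X.X (n + 1)) c → Van k A (X.X (n + 1)) (c - 1) → c.val ≤ g := by
    intro c h1 h2
    by_contra hcon
    unfold Van at h1
    push Not at h1
    obtain ⟨x, hx⟩ := h1
    have : Nontrivial (E0 c (X.X (n + 1))) := ⟨E0.pr c x, 0, fun h => hx (congrArg E0v h)⟩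
    obtain ⟨f, hf⟩ := ex_to_SQ (R := A) (E0 c (X.X (n + 1)))
    obtain ⟨F, hF⟩ := E0.out hm c _ h2 f
    apply hf
    ext y
    have h3 := Chain.sz_jac GR.qf hX.1 n F (low c (by omega) F) (E0v y)
    have h4 : Ring.jacobson (GR k A m) • (⊤ : Submodule (GR k A m) (Deg c (SQ A))) = ⊥ := by
      rw [eq_bot_iff, Submodule.smul_le]
      intro r hr z _
      rw [jac_deg c hr]; exact Submodule.zero_mem _
    rw [h4, hF, E0.pr_v] at h3
    exact h3
  have top : ∀ t : ZMod m, ¬ Van k A (X.X (n + 1)) t → Van k A (X.X (n + 1)) (t + 1) → (-t).val ≤ g := by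
    intro t h1 h2
    by_contra hcon
    unfold Van at h1
    push Not at h1
    obtain ⟨x, hx⟩ := h1
    have : Nontrivial (E0 t (X.X (n + 1))) := ⟨E0.pr t x, 0, fun h => hx (congrArg E0v h)⟩
    obtain ⟨f, hf⟩ := ex_from_SQ (R := A) (E0 t (X.X (n + 1)))
    obtain ⟨F, hF⟩ := E0.into hm t _ h2 f
    apply hf
    have h3 := sz_soc hX.1 n (fun r hr x => jac_deg t hr x) F (up t (by omega) F)
    refine LinearMap.ext fun y => E0.ext ?_
    have h4 := LinearMap.congr_fun h3 (Deg.up t y)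
    rw [hF] at h4
    exact h4
  by_contra hcon
  classical
  have ex1 : ∃ i : ℕ, Van k A (X.X (n + 1)) (s - (i : ZMod m)) := by
    obtain ⟨u, hu, h⟩ := gap C hC (by omega) (s - (C : ZMod m))
    refine ⟨C - u, ?_⟩
    rw [Nat.cast_sub hu]
    convert h using 1
    ring
  obtain ⟨i, hi⟩ : ∃ i, i = Nat.find ex1 := ⟨_, rfl⟩
  have hi1 : Van k A (X.X (n + 1)) (s - (i : ZMod m)) := hi ▸ Nat.find_spec ex1
  have hi2 : ∀ j < i, ¬ Van k A (X.X (n + 1)) (s - (j : ZMod m)) := fun j hj => Nat.find_min ex1 (hi ▸ hj)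
  have hi0 : i ≠ 0 := fun h => hcon (by rw [h] at hi1; simpa using hi1)
  obtain ⟨i, rfl⟩ : ∃ i', i = i' + 1 := ⟨i - 1, by omega⟩
  obtain ⟨c, hc⟩ : ∃ c : ZMod m, c = s - (i : ZMod m) := ⟨_, rfl⟩
  have hcg := bot c (hc ▸ hi2 i (by omega)) (by
    convert hi1 using 1; rw [hc]; push_cast; ring)
  have ex2 : ∃ u : ℕ, u ≤ C ∧ Van k A (X.X (n + 1)) (c + (u : ZMod m)) := gap C hC (by omega) c
  obtain ⟨u, hu⟩ : ∃ u, u = Nat.find ex2 := ⟨_, rfl⟩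
  have hu1 : u ≤ C ∧ Van k A (X.X (n + 1)) (c + (u : ZMod m)) := hu ▸ Nat.find_spec ex2
  have hu2 : ∀ j < u, ¬ Van k A (X.X (n + 1)) (c + (j : ZMod m)) := fun j hj h =>
    Nat.find_min ex2 (hu ▸ hj) ⟨by omega, h⟩
  have hiu : i < u := by
    by_contra hlt
    have := hi2 (i - u) (by omega)
    apply this
    rw [Nat.cast_sub (by omega)]
    convert hu1.2 using 1
    rw [hc]; ring
  obtain ⟨u, rfl⟩ : ∃ u', u = u' + 1 := ⟨u - 1, by omega⟩
  have htg := top (c + (u : ZMod m)) (hu2 u (by omega)) (by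
    convert hu1.2 using 1; push_cast; ring)
  have hsum : ((c.val + u + (-(c + (u : ZMod m))).val : ℕ) : ZMod m) = 0 := by
    push_cast
    rw [ZMod.natCast_zmod_val, ZMod.natCast_zmod_val]; ring
  rw [ZMod.natCast_eq_zero_iff] at hsum
  have h0 := Nat.eq_zero_of_dvd_of_lt hsum (by omega)
  have hc0 : c = 0 := (ZMod.val_eq_zero c).1 (by omega)
  have hi0' : i = 0 := by omega
  apply hs
  rw [hi0', hc0] at hc
  simpa using hc.symm

end st2
end
end TE

namespace TE

noncomputable section

open Module

theorem jac_rel {A : Type} [Ring A] (S : A → A → Prop) (hl : ∀ a, ∃ b, S a b) (hr : ∀ b, ∃ a, S a b)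
    (h1 : S 1 1) (hm : ∀ a b a' b', S a b → S a' b' → S (a * a') (b * b'))
    (hs : ∀ a b a' b', S a b → S a' b' → S (a - a') (b - b')) (h0 : ∀ b, S 0 b → b = 0)
    {a b : A} (h : S a b) (ha : a ∈ Ring.jacobson A) : b ∈ Ring.jacobson A := by
  rw [← Ideal.jacobson_bot] at ha ⊢
  rw [Ideal.mem_jacobson_iff] at ha ⊢
  intro c
  obtain ⟨c', hc'⟩ := hr (-c)
  obtain ⟨u, hu⟩ := ha (-c')
  obtain ⟨v, hv⟩ := hl u
  refine ⟨v, ?_⟩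
  have h2 := hm _ _ _ _ hv (hs _ _ _ _ h1 (hm _ _ _ _ hc' h))
  have h3 := h0 _ (by
    have := hs _ _ _ _ h2 h1
    have e : u * (1 - c' * a) - 1 = 0 := by
      rw [Ideal.mem_bot] at hu
      rw [← hu]; noncomm_ring
    rw [e] at this
    exact this)
  rw [Ideal.mem_bot, ← h3]; noncomm_ring

section st3

open Chain

variable {k A : Type} [Field k] [Ring A] [Algebra k A] [FiniteDimensional k A] {m : ℕ} [NeZero m]

theorem sz_deg' (d : ZMod m) {X Y M N : Type} [AddCommGroup X] [AddCommGroup Y] [AddCommGroup M]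
    [AddCommGroup N] [Module (GR k A m) X] [Module (GR k A m) Y] [Module A M] [Module A N]
    (e : X ≃ₗ[GR k A m] Deg d M) (e' : Y ≃ₗ[GR k A m] Deg d N) (f : X →ₗ[GR k A m] Y) (hf : SZ f) :
    f = 0 := by
  have h := sz_deg d (e'.toLinearMap ∘ₗ f ∘ₗ e.symm.toLinearMap) ((hf.comp_right _).comp_left _)
  ext x
  have h1 := LinearMap.congr_fun h (e x)
  simpa using h1

theorem conc (hm : (1 : ZMod m) ≠ 0) (d : ZMod m) (X : ModuleCat.{0} (GR k A m))
    (hX : ∀ s, s ≠ d → Van k A X s) : Nonempty (X ≃ₗ[GR k A m] Deg d (E0 d X)) := by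
  obtain ⟨G, hG⟩ := E0.into hm d X (hX _ (fun h => hm (by simpa using h))) (LinearMap.id)
  refine ⟨(LinearEquiv.ofBijective G ⟨fun x y h => ?_, fun x => ?_⟩).symm⟩
  · rw [hG, hG] at h
    exact E0.ext h
  · refine ⟨Deg.up d (E0.pr d x), ?_⟩
    rw [hG]
    show E0v (E0.pr d x) = x
    rw [E0.v_pr]
    rw [← sum_e_smul (k := k) (A := A) (m := m) x, Finset.sum_eq_single d]
    · rw [← mul_smul, GR.e_idem]
    · intro b _ hb; exact hX b hb x
    · simp

theorem step3 (n : ℕ) (V X : Chain (GR k A m)) (hm : (1 : ZMod m) ≠ 0)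
    (u : V.X 0 ≃ₗ[GR k A m] Deg (0 : ZMod m) A) (f : V.X n ≃ₗ[GR k A m] Deg (0 : ZMod m) A)
    (x0 : X.X 0 ≃ₗ[GR k A m] Deg (0 : ZMod m) (SQ A)) (hX : ∀ s : ZMod m, s ≠ 0 → Van k A (X.X n) s) :
    Nonempty (X.X n ≃ₗ[GR k A m] Deg (0 : ZMod m) (SQ A)) := by
  obtain ⟨w⟩ := conc hm 0 (X.X n) hX
  have hq : QF (GR k A m) := GR.qf
  let r : A → (Deg (0 : ZMod m) A →ₗ[GR k A m] Deg (0 : ZMod m) A) := fun a =>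
    degm 0 (LinearMap.toSpanSingleton A A a)
  have hr : ∀ a x, r a x = Deg.up (0 : ZMod m) (x.dn * a) := fun a x => rfl
  have hr' : ∀ g : Deg (0 : ZMod m) A →ₗ[GR k A m] Deg (0 : ZMod m) A, ∃ a, g = r a := by
    intro g
    refine ⟨(g (Deg.up 0 1)).dn, LinearMap.ext fun x => ?_⟩
    have h := (degm' 0 g).map_smul x.dn (1 : A)
    rw [smul_eq_mul, mul_one] at h
    exact h
  let ru : A → (V.X 0 →ₗ[GR k A m] V.X 0) := fun a => u.symm.toLinearMap ∘ₗ r a ∘ₗ u.toLinearMap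
  let rf : A → (V.X n →ₗ[GR k A m] V.X n) := fun a => f.symm.toLinearMap ∘ₗ r a ∘ₗ f.toLinearMap
  have hru : ∀ g, ∃ a, g = ru a := by
    intro g
    obtain ⟨a, ha⟩ := hr' (u.toLinearMap ∘ₗ g ∘ₗ u.symm.toLinearMap)
    refine ⟨a, LinearMap.ext fun x => ?_⟩
    show _ = u.symm (r a (u x))
    rw [← ha]; simp
  have hrf : ∀ g, ∃ a, g = rf a := by
    intro g
    obtain ⟨a, ha⟩ := hr' (f.toLinearMap ∘ₗ g ∘ₗ f.symm.toLinearMap)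
    refine ⟨a, LinearMap.ext fun x => ?_⟩
    show _ = f.symm (r a (f x))
    rw [← ha]; simp
  let S : A → A → Prop := fun a b => RelN V V n (ru a) (rf b)
  have hl : ∀ a, ∃ b, S a b := fun a => by
    obtain ⟨g, hg⟩ := RelN.ex_right (c := V) (c' := V) n (ru a)
    obtain ⟨b, rfl⟩ := hrf g
    exact ⟨b, hg⟩
  have hrr : ∀ b, ∃ a, S a b := fun b => by
    obtain ⟨g, hg⟩ := RelN.ex_left (c := V) (c' := V) hq n (rf b)
    obtain ⟨a, rfl⟩ := hru g
    exact ⟨a, hg⟩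
  have S1 : S 1 1 := by
    have h1 : ru 1 = LinearMap.id := LinearMap.ext fun x => by
      show u.symm (Deg.up 0 ((u x).dn * 1)) = x
      rw [mul_one]; exact u.symm_apply_apply x
    have h2 : rf 1 = LinearMap.id := LinearMap.ext fun x => by
      show f.symm (Deg.up 0 ((f x).dn * 1)) = x
      rw [mul_one]; exact f.symm_apply_apply x
    show RelN V V n (ru 1) (rf 1)
    rw [h1, h2]; exact RelN.id n
  have Sm : ∀ a b a' b', S a b → S a' b' → S (a * a') (b * b') := by
    intro a b a' b' h h'
    have := RelN.comp h h'
    have h1 : ru (a * a') = ru a' ∘ₗ ru a := LinearMap.ext fun x => by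
      show u.symm (Deg.up 0 ((u x).dn * (a * a'))) = u.symm (Deg.up 0 (Deg.dn (u (u.symm (Deg.up 0 ((u x).dn * a)))) * a'))
      rw [u.apply_symm_apply, ← mul_assoc]; rfl
    have h2 : rf (b * b') = rf b' ∘ₗ rf b := LinearMap.ext fun x => by
      show f.symm (Deg.up 0 ((f x).dn * (b * b'))) = f.symm (Deg.up 0 (Deg.dn (f (f.symm (Deg.up 0 ((f x).dn * b)))) * b'))
      rw [f.apply_symm_apply, ← mul_assoc]; rfl
    show RelN V V n (ru (a * a')) (rf (b * b'))
    rw [h1, h2]; exact this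
  have Ss : ∀ a b a' b', S a b → S a' b' → S (a - a') (b - b') := by
    intro a b a' b' h h'
    have := RelN.sub h h'
    have h1 : ru (a - a') = ru a - ru a' := LinearMap.ext fun x => by
      show u.symm (Deg.up 0 ((u x).dn * (a - a'))) = u.symm (Deg.up 0 ((u x).dn * a)) - u.symm (Deg.up 0 ((u x).dn * a'))
      rw [← map_sub, mul_sub]; rfl
    have h2 : rf (b - b') = rf b - rf b' := LinearMap.ext fun x => by
      show f.symm (Deg.up 0 ((f x).dn * (b - b'))) = f.symm (Deg.up 0 ((f x).dn * b)) - f.symm (Deg.up 0 ((f x).dn * b'))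
      rw [← map_sub, mul_sub]; rfl
    show RelN V V n (ru (a - a')) (rf (b - b'))
    rw [h1, h2]; exact this
  have ru0 : ∀ a, ru a = 0 ↔ a = 0 := by
    intro a
    constructor
    · intro h
      have h1 := LinearMap.congr_fun h (u.symm (Deg.up 0 1))
      have h2 : u.symm (Deg.up 0 (Deg.dn (u (u.symm (Deg.up 0 1))) * a)) = 0 := h1
      rw [u.apply_symm_apply, LinearEquiv.map_eq_zero_iff] at h2
      exact (one_mul a).symm.trans h2
    · rintro rfl
      refine LinearMap.ext fun x => ?_
      show u.symm (Deg.up 0 ((u x).dn * 0)) = 0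
      rw [mul_zero]; exact map_zero u.symm
  have rf0 : ∀ a, rf a = 0 ↔ a = 0 := by
    intro a
    constructor
    · intro h
      have h1 := LinearMap.congr_fun h (f.symm (Deg.up 0 1))
      have h2 : f.symm (Deg.up 0 (Deg.dn (f (f.symm (Deg.up 0 1))) * a)) = 0 := h1
      rw [f.apply_symm_apply, LinearEquiv.map_eq_zero_iff] at h2
      exact (one_mul a).symm.trans h2
    · rintro rfl
      refine LinearMap.ext fun x => ?_
      show f.symm (Deg.up 0 ((f x).dn * 0)) = 0
      rw [mul_zero]; exact map_zero f.symm
  have S0 : ∀ b, S 0 b → b = 0 := fun b h => (rf0 b).1 (sz_deg' 0 f f _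
    (RelN.sz_right h (by rw [(ru0 0).2 rfl]; exact SZ.zero)))
  have S0' : ∀ a, S a 0 → a = 0 := fun b h => (ru0 b).1 (sz_deg' 0 u u _
    (RelN.sz_left hq h (by rw [(rf0 0).2 rfl]; exact SZ.zero)))
  have J1 : ∀ a b, S a b → a ∈ Ring.jacobson A → b ∈ Ring.jacobson A := fun a b h ha =>
    jac_rel S hl hrr S1 Sm Ss S0 h ha
  have J2 : ∀ a b, S a b → b ∈ Ring.jacobson A → a ∈ Ring.jacobson A := fun a b h ha =>
    jac_rel (fun a b => S b a) hrr hl S1 (fun a b a' b' h h' => Sm _ _ _ _ h h')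
      (fun a b a' b' h h' => Ss _ _ _ _ h h') S0' h ha
  let π := Submodule.mkQ (Ring.jacobson A)
  have hπ : Function.Surjective π := Submodule.mkQ_surjective _
  have hπ0 : ∀ a, π a = 0 ↔ a ∈ Ring.jacobson A := fun a => Submodule.Quotient.mk_eq_zero _
  let P : V.X 0 →ₗ[GR k A m] X.X 0 := x0.symm.toLinearMap ∘ₗ degm 0 π ∘ₗ u.toLinearMap
  have hP : ∀ a, P ∘ₗ ru a = 0 ↔ a ∈ Ring.jacobson A := by
    intro a
    have e : ∀ x, (P ∘ₗ ru a) x = x0.symm (Deg.up 0 (π ((u x).dn * a))) := by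
      intro x
      show x0.symm (Deg.up 0 (π (Deg.dn (u (u.symm (Deg.up 0 ((u x).dn * a))))))) = _
      rw [u.apply_symm_apply]; rfl
    constructor
    · intro h
      have h1 := e (u.symm (Deg.up 0 1))
      rw [h, LinearMap.zero_apply, u.apply_symm_apply, eq_comm, LinearEquiv.map_eq_zero_iff] at h1
      have h2 : π (1 * a) = 0 := h1
      rwa [one_mul, hπ0] at h2
    · intro h
      refine LinearMap.ext fun x => ?_
      rw [e, (hπ0 _).2 (Ideal.mul_mem_left _ _ h)]
      exact map_zero x0.symm
  obtain ⟨H, hH⟩ := RelN.ex_right (c := V) (c' := X) n P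
  have key : ∀ b, b ∈ Ring.jacobson A ↔ H (f.symm (Deg.up 0 b)) = 0 := by
    intro b
    obtain ⟨a, ha⟩ := hrr b
    have hc : RelN V X n (P ∘ₗ ru a) (H ∘ₗ rf b) := RelN.comp ha hH
    constructor
    · intro hb
      have h1 := sz_deg' 0 f w _ (hc.sz_right (by rw [(hP a).2 (J2 a b ha hb)]; exact SZ.zero))
      have h2 := LinearMap.congr_fun h1 (f.symm (Deg.up 0 1))
      have h3 : H (f.symm (Deg.up 0 (Deg.dn (f (f.symm (Deg.up 0 1))) * b))) = 0 := h2
      rw [f.apply_symm_apply] at h3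
      have h4 : H (f.symm (Deg.up 0 (1 * b))) = 0 := h3
      rwa [one_mul] at h4
    · intro hb
      refine J1 a b ha ((hP a).1 (sz_deg' 0 u x0 _ (hc.sz_left hq ?_)))
      convert SZ.zero using 1
      refine LinearMap.ext fun x => ?_
      show H (f.symm (Deg.up 0 ((f x).dn * b))) = 0
      have h1 : Deg.up 0 ((f x).dn * b) = GR.cst (k := k) m (f x).dn 0 • Deg.up (0 : ZMod m) b := rfl
      rw [h1, map_smul, map_smul, hb, smul_zero]
  have surj : ∀ y : X.X n, ∃ b, H (f.symm (Deg.up 0 b)) = y := by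
    intro y
    let g : V.X n →ₗ[GR k A m] X.X n := w.symm.toLinearMap ∘ₗ
      degm 0 (LinearMap.toSpanSingleton A _ (w y).dn) ∘ₗ f.toLinearMap
    obtain ⟨g0, hg0⟩ := RelN.ex_left (c := V) (c' := X) hq n g
    obtain ⟨z, hz⟩ := hπ (x0 (g0 (u.symm (Deg.up 0 1)))).dn
    have hg1 : g0 = P ∘ₗ ru z := by
      refine LinearMap.ext fun x => ?_
      have e : (P ∘ₗ ru z) x = x0.symm (Deg.up 0 (π ((u x).dn * z))) := by
        show x0.symm (Deg.up 0 (π (Deg.dn (u (u.symm (Deg.up 0 ((u x).dn * z))))))) = _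
        rw [u.apply_symm_apply]; rfl
      rw [e, eq_comm, LinearEquiv.symm_apply_eq]
      have h5 : x = GR.cst (k := k) m (u x).dn 0 • u.symm (Deg.up 0 1) := by
        apply u.injective
        rw [map_smul, u.apply_symm_apply]
        show _ = Deg.up 0 ((u x).dn * 1)
        rw [mul_one]; rfl
      have h6 : x0 (g0 x) = Deg.up 0 ((u x).dn • π z) := by
        conv_lhs => rw [h5]
        rw [map_smul, map_smul, hz]; rfl
      rw [h6, ← smul_eq_mul, map_smul]
    obtain ⟨b, hb⟩ := hl z
    have hd := hg0.sub (RelN.comp hb hH)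
    have hz2 := sz_deg' 0 f w _ (hd.sz_right (by rw [hg1, sub_self]; exact SZ.zero))
    refine ⟨b, ?_⟩
    have h1 := LinearMap.congr_fun hz2 (f.symm (Deg.up 0 1))
    have h2 : w.symm (Deg.up 0 (Deg.dn (f (f.symm (Deg.up 0 1))) • (w y).dn)) -
      H (f.symm (Deg.up 0 (Deg.dn (f (f.symm (Deg.up 0 1))) * b))) = 0 := h1
    rw [f.apply_symm_apply] at h2
    have h3 : w.symm (Deg.up 0 ((1 : A) • (w y).dn)) - H (f.symm (Deg.up 0 ((1 : A) * b))) = 0 := h2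
    rw [one_mul, one_smul, sub_eq_zero] at h3
    rw [← h3]
    exact w.symm_apply_apply y
  obtain ⟨F, hF⟩ := ex_desc (R := GR k A m) (degm 0 π : Deg (0 : ZMod m) A →ₗ[GR k A m] Deg (0 : ZMod m) (SQ A))
    (fun y => hπ y) (H ∘ₗ f.symm.toLinearMap) (fun x hx => (key x).1 ((hπ0 _).1 hx))
  refine ⟨(LinearEquiv.ofBijective F ⟨?_, ?_⟩).symm⟩
  · rw [← LinearMap.ker_eq_bot, LinearMap.ker_eq_bot']
    intro x hx
    obtain ⟨b, rfl⟩ := hπ x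
    have h1 := hF (Deg.up 0 b)
    have h2 : F (π b) = H (f.symm (Deg.up 0 b)) := h1
    have h3 := (key b).2 (h2.symm.trans hx)
    exact (hπ0 b).2 h3
  · intro y
    obtain ⟨b, hb⟩ := surj y
    exact ⟨_, (hF (Deg.up 0 b)).trans hb⟩

end st3

section out

variable {k A : Type} [Field k] [Ring A] [Algebra k A] [FiniteDimensional k A]

theorem mem_jacB (x : TrivialExtension k A) :
    x ∈ Ring.jacobson (TrivialExtension k A) ↔ x.fst ∈ Ring.jacobson A := by
  have : IsArtinianRing A := IsArtinianRing.of_finite k A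
  constructor
  · intro h
    have hs : Function.Surjective (TrivSqZeroExt.fstHom k A (Module.Dual k A)) :=
      fun u => ⟨TrivSqZeroExt.inl u, rfl⟩
    have : RingHomSurjective (TrivSqZeroExt.fstHom k A (Module.Dual k A)).toRingHom := ⟨hs⟩
    exact Ring.le_comap_jacobson (f := (TrivSqZeroExt.fstHom k A (Module.Dual k A)).toRingHom) h
  · intro h
    have h1 : eGR k A x ∈ Ring.jacobson (GR k A 1) := GR.mem_jac (fun i => h)
    have : RingHomSurjective (eGR k A).symm.toRingEquiv.toRingHom := ⟨(eGR k A).symm.surjective⟩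
    have h2 := Ring.le_comap_jacobson (f := (eGR k A).symm.toRingEquiv.toRingHom) h1
    have h3 : (eGR k A).symm (eGR k A x) ∈ Ring.jacobson (TrivialExtension k A) := h2
    rwa [AlgEquiv.symm_apply_apply] at h3

theorem sqB_equiv : Nonempty (rs (toGR k A).toRingHom (ModuleCat.of (GR k A 1) (Deg (0 : ZMod 1) (SQ A)))
    ≃ₗ[TrivialExtension k A] SQ (TrivialExtension k A)) := by
  let B := TrivialExtension k A
  let T := rs (toGR k A).toRingHom (ModuleCat.of (GR k A 1) (Deg (0 : ZMod 1) (SQ A)))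
  let f : B →ₗ[B] T :=
    { toFun := fun x => Deg.up (0 : ZMod 1) (Submodule.mkQ (Ring.jacobson A) x.fst)
      map_add' := fun x y => rfl
      map_smul' := fun r x => rfl }
  have hf : Function.Surjective f := fun y => by
    obtain ⟨a, rfl⟩ := Submodule.mkQ_surjective (Ring.jacobson A) y
    exact ⟨TrivSqZeroExt.inl a, rfl⟩
  have hk : LinearMap.ker f = Ring.jacobson B := by
    ext x
    rw [LinearMap.mem_ker]
    exact (Submodule.Quotient.mk_eq_zero (Ring.jacobson A)).trans (mem_jacB x).symm
  have e1 : SQ B ≃ₗ[B] B ⧸ LinearMap.ker f := Submodule.quotEquivOfEq _ _ hk.symm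
  exact ⟨(e1.trans (f.quotKerEquivOfSurjective hf)).symm⟩

theorem rad_periodic (hB : ∀ (M : Type) [AddCommGroup M] [Module (TrivialExtension k A) M],
        Module.Finite (TrivialExtension k A) M → ComplexityLeOne k (TrivialExtension k A) M) :
    ∃ (n : ℕ) (c : Chain (TrivialExtension k A)), 1 ≤ n ∧ c.Min ∧
      Nonempty (c.X 0 ≃ₗ[TrivialExtension k A] SQ (TrivialExtension k A)) ∧
      Nonempty (c.X n ≃ₗ[TrivialExtension k A] SQ (TrivialExtension k A)) := by
  obtain ⟨C1, hC1⟩ := bound hB A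
  obtain ⟨C2, hC2⟩ := bound hB (SQ A)
  obtain ⟨g, hg⟩ := step1 (SQ A) (Submodule.mkQ (Ring.jacobson A)) (Submodule.mkQ_surjective _) (max C1 C2)
    (fun m _ d c h j => (hC1 m d c h j).trans (le_max_left _ _))
    (fun m _ d c h j => (hC2 m d c h j).trans (le_max_right _ _))
  let m := C2 + 2 * g + 3
  have : NeZero m := ⟨by simp [m]⟩
  obtain ⟨n, hn, hper⟩ := period (k := k) (A := A) (m := m) (by simp only [m]; omega) C1 (hC1 m)
  obtain ⟨X, hX⟩ := ex_ch (k := k) (A := A) m 0 (SQ A)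
  obtain ⟨V, hV⟩ := ex_ch (k := k) (A := A) m 0 A
  have hm : (1 : ZMod m) ≠ 0 := by
    have : Fact (1 < m) := ⟨by simp only [m]; omega⟩
    exact one_ne_zero
  have h2 := step2 g C2 n hg hn le_rfl hper X hX (hC2 m 0 X hX n)
  obtain ⟨f⟩ := hper 0 V hV
  obtain ⟨u⟩ := hV.2
  obtain ⟨x0⟩ := hX.2
  obtain ⟨xn⟩ := step3 n V X hm u f x0 h2
  obtain ⟨s⟩ := sqB_equiv (k := k) (A := A)
  let q : ZMod m → ZMod 1 := fun _ => 0
  have hq : ∀ i : ZMod m, q (i - 1) = q i - 1 :=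
    fun i => Subsingleton.elim _ _
  let c := (X.res (GR.good_pb q hq)).res (goodB k A)
  have key : ∀ j, (X.X j ≃ₗ[GR k A m] Deg (0 : ZMod m) (SQ A)) →
      Nonempty (c.X j ≃ₗ[TrivialExtension k A] SQ (TrivialExtension k A)) := by
    intro j e
    let w : c.X j ≃ₗ[TrivialExtension k A] rs (toGR k A).toRingHom
        (ModuleCat.of (GR k A 1) (Deg (0 : ZMod 1) (SQ A))) :=
          { toFun := fun x => Deg.up (0 : ZMod 1) (e x).dn
            map_add' := fun x y => e.map_add x y
            map_smul' := fun r x => (e.map_smul (GR.pb q hq (toGR k A r)) x).trans rfl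
            invFun := fun x => e.symm (Deg.up _ (show Deg (0 : ZMod 1) (SQ A) from x).dn)
            left_inv := fun x => e.left_inv x
            right_inv := fun x => e.right_inv x }
    exact ⟨w.trans s⟩
  exact ⟨n, c, hn, Chain.res_min _ (Chain.res_min _ hX.1), key 0 x0, key n xn⟩

end out

end
end TE

namespace TE

noncomputable section

open Module TensorProduct

theorem ss_gen {L E : Type} [Ring L] [Ring E] [IsSemisimpleRing E] (β : E →+* L) {t : ℕ} (n : Fin t → ℕ)
    (hn : ∀ i, NeZero (n i)) (u : ∀ i, Fin (n i) → Fin (n i) → L) (h1 : ∑ i, ∑ a, u i a a = 1)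
    (hmul : ∀ i a b c d, u i a b * u i c d = if b = c then u i a d else 0)
    (hne : ∀ i j a b c d, i ≠ j → u i a b * u j c d = 0)
    (hc : ∀ i a b e, u i a b * β e = β e * u i a b)
    (hgen : ∀ x : L, x ∈ AddSubgroup.closure {y | ∃ i a b e, y = u i a b * β e}) : IsSemisimpleRing L := by
  have main : ∀ W : Submodule L L, ∃ W', IsCompl W W' := by
    intro W
    have : IsSemisimpleModule E (rs β (ModuleCat.of L L)) := IsSemisimpleRing.isSemisimpleModule
    obtain ⟨p, hp⟩ := IsSemisimpleModule.extension_property (R := E)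
      (rsm β (M := ModuleCat.of L W) (N := ModuleCat.of L L) W.subtype) W.subtype_injective LinearMap.id
    let q : L → W := fun x => p x
    have q_add : ∀ x y, q (x + y) = q x + q y := fun x y => p.map_add x y
    have q_smul : ∀ e x, q (β e * x) = β e • q x := fun e x => p.map_smul e x
    have q_id : ∀ w : W, q w = w := fun w => LinearMap.congr_fun hp w
    let qh : L →+ W := ⟨⟨q, p.map_zero⟩, q_add⟩
    let o : ∀ i, Fin (n i) := fun i => haveI := hn i; 0
    let Q : L → W := fun x => ∑ i, ∑ a, u i a (o i) • q (u i (o i) a * x)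
    have Q_add : ∀ x y, Q (x + y) = Q x + Q y := by
      intro x y
      simp only [Q, mul_add, q_add, smul_add, Finset.sum_add_distrib]
    have Q_u : ∀ j c d x, Q (u j c d * x) = u j c d • Q x := by
      intro j c d x
      have l : Q (u j c d * x) = u j c (o j) • q (u j (o j) d * x) := by
        simp only [Q]
        rw [Finset.sum_eq_single j, Finset.sum_eq_single c]
        · rw [← mul_assoc, hmul, if_pos rfl]
        · intro a _ ha
          rw [← mul_assoc, hmul, if_neg ha, zero_mul]
          show _ • qh 0 = 0
          rw [map_zero, smul_zero]
        · simp
        · intro i _ hi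
          refine Finset.sum_eq_zero fun a _ => ?_
          rw [← mul_assoc, hne _ _ _ _ _ _ hi, zero_mul]
          show _ • qh 0 = 0
          rw [map_zero, smul_zero]
        · simp
      rw [l]
      simp only [Q, Finset.smul_sum]
      rw [Finset.sum_eq_single j, Finset.sum_eq_single d]
      · rw [smul_smul, hmul, if_pos rfl]
      · intro a _ ha
        rw [smul_smul, hmul, if_neg ha.symm, zero_smul]
      · simp
      · intro i _ hi
        refine Finset.sum_eq_zero fun a _ => ?_
        rw [smul_smul, hne _ _ _ _ _ _ hi.symm, zero_smul]
      · simp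
    have Q_e : ∀ e x, Q (β e * x) = β e • Q x := by
      intro e x
      simp only [Q, Finset.smul_sum]
      refine Finset.sum_congr rfl fun i _ => Finset.sum_congr rfl fun a _ => ?_
      rw [← mul_assoc, hc, mul_assoc, q_smul, smul_smul, smul_smul, hc]
    have Q_smul : ∀ r x, Q (r * x) = r • Q x := by
      intro r x
      induction hgen r using AddSubgroup.closure_induction with
      | mem y hy =>
        obtain ⟨i, a, b, e, rfl⟩ := hy
        rw [mul_assoc, Q_u, Q_e, smul_smul]
      | zero =>
        rw [zero_mul, zero_smul]
        have := Q_add 0 0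
        rw [add_zero] at this
        exact left_eq_add.1 this
      | add y z _ _ hy hz => rw [add_mul, Q_add, hy, hz, add_smul]
      | neg y _ hy =>
        rw [neg_smul, ← hy, eq_neg_iff_add_eq_zero, ← Q_add, neg_mul, neg_add_cancel]
        have := Q_add 0 0
        rw [add_zero] at this
        exact left_eq_add.1 this
    let f : L →ₗ[L] W := ⟨⟨Q, Q_add⟩, Q_smul⟩
    refine ⟨LinearMap.ker f, LinearMap.isCompl_of_proj (f := f) fun w => ?_⟩
    show Q w = w
    have : ∀ i a, u i a (o i) • q (u i (o i) a * w) = u i a a • w := by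
      intro i a
      have h2 : q (u i (o i) a * w) = u i (o i) a • w := q_id (u i (o i) a • w)
      rw [h2, smul_smul, hmul, if_pos rfl]
    simp only [Q, this]
    simp only [← Finset.sum_smul]
    rw [h1, one_smul]
  exact { toComplementedLattice := ⟨main⟩ }

section sep

variable {k S : Type} [Field k] [Ring S] [Algebra k S] [FiniteDimensional k S]

theorem sep_gen {K E F T : Type} [Field K] [IsAlgClosed K] [Ring E] [Algebra K E] [FiniteDimensional K E]
    [IsSemisimpleRing E] [Ring F] [Algebra K F] [IsSemisimpleRing F] [Ring T] [Algebra K T]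
    (α : E →ₐ[K] T) (β : F →ₐ[K] T) (hcomm : ∀ x y, α x * β y = β y * α x)
    (hg : ∀ x, x ∈ AddSubgroup.closure {z | ∃ c y, z = α c * β y}) : IsSemisimpleRing T := by
  obtain ⟨t, d, hd, ⟨e⟩⟩ := IsSemisimpleRing.exists_algEquiv_pi_matrix_of_isAlgClosed K E
  let v : ∀ i, Fin (d i) → Fin (d i) → (Π i, Matrix (Fin (d i)) (Fin (d i)) K) := fun i a b =>
    Pi.single i (Matrix.single a b 1)
  have vsum : ∀ x : (Π i, Matrix (Fin (d i)) (Fin (d i)) K), x = ∑ i, ∑ a, ∑ b, x i a b • v i a b := by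
    intro x
    have h1 : ∀ i, ∑ a, ∑ b, x i a b • v i a b = Pi.single i (x i) := by
      intro i
      conv_rhs => rw [Matrix.matrix_eq_sum_single (x i)]
      show _ = LinearMap.single K _ i _
      rw [map_sum]
      refine Finset.sum_congr rfl fun a _ => ?_
      rw [map_sum]
      refine Finset.sum_congr rfl fun b _ => ?_
      have : Matrix.single a b (x i a b) = x i a b • Matrix.single a b 1 := by simp
      rw [this, map_smul]; rfl
    simp only [h1]
    exact (Finset.univ_sum_single x).symm
  refine ss_gen β.toRingHom d hd (fun i a b => α (e.symm (v i a b))) ?_ ?_ ?_ ?_ ?_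
  · simp only [← map_sum]
    have : ∑ i, ∑ a, v i a a = 1 := by
      conv_rhs => rw [vsum 1]
      refine Finset.sum_congr rfl fun i _ => Finset.sum_congr rfl fun a _ => ?_
      rw [Finset.sum_eq_single a]
      · simp
      · intro b _ hb
        rw [Pi.one_apply, Matrix.one_apply_ne hb.symm, zero_smul]
      · simp
    rw [this, map_one, map_one]
  · intro i a b c f
    rw [← map_mul, ← map_mul]
    have : v i a b * v i c f = if b = c then v i a f else 0 := by
      simp only [v]
      rw [← Pi.single_mul]
      split_ifs with h
      · subst h; simp
      · rw [Matrix.single_mul_single_of_ne _ _ _ _ h]; simp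
    rw [this]
    split_ifs <;> simp
  · intro i j a b c f hij
    rw [← map_mul, ← map_mul]
    have : v i a b * v j c f = 0 := by
      funext l
      simp only [v, Pi.mul_apply, Pi.zero_apply]
      by_cases h : l = i
      · rw [Pi.single_eq_of_ne (M := fun i => Matrix (Fin (d i)) (Fin (d i)) K) (i := j) (i' := l) (by rw [h]; exact hij), mul_zero]
      · rw [Pi.single_eq_of_ne (M := fun i => Matrix (Fin (d i)) (Fin (d i)) K) (i := i) (i' := l) h, zero_mul]
    rw [this, map_zero, map_zero]
  · intro i a b y
    exact hcomm _ _
  · have key : ∀ c y, α c * β y ∈ AddSubgroup.closure {z | ∃ i a b y, z = α (e.symm (v i a b)) * β y} := by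
      intro c y
      have h1 : c = ∑ i, ∑ a, ∑ b, e c i a b • e.symm (v i a b) := by
        apply e.injective
        conv_lhs => rw [vsum (e c)]
        simp only [map_sum, map_smul, AlgEquiv.apply_symm_apply]
      rw [h1]
      simp only [map_sum, Finset.sum_mul]
      refine AddSubgroup.sum_mem _ fun i _ => AddSubgroup.sum_mem _ fun a _ => AddSubgroup.sum_mem _ fun b _ =>
        AddSubgroup.subset_closure ⟨i, a, b, e c i a b • y, ?_⟩
      rw [map_smul, map_smul, smul_mul_assoc, mul_smul_comm]
    intro x
    refine (AddSubgroup.closure_le _).2 ?_ (hg x)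
    rintro _ ⟨c, y, rfl⟩
    exact key c y

theorem tens_comm {K Q T : Type} [Field K] [Algebra k K] [Ring Q] [Algebra k Q] [Ring T]
    (α : K ⊗[k] S → T) (β : K ⊗[k] Q → T) (ha : ∀ x y, α (x + y) = α x + α y)
    (hb : ∀ x y, β (x + y) = β x + β y)
    (h : ∀ x s y q, α (x ⊗ₜ s) * β (y ⊗ₜ q) = β (y ⊗ₜ q) * α (x ⊗ₜ s)) (x : K ⊗[k] S) (y : K ⊗[k] Q) :
    α x * β y = β y * α x := by
  have ha0 : α 0 = 0 := by have := ha 0 0; rw [add_zero] at this; exact left_eq_add.1 this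
  have hb0 : β 0 = 0 := by have := hb 0 0; rw [add_zero] at this; exact left_eq_add.1 this
  induction x using TensorProduct.induction_on with
  | zero => rw [ha0, zero_mul, mul_zero]
  | add x x' h h' => rw [ha, add_mul, h, h', mul_add]
  | tmul x s =>
    induction y using TensorProduct.induction_on with
    | zero => rw [hb0, zero_mul, mul_zero]
    | add x x' h h' => rw [hb, mul_add, h, h', add_mul]
    | tmul y s' => exact h _ _ _ _

theorem sep_ext {K : Type} [Field K] [Algebra k K] [IsAlgClosed K] (hS : IsSemisimpleRing (K ⊗[k] S)) :
    IsSemisimpleRing (K ⊗[k] (S ⊗[k] Sᵐᵒᵖ)) := by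
  let α : K ⊗[k] S →ₐ[K] K ⊗[k] (S ⊗[k] Sᵐᵒᵖ) :=
    Algebra.TensorProduct.map (AlgHom.id K K) (Algebra.TensorProduct.includeLeft)
  let β : K ⊗[k] Sᵐᵒᵖ →ₐ[K] K ⊗[k] (S ⊗[k] Sᵐᵒᵖ) :=
    Algebra.TensorProduct.map (AlgHom.id K K) (Algebra.TensorProduct.includeRight)
  have hα : ∀ x s, α (x ⊗ₜ s) = x ⊗ₜ (s ⊗ₜ 1) := fun x s => rfl
  have hβ : ∀ x s, β (x ⊗ₜ s) = x ⊗ₜ (1 ⊗ₜ s) := fun x s => rfl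
  have : IsSemisimpleRing (K ⊗[k] Sᵐᵒᵖ) := by
    have : IsSemisimpleRing (K ⊗[k] S)ᵐᵒᵖ := isSemisimpleRing_mulOpposite_iff.2 hS
    let e1 : Kᵐᵒᵖ ⊗[k] Sᵐᵒᵖ ≃ₐ[k] (K ⊗[k] S)ᵐᵒᵖ := Algebra.TensorProduct.opAlgEquiv k k K S
    let e2 : K ⊗[k] Sᵐᵒᵖ ≃ₐ[k] Kᵐᵒᵖ ⊗[k] Sᵐᵒᵖ :=
      Algebra.TensorProduct.congr (AlgEquiv.toOpposite k K) AlgEquiv.refl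
    exact (e2.trans e1).symm.toRingEquiv.isSemisimpleRing
  refine sep_gen α β ?_ ?_
  · refine tens_comm α β (fun x y => map_add α x y) (fun x y => map_add β x y) ?_
    intro x s y s'
    show α (x ⊗ₜ s) * β (y ⊗ₜ s') = β (y ⊗ₜ s') * α (x ⊗ₜ s)
    rw [hα, hβ, Algebra.TensorProduct.tmul_mul_tmul, Algebra.TensorProduct.tmul_mul_tmul,
      Algebra.TensorProduct.tmul_mul_tmul, Algebra.TensorProduct.tmul_mul_tmul]
    simp [mul_comm]
  · intro x
    induction x using TensorProduct.induction_on with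
    | zero => exact AddSubgroup.zero_mem _
    | add x y hx hy => exact AddSubgroup.add_mem _ hx hy
    | tmul x z =>
      induction z using TensorProduct.induction_on with
      | zero => rw [tmul_zero]; exact AddSubgroup.zero_mem _
      | add y z hy hz => rw [tmul_add]; exact AddSubgroup.add_mem _ hy hz
      | tmul s s' =>
        refine AddSubgroup.subset_closure ⟨x ⊗ₜ s, 1 ⊗ₜ s', ?_⟩
        rw [hα, hβ, Algebra.TensorProduct.tmul_mul_tmul, Algebra.TensorProduct.tmul_mul_tmul]
        simp

theorem jac_zero_of_ext {T K : Type} [Ring T] [Algebra k T] [FiniteDimensional k T] [Field K] [Algebra k K]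
    (h : IsSemisimpleRing (K ⊗[k] T)) : Ring.jacobson T = ⊥ := by
  have : IsArtinianRing T := IsArtinianRing.of_finite k T
  obtain ⟨m, hm⟩ : IsNilpotent (Ring.jacobson T) := IsSemiprimaryRing.isNilpotent
  let V : ℕ → AddSubgroup (K ⊗[k] T) := fun i =>
    AddSubgroup.closure {y | ∃ (a : K) (x : T), x ∈ (Ring.jacobson T) ^ i ∧ y = a ⊗ₜ x}
  rw [eq_bot_iff]
  intro x hx
  have step : ∀ i (y z : K ⊗[k] T), z ∈ V i → (1 ⊗ₜ x) * y * z ∈ V (i + 1) := by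
    intro i y z hz
    induction hz using AddSubgroup.closure_induction with
    | mem z hz =>
      obtain ⟨a, z, hz, rfl⟩ := hz
      induction y using TensorProduct.induction_on with
      | zero => rw [mul_zero, zero_mul]; exact AddSubgroup.zero_mem _
      | add a b ha hb => rw [mul_add, add_mul]; exact AddSubgroup.add_mem _ ha hb
      | tmul b t =>
        refine AddSubgroup.subset_closure ⟨b * a, x * (t * z), ?_, by simp [mul_assoc]⟩
        rw [Ideal.IsTwoSided.pow_succ]
        exact Ideal.mul_mem_mul hx (Ideal.mul_mem_left _ _ hz)
    | zero => rw [mul_zero]; exact AddSubgroup.zero_mem _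
    | add y z _ _ hy hz => rw [mul_add]; exact AddSubgroup.add_mem _ hy hz
    | neg y _ hy => rw [mul_neg]; exact AddSubgroup.neg_mem _ hy
  obtain ⟨y, hy⟩ : ∃ y, (1 ⊗ₜ[k] x : K ⊗[k] T) * y * (1 ⊗ₜ x) = 1 ⊗ₜ x := by
    obtain ⟨W, hW⟩ := exists_isCompl (Ideal.span {(1 ⊗ₜ[k] x : K ⊗[k] T)})
    have h1 : (1 : K ⊗[k] T) ∈ Ideal.span {(1 ⊗ₜ[k] x : K ⊗[k] T)} ⊔ W := by
      rw [hW.sup_eq_top]; trivial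
    obtain ⟨a, ha, w, hw, haw⟩ := Submodule.mem_sup.1 h1
    obtain ⟨y, rfl⟩ := Ideal.mem_span_singleton'.1 ha
    refine ⟨y, ?_⟩
    have h2 : (1 ⊗ₜ[k] x : K ⊗[k] T) * w = 1 ⊗ₜ x - 1 ⊗ₜ[k] x * y * (1 ⊗ₜ x) := by
      rw [eq_sub_iff_add_eq', mul_assoc, ← mul_add, haw, mul_one]
    have h3 : (1 ⊗ₜ[k] x : K ⊗[k] T) * w ∈ Ideal.span {(1 ⊗ₜ[k] x : K ⊗[k] T)} ⊓ W := by
      refine ⟨?_, Ideal.mul_mem_left _ _ hw⟩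
      rw [h2]
      exact Ideal.sub_mem _ (Ideal.mem_span_singleton_self _)
        (Ideal.mul_mem_left _ _ (Ideal.mem_span_singleton_self _))
    rw [hW.inf_eq_bot, Submodule.mem_bot, h2] at h3
    exact (sub_eq_zero.1 h3).symm
  have all : ∀ i, (1 ⊗ₜ[k] x : K ⊗[k] T) ∈ V i := by
    intro i
    induction i with
    | zero => exact AddSubgroup.subset_closure ⟨1, x, by rw [Submodule.pow_zero, Ideal.one_eq_top]; trivial, rfl⟩
    | succ i ih => rw [← hy]; exact step i _ _ ih
  have h0 : (1 ⊗ₜ[k] x : K ⊗[k] T) = 0 := by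
    have := all m
    have h1 : V m ≤ ⊥ := by
      refine (AddSubgroup.closure_le _).2 ?_
      rintro _ ⟨a, z, hz, rfl⟩
      rw [hm] at hz
      rw [show z = 0 from hz, tmul_zero]; exact AddSubgroup.zero_mem _
    exact h1 this
  have hinj := Algebra.TensorProduct.includeRight_injective (R := k) (A := K) (B := T) (algebraMap k K).injective
  exact hinj (by rw [map_zero]; exact h0)

end sep

end
end TE

namespace TE

noncomputable section

open Module TensorProduct MulOpposite

section env

variable {k B : Type} [Field k] [Ring B] [Algebra k B]

theorem jac_env {S : Type} [Ring S] [Algebra k S] [FiniteDimensional k S] (π : B →ₐ[k] S)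
    (hπ : Function.Surjective π) (hk : ∀ x, π x = 0 → x ∈ Ring.jacobson B)
    {K : Type} [Field K] [Algebra k K] [IsAlgClosed K] (hS : IsSemisimpleRing (K ⊗[k] S))
    (r : B ⊗[k] Bᵐᵒᵖ) (hr : r ∈ Ring.jacobson (B ⊗[k] Bᵐᵒᵖ)) :
    r ∈ AddSubgroup.closure {y : B ⊗[k] Bᵐᵒᵖ | ∃ b c : B, (b ∈ Ring.jacobson B ∨ c ∈ Ring.jacobson B) ∧
      y = b ⊗ₜ op c} := by
  have : FiniteDimensional k (S ⊗[k] Sᵐᵒᵖ) := by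
    have : FiniteDimensional k Sᵐᵒᵖ := Module.Finite.equiv (MulOpposite.opLinearEquiv k)
    infer_instance
  have h0 : Ring.jacobson (S ⊗[k] Sᵐᵒᵖ) = ⊥ := jac_zero_of_ext (sep_ext hS)
  let Pi0 : B ⊗[k] Bᵐᵒᵖ →ₐ[k] S ⊗[k] Sᵐᵒᵖ := Algebra.TensorProduct.map π (AlgHom.op π)
  have hop : Function.Surjective (AlgHom.op π) := fun x => by
    obtain ⟨y, hy⟩ := hπ x.unop
    exact ⟨op y, by simp [hy]⟩
  have hs : Function.Surjective Pi0 := TensorProduct.map_surjective hπ hop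
  have : RingHomSurjective Pi0.toRingHom := ⟨hs⟩
  have h1 : Pi0 r = 0 := by
    have := Ring.le_comap_jacobson Pi0.toRingHom hr
    rw [Ideal.mem_comap, h0] at this
    exact this
  let p : B →ₗ[k] S := π.toLinearMap
  let q : Bᵐᵒᵖ →ₗ[k] Sᵐᵒᵖ := (AlgHom.op π).toLinearMap
  have h2 : r ∈ (TensorProduct.map p q).ker := h1
  rw [TensorProduct.map_ker (f := p.ker.subtype) (g := p) (LinearMap.exact_subtype_ker_map p) hπ
    (f' := q.ker.subtype) (g' := q) (LinearMap.exact_subtype_ker_map q) hop] at h2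
  obtain ⟨a, ⟨a', rfl⟩, b, ⟨b', rfl⟩, rfl⟩ := Submodule.mem_sup.1 h2
  refine AddSubgroup.add_mem _ ?_ ?_
  · clear hr h1 h2
    induction a' using TensorProduct.induction_on with
    | zero => rw [map_zero]; exact AddSubgroup.zero_mem _
    | add x y hx hy => rw [map_add]; exact AddSubgroup.add_mem _ hx hy
    | tmul x y =>
      refine AddSubgroup.subset_closure ⟨x, y.1.unop, Or.inr (hk _ ?_), rfl⟩
      have := y.2
      exact congrArg unop (LinearMap.mem_ker.1 this)
  · clear hr h1 h2
    induction b' using TensorProduct.induction_on with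
    | zero => rw [map_zero]; exact AddSubgroup.zero_mem _
    | add x y hx hy => rw [map_add]; exact AddSubgroup.add_mem _ hx hy
    | tmul x y =>
      refine AddSubgroup.subset_closure ⟨x.1, y.unop, Or.inl (hk _ ?_), rfl⟩
      exact LinearMap.mem_ker.1 x.2

abbrev ell (k B : Type) [Field k] [Ring B] [Algebra k B] : B →ₐ[k] B ⊗[k] Bᵐᵒᵖ :=
  Algebra.TensorProduct.includeLeft

abbrev arr (k B : Type) [Field k] [Ring B] [Algebra k B] : Bᵐᵒᵖ →ₐ[k] B ⊗[k] Bᵐᵒᵖ :=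
  Algebra.TensorProduct.includeRight

theorem proj_rs {R R' : Type} [Ring R] [Ring R'] (ρ : R' →+* R)
    (h : Module.Projective R' (rs ρ (ModuleCat.of R R))) (P : ModuleCat.{0} R) [Module.Projective R P] :
    Module.Projective R' (rs ρ P) := by
  obtain ⟨s, hs⟩ := Module.projective_def'.1 (show Module.Projective R P from inferInstance)
  apply Module.Projective.of_lifting_property
  intro M N _ _ _ _ f g hf
  have := h
  have H : ∀ x : P, ∃ u : rs ρ (ModuleCat.of R R) →ₗ[R'] M, ∀ r : R,
      f (u r) = g (show (P : Type) from r • x) := by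
    intro x
    let G : rs ρ (ModuleCat.of R R) →ₗ[R'] N := g ∘ₗ rsm ρ (M := ModuleCat.of R R) (N := P) (LinearMap.toSpanSingleton R P x)
    obtain ⟨u, hu⟩ := proj_lift f hf G
    exact ⟨u, hu⟩
  choose u hu using H
  let U : (P →₀ R) → M := fun y => y.sum fun x r => u x r
  have U0 : ∀ x, u x (0 : R) = 0 := fun x => (u x).map_zero
  have Ua : ∀ y z, U (y + z) = U y + U z := fun y z =>
    Finsupp.sum_add_index' (h := fun x r => u x r) U0 (fun x r r' => (u x).map_add r r')
  have Us : ∀ (a : R') y, U (ρ a • y) = a • U y := fun a y => by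
    show (ρ a • y).sum _ = _
    rw [Finsupp.sum_smul_index' U0]
    show _ = a • y.sum _
    rw [Finsupp.smul_sum]
    exact Finsupp.sum_congr fun x _ => (u x).map_smul a _
  have Uf : ∀ y, f (U y) = g (show (P : Type) from Finsupp.linearCombination R id y) := fun y => by
    induction y using Finsupp.induction_linear with
    | zero => rw [map_zero]; exact (congrArg f (Finsupp.sum_zero_index)).trans (by rw [map_zero]; exact g.map_zero.symm)
    | add y z hy hz => rw [Ua, map_add, hy, hz, map_add]; exact (g.map_add _ _).symm
    | single x r =>
      rw [Finsupp.linearCombination_single]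
      refine (congrArg f (Finsupp.sum_single_index (h := fun x r => u x r) (U0 x))).trans (hu x r)
  refine ⟨⟨⟨fun x => U (s x), fun x y => (congrArg U (s.map_add x y)).trans (Ua _ _)⟩, fun a x =>
    (congrArg U (s.map_smul (ρ a) x)).trans (Us a _)⟩, ?_⟩
  ext x
  refine (Uf (s x)).trans (congrArg g ?_)
  exact LinearMap.congr_fun hs x

theorem proj_ell (P : ModuleCat.{0} (B ⊗[k] Bᵐᵒᵖ)) [Module.Projective (B ⊗[k] Bᵐᵒᵖ) P] :
    Module.Projective B (rs (ell k B).toRingHom P) := by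
  apply proj_rs
  let w : (B ⊗[k] Bᵐᵒᵖ) ≃ₗ[B] rs (ell k B).toRingHom (ModuleCat.of (B ⊗[k] Bᵐᵒᵖ) (B ⊗[k] Bᵐᵒᵖ)) :=
    { AddEquiv.refl _ with
      map_smul' := fun b x => by
        show b • x = (ell k B b) * x
        induction x using TensorProduct.induction_on with
        | zero => rw [smul_zero, mul_zero]
        | add x y hx hy => rw [smul_add, hx, hy, mul_add]
        | tmul x y => simp [TensorProduct.smul_tmul'] }
  exact Module.Projective.of_equiv w

theorem proj_arr (P : ModuleCat.{0} (B ⊗[k] Bᵐᵒᵖ)) [Module.Projective (B ⊗[k] Bᵐᵒᵖ) P] :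
    Module.Projective Bᵐᵒᵖ (rs (arr k B).toRingHom P) := by
  apply proj_rs
  let w : (Bᵐᵒᵖ ⊗[k] B) ≃ₗ[Bᵐᵒᵖ] rs (arr k B).toRingHom (ModuleCat.of (B ⊗[k] Bᵐᵒᵖ) (B ⊗[k] Bᵐᵒᵖ)) :=
    { (TensorProduct.comm k Bᵐᵒᵖ B).toAddEquiv with
      map_smul' := fun b x => by
        show TensorProduct.comm k Bᵐᵒᵖ B (b • x) = (arr k B b) * TensorProduct.comm k Bᵐᵒᵖ B x
        induction x using TensorProduct.induction_on with
        | zero => rw [smul_zero, map_zero, mul_zero]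
        | add x y hx hy => rw [smul_add, map_add, hx, hy, map_add, mul_add]
        | tmul x y => simp [TensorProduct.smul_tmul'] }
  exact Module.Projective.of_equiv w

theorem proj_ker {R : Type} [Ring R] {K P N : Type} [AddCommGroup K] [AddCommGroup P] [AddCommGroup N]
    [Module R K] [Module R P] [Module R N] [Module.Projective R N] [Module.Projective R P]
    (i : K →ₗ[R] P) (p : P →ₗ[R] N) (hi : Function.Injective i) (hp : Function.Surjective p)
    (h : ∀ x, p x = 0 ↔ ∃ y, i y = x) :
    Module.Projective R K ∧ ∃ r : P →ₗ[R] K, ∀ x, r (i x) = x := by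
  obtain ⟨s, hs⟩ := proj_lift p hp (LinearMap.id)
  obtain ⟨r, hr⟩ := ex_lift i hi (LinearMap.id - s ∘ₗ p) (fun x => (h _).1 (by simp [hs]))
  have : ∀ x, r (i x) = x := fun x => hi (by
    rw [hr]; simp [(h (i x)).2 ⟨x, rfl⟩])
  exact ⟨Module.Projective.of_split i r (by ext x; exact this x), r, this⟩

end env

end
end TE

namespace TE

noncomputable section

open Module TensorProduct MulOpposite

section QF

variable {k B : Type} [Field k] [Ring B] [Algebra k B]

abbrev Lf (P : ModuleCat.{0} (B ⊗[k] Bᵐᵒᵖ)) : ModuleCat.{0} B := rs (ell k B).toRingHom P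

def rm (P : ModuleCat.{0} (B ⊗[k] Bᵐᵒᵖ)) (b : B) : Lf P →ₗ[B] Lf P where
  toFun p := show (P : Type) from ((1 : B) ⊗ₜ[k] op b) • (show (P : Type) from p)
  map_add' p q := smul_add ((1 : B) ⊗ₜ[k] op b) (show (P : Type) from p) (show (P : Type) from q)
  map_smul' a p := by
    show ((1 : B) ⊗ₜ[k] op b) • (a ⊗ₜ[k] (1 : Bᵐᵒᵖ)) • (show (P : Type) from p) =
      (a ⊗ₜ[k] (1 : Bᵐᵒᵖ)) • ((1 : B) ⊗ₜ[k] op b) • (show (P : Type) from p)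
    rw [smul_smul, smul_smul]; simp

variable {P P' : ModuleCat.{0} (B ⊗[k] Bᵐᵒᵖ)}

theorem rm_def (b : B) (p : Lf P) : rm P b p = (show (P : Type) from ((1 : B) ⊗ₜ[k] op b) • (show (P : Type) from p)) := rfl

theorem rm_mul (a b : B) (p : Lf P) : rm P (a * b) p = rm P b (rm P a p) := by
  rw [rm_def, rm_def, rm_def]
  show ((1 : B) ⊗ₜ[k] op (a * b)) • (show (P : Type) from p) =
    ((1 : B) ⊗ₜ[k] op b) • ((1 : B) ⊗ₜ[k] op a) • (show (P : Type) from p)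
  rw [smul_smul]; simp

theorem rm_one (p : Lf P) : rm P 1 p = p := one_smul (B ⊗[k] Bᵐᵒᵖ) (show (P : Type) from p)

theorem rm_add (a b : B) (p : Lf P) : rm P (a + b) p = rm P a p + rm P b p := by
  show ((1 : B) ⊗ₜ[k] op (a + b)) • (show (P : Type) from p) = _
  rw [op_add, tmul_add, add_smul]; rfl

theorem rm_zero (p : Lf P) : rm P 0 p = 0 := by
  show ((1 : B) ⊗ₜ[k] op (0 : B)) • (show (P : Type) from p) = _
  rw [op_zero, tmul_zero]; exact zero_smul (B ⊗[k] Bᵐᵒᵖ) (show (P : Type) from p)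

theorem rm_alg (c : k) (b : B) (p : Lf P) : rm P (c • b) p = algebraMap k B c • rm P b p := by
  show ((1 : B) ⊗ₜ[k] op (c • b)) • (show (P : Type) from p) =
    (algebraMap k B c ⊗ₜ[k] (1 : Bᵐᵒᵖ)) • ((1 : B) ⊗ₜ[k] op b) • (show (P : Type) from p)
  rw [smul_smul]
  congr 1
  rw [op_smul, tmul_smul, Algebra.algebraMap_eq_smul_one, TensorProduct.smul_tmul']
  simp

theorem rm_map (f : P →ₗ[B ⊗[k] Bᵐᵒᵖ] P') (b : B) (p : Lf P) : f (rm P b p) = rm P' b (f p) :=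
  f.map_smul _ _

theorem rm_lm (a b : B) (p : Lf P) :
    (show (P : Type) from (a ⊗ₜ[k] op b) • (show (P : Type) from p)) = a • rm P b p := by
  show (a ⊗ₜ[k] op b) • (show (P : Type) from p) =
    (a ⊗ₜ[k] (1 : Bᵐᵒᵖ)) • ((1 : B) ⊗ₜ[k] op b) • (show (P : Type) from p)
  rw [smul_smul]; simp

variable {ι : Type} [Fintype ι] (L : Submodule B (ι → B))

def PL (P : ModuleCat.{0} (B ⊗[k] Bᵐᵒᵖ)) : Submodule B (ι → Lf P) where
  carrier := AddSubgroup.closure {x | ∃ l ∈ L, ∃ p : Lf P, x = fun i => rm P (l i) p}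
  add_mem' := AddSubgroup.add_mem _
  zero_mem' := AddSubgroup.zero_mem _
  smul_mem' b x hx := by
    change x ∈ AddSubgroup.closure _ at hx
    show _ ∈ AddSubgroup.closure _
    induction hx using AddSubgroup.closure_induction with
    | mem x hx =>
      obtain ⟨l, hl, p, rfl⟩ := hx
      refine AddSubgroup.subset_closure ⟨l, hl, b • p, ?_⟩
      funext i
      exact ((rm P (l i)).map_smul b p).symm
    | zero => rw [smul_zero]; exact AddSubgroup.zero_mem _
    | add x y _ _ hx hy => rw [smul_add]; exact AddSubgroup.add_mem _ hx hy
    | neg x _ hx => rw [smul_neg]; exact AddSubgroup.neg_mem _ hx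

variable {L}

theorem PL.mem {l : ι → B} (hl : l ∈ L) (p : Lf P) : (fun i => rm P (l i) p) ∈ PL L P :=
  AddSubgroup.subset_closure ⟨l, hl, p, rfl⟩

theorem PL.ind {C : Type} [AddCommGroup C] (F : (ι → Lf P) →+ C) (S : AddSubgroup C)
    (h : ∀ l ∈ L, ∀ p : Lf P, F (fun i => rm P (l i) p) ∈ S) (x : ι → Lf P) (hx : x ∈ PL L P) : F x ∈ S := by
  have : AddSubgroup.closure {x | ∃ l ∈ L, ∃ p : Lf P, x = fun i => rm P (l i) p} ≤ S.comap F := by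
    rw [AddSubgroup.closure_le]
    rintro _ ⟨l, hl, p, rfl⟩
    exact h l hl p
  exact this hx

variable (L)

abbrev Qf (P : ModuleCat.{0} (B ⊗[k] Bᵐᵒᵖ)) : ModuleCat.{0} B := ModuleCat.of B ((ι → Lf P) ⧸ PL L P)

def cw (f : P →ₗ[B ⊗[k] Bᵐᵒᵖ] P') : (ι → Lf P) →ₗ[B] (ι → Lf P') where
  toFun x i := f (x i)
  map_add' x y := funext fun i => f.map_add _ _
  map_smul' b x := funext fun i => f.map_smul _ _

theorem cw_PL (f : P →ₗ[B ⊗[k] Bᵐᵒᵖ] P') (x : ι → Lf P) (hx : x ∈ PL L P) : cw f x ∈ PL L P' := by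
  refine PL.ind (cw f).toAddMonoidHom (PL L P').toAddSubgroup ?_ x hx
  intro l hl p
  have : cw f (fun i => rm P (l i) p) = fun i => rm P' (l i) (show Lf P' from f p) :=
    funext fun i => rm_map f _ _
  show cw f (fun i => rm P (l i) p) ∈ PL L P'
  rw [this]
  exact PL.mem hl _

def Qm (f : P →ₗ[B ⊗[k] Bᵐᵒᵖ] P') : Qf L P →ₗ[B] Qf L P' :=
  (PL L P).mapQ (PL L P') (cw f) (fun x hx => cw_PL L f x hx)

theorem Qm_mk (f : P →ₗ[B ⊗[k] Bᵐᵒᵖ] P') (x : ι → Lf P) :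
    Qm L f ((PL L P).mkQ x) = (PL L P').mkQ (cw f x) := rfl

theorem Qm_surj (f : P →ₗ[B ⊗[k] Bᵐᵒᵖ] P') (hf : Function.Surjective f) : Function.Surjective (Qm L f) := by
  intro y
  obtain ⟨y, rfl⟩ := (PL L P').mkQ_surjective y
  choose x hx using fun i => hf (y i)
  exact ⟨(PL L P).mkQ x, (Qm_mk L f x).trans (congrArg (PL L P').mkQ (funext hx))⟩

theorem PL_surj (f : P →ₗ[B ⊗[k] Bᵐᵒᵖ] P') (hf : Function.Surjective f) (y : ι → Lf P') (hy : y ∈ PL L P') :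
    ∃ x ∈ PL L P, cw f x = y := by
  have := PL.ind (AddMonoidHom.id _) ((PL L P).toAddSubgroup.map (cw f : (ι → Lf P) →ₗ[B] (ι → Lf P')).toAddMonoidHom) ?_ y hy
  · obtain ⟨x, hx, h⟩ := this
    exact ⟨x, hx, h⟩
  · intro l hl p
    obtain ⟨q, rfl⟩ := hf p
    exact ⟨fun i => rm P (l i) q, PL.mem hl _, funext fun i => rm_map f _ _⟩

variable {K N : ModuleCat.{0} (B ⊗[k] Bᵐᵒᵖ)}

theorem Qm_exact (i : K →ₗ[B ⊗[k] Bᵐᵒᵖ] P) (p : P →ₗ[B ⊗[k] Bᵐᵒᵖ] N) (hp : Function.Surjective p)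
    (h : ∀ x, p x = 0 ↔ ∃ y, i y = x) (x : Qf L P) : Qm L p x = 0 ↔ ∃ y, Qm L i y = x := by
  constructor
  · intro hx
    obtain ⟨x, rfl⟩ := (PL L P).mkQ_surjective x
    rw [Qm_mk, Submodule.mkQ_apply, Submodule.Quotient.mk_eq_zero] at hx
    obtain ⟨z, hz, hz'⟩ := PL_surj L p hp _ hx
    have : ∀ j, ∃ y, i y = x j - z j := fun j => (h _).1 (by
      exact (p.map_sub (x j) (z j)).trans (sub_eq_zero.2 (congrFun hz' j).symm))
    choose y hy using this
    refine ⟨(PL L K).mkQ y, (Qm_mk L i y).trans ?_⟩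
    have h2 : cw i y = x - z := funext hy
    rw [h2, map_sub, sub_eq_self, Submodule.mkQ_apply, Submodule.Quotient.mk_eq_zero]
    exact hz
  · rintro ⟨y, rfl⟩
    obtain ⟨y, rfl⟩ := (PL L K).mkQ_surjective y
    rw [Qm_mk, Qm_mk]
    have : cw p (cw i y) = 0 := funext fun j => (h _).2 ⟨y j, rfl⟩
    rw [this, map_zero]

theorem Qm_inj (i : K →ₗ[B ⊗[k] Bᵐᵒᵖ] P)
    (r : rs (arr k B).toRingHom P →ₗ[Bᵐᵒᵖ] rs (arr k B).toRingHom K) (hr : ∀ x : K, r (i x) = x) :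
    Function.Injective (Qm L i) := by
  rw [injective_iff_map_eq_zero]
  intro x hx
  obtain ⟨x, rfl⟩ := (PL L K).mkQ_surjective x
  rw [Qm_mk, Submodule.mkQ_apply, Submodule.Quotient.mk_eq_zero] at hx
  rw [Submodule.mkQ_apply, Submodule.Quotient.mk_eq_zero]
  let F : (ι → Lf P) →+ (ι → Lf K) := ⟨⟨fun y j => r (y j), funext fun j => r.map_zero⟩,
    fun y z => funext fun j => r.map_add _ _⟩
  have := PL.ind F (PL L K).toAddSubgroup ?_ _ hx
  · have h2 : F (cw i x) = x := funext fun j => hr (x j)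
    rw [h2] at this
    exact this
  · intro l hl p
    have : F (fun j => rm P (l j) p) = fun j => rm K (l j) (r p) := funext fun j => r.map_smul (op (l j)) p
    rw [this]
    exact PL.mem hl _

end QF

end
end TE

namespace TE

noncomputable section

open Module TensorProduct MulOpposite

section W

variable {k B : Type} [Field k] [Ring B] [Algebra k B]
variable {M N N' : Type} [AddCommGroup M] [Module B M] [Module k M] [IsScalarTower k B M]
  [AddCommGroup N] [Module B N] [Module k N] [IsScalarTower k B N]
  [AddCommGroup N'] [Module B N'] [Module k N'] [IsScalarTower k B N']

abbrev opMod : Module Bᵐᵒᵖ (M →ₗ[k] N) where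
  smul b f := f ∘ₗ (Algebra.lsmul k k M b.unop)
  one_smul f := LinearMap.ext fun x => by show f ((1 : B) • x) = f x; rw [one_smul]
  mul_smul a b f := LinearMap.ext fun x => by
    show f ((a * b).unop • x) = f (b.unop • a.unop • x); rw [unop_mul, mul_smul]
  smul_zero a := rfl
  smul_add a f g := rfl
  add_smul a b f := LinearMap.ext fun x => by
    show f ((a + b).unop • x) = f (a.unop • x) + f (b.unop • x); rw [unop_add, add_smul, map_add]
  zero_smul f := LinearMap.ext fun x => by show f ((0 : Bᵐᵒᵖ).unop • x) = 0; rw [unop_zero, zero_smul, map_zero]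

abbrev envMod : Module (B ⊗[k] Bᵐᵒᵖ) (M →ₗ[k] N) :=
  letI : Module Bᵐᵒᵖ (M →ₗ[k] N) := opMod
  haveI : SMulCommClass B Bᵐᵒᵖ (M →ₗ[k] N) := ⟨fun a b f => rfl⟩
  haveI : IsScalarTower k Bᵐᵒᵖ (M →ₗ[k] N) := ⟨fun c b f => LinearMap.ext fun x => by
    show f ((c • b).unop • x) = c • f (b.unop • x)
    rw [unop_smul, smul_assoc, map_smul]⟩
  haveI : IsScalarTower k B (M →ₗ[k] N) := ⟨fun c b f => LinearMap.ext fun x => by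
    show (c • b) • f x = c • b • f x
    rw [smul_assoc]⟩
  TensorProduct.Algebra.module

theorem envMod_smul (a b : B) (f : M →ₗ[k] N) (x : M) :
    letI : Module (B ⊗[k] Bᵐᵒᵖ) (M →ₗ[k] N) := envMod
    ((a ⊗ₜ[k] op b) • f) x = a • f (b • x) := by
  let : Module Bᵐᵒᵖ (M →ₗ[k] N) := opMod
  rfl

def mkEnv {X Y : Type} [AddCommGroup X] [Module (B ⊗[k] Bᵐᵒᵖ) X] [AddCommGroup Y] [Module (B ⊗[k] Bᵐᵒᵖ) Y]
    (f : X →+ Y) (h : ∀ (a b : B) x, f ((a ⊗ₜ[k] op b) • x) = (a ⊗ₜ[k] op b) • f x) : X →ₗ[B ⊗[k] Bᵐᵒᵖ] Y where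
  toFun := f
  map_add' := f.map_add
  map_smul' r x := by
    show f (r • x) = r • f x
    induction r using TensorProduct.induction_on with
    | zero => exact (congrArg f (zero_smul (B ⊗[k] Bᵐᵒᵖ) x)).trans (f.map_zero.trans (zero_smul (B ⊗[k] Bᵐᵒᵖ) (f x)).symm)
    | add r s hr hs => rw [add_smul, map_add, hr, hs, add_smul]
    | tmul a b => exact h a b.unop x

variable {ι : Type} [Fintype ι] (L : Submodule B (ι → B)) {P : ModuleCat.{0} (B ⊗[k] Bᵐᵒᵖ)}

theorem adj1 (g : Qf L P →ₗ[B] N) :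
    letI : Module (B ⊗[k] Bᵐᵒᵖ) (((ι → B) ⧸ L) →ₗ[k] N) := envMod
    ∃ G : P →ₗ[B ⊗[k] Bᵐᵒᵖ] (((ι → B) ⧸ L) →ₗ[k] N), ∀ (p : Lf P) v,
      (G p : ((ι → B) ⧸ L) →ₗ[k] N) (L.mkQ v) = g ((PL L P).mkQ fun i => rm P (v i) p) := by
  let : Module (B ⊗[k] Bᵐᵒᵖ) (((ι → B) ⧸ L) →ₗ[k] N) := envMod
  let q : (ι → B) →ₗ[k] ((ι → B) ⧸ L) := L.mkQ.restrictScalars k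
  have hq : Function.Surjective q := L.mkQ_surjective
  let G0 : Lf P → (ι → B) →ₗ[k] N := fun p =>
    { toFun := fun v => g ((PL L P).mkQ fun i => rm P (v i) p)
      map_add' := fun v w => by
        rw [← map_add, ← map_add]
        congr 2
        funext i; exact rm_add _ _ _
      map_smul' := fun c v => by
        have : (fun i => rm P ((c • v) i) p) = algebraMap k B c • fun i => rm P (v i) p :=
          funext fun i => rm_alg c (v i) p
        rw [this, map_smul, map_smul, algebraMap_smul]; rfl }
  have hG0 : ∀ p, ∃ G : ((ι → B) ⧸ L) →ₗ[k] N, ∀ v, G (q v) = G0 p v := fun p => by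
    refine ex_desc q hq (G0 p) ?_
    intro v hv
    show g ((PL L P).mkQ fun i => rm P (v i) p) = 0
    have hv' : v ∈ L := (Submodule.Quotient.mk_eq_zero L).1 hv
    rw [Submodule.mkQ_apply, (Submodule.Quotient.mk_eq_zero (PL L P)).2 (PL.mem hv' p), map_zero]
  choose G1 hG1 using hG0
  have hG : ∀ p v, G1 p (q v) = g ((PL L P).mkQ fun i => rm P (v i) p) := hG1
  have add : ∀ x y : Lf P, G1 (x + y) = G1 x + G1 y := by
    intro x y
    refine LinearMap.ext fun m => ?_
    obtain ⟨v, rfl⟩ := hq m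
    rw [LinearMap.add_apply, hG, hG, hG, ← map_add, ← map_add]
    congr 2
    funext i; exact map_add (rm P (v i)) x y
  have sm : ∀ (a b : B) (x : Lf P) m, G1 (a • rm P b x) m = a • G1 x (b • m) := by
    intro a b x m
    obtain ⟨v, rfl⟩ := hq m
    have : b • q v = q (b • v) := rfl
    have h2 : (fun i => rm P (v i) (a • rm P b x)) = a • (fun i => rm P ((b • v) i) x) := funext fun i => by
      show rm P (v i) _ = a • rm P (b * v i) x
      rw [map_smul, rm_mul]
    rw [this, hG, hG, h2, map_smul, map_smul]
  refine ⟨mkEnv (AddMonoidHom.mk' (fun p : P => G1 p) add) ?_, hG⟩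
  intro a b x
  refine LinearMap.ext fun m => ?_
  refine Eq.trans ?_ (envMod_smul a b (G1 x) m).symm
  exact (LinearMap.congr_fun (congrArg G1 (rm_lm a b (show Lf P from x))) m).trans (sm a b x m)

open Classical in
theorem adj2 :
    letI : Module (B ⊗[k] Bᵐᵒᵖ) (((ι → B) ⧸ L) →ₗ[k] N) := envMod
    ∀ H : P →ₗ[B ⊗[k] Bᵐᵒᵖ] (((ι → B) ⧸ L) →ₗ[k] N), ∃ h : Qf L P →ₗ[B] N, ∀ x : ι → Lf P,
      h ((PL L P).mkQ x) = ∑ i, (H (x i) : ((ι → B) ⧸ L) →ₗ[k] N) (L.mkQ (Pi.single i 1)) := by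
  let : Module (B ⊗[k] Bᵐᵒᵖ) (((ι → B) ⧸ L) →ₗ[k] N) := envMod
  intro H
  have hH2 : ∀ (a b : B) (p : Lf P) m, (H (a • rm P b p : Lf P) : ((ι → B) ⧸ L) →ₗ[k] N) m =
      a • (H p : ((ι → B) ⧸ L) →ₗ[k] N) (b • m) := by
    intro a b p m
    refine (LinearMap.congr_fun (congrArg H (rm_lm a b p).symm) m).trans ?_
    refine (LinearMap.congr_fun (H.map_smul (a ⊗ₜ[k] op b) p) m).trans ?_
    exact envMod_smul a b _ m
  have hH3 : ∀ (x y : Lf P), H (x + y : Lf P) = H x + H y := fun x y => H.map_add x y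
  let e : ι → ((ι → B) ⧸ L) := fun i => L.mkQ (Pi.single i 1)
  have he : ∀ v, ∑ i, v i • e i = L.mkQ v := fun v => by
    show ∑ i, v i • L.mkQ (Pi.single i 1) = L.mkQ v
    simp only [← map_smul, ← map_sum]
    congr 1
    funext j
    simp [Finset.sum_apply, Pi.single_apply]
  let h0 : (ι → Lf P) →ₗ[B] N :=
    { toFun := fun x => ∑ i, (H (x i) : ((ι → B) ⧸ L) →ₗ[k] N) (e i)
      map_add' := fun x y => by
        rw [← Finset.sum_add_distrib]
        refine Finset.sum_congr rfl fun i _ => ?_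
        exact LinearMap.congr_fun (hH3 (x i) (y i)) (e i)
      map_smul' := fun b x => by
        rw [RingHom.id_apply, Finset.smul_sum]
        refine Finset.sum_congr rfl fun i _ => ?_
        have := hH2 b 1 (x i) (e i)
        rw [rm_one, one_smul] at this
        exact this }
  have h0k : PL L P ≤ LinearMap.ker h0 := by
    intro x hx
    refine PL.ind h0.toAddMonoidHom ⊥ ?_ x hx
    intro l hl p
    show ∑ i, (H (rm P (l i) p) : ((ι → B) ⧸ L) →ₗ[k] N) (e i) = 0
    have : ∀ i, (H (rm P (l i) p) : ((ι → B) ⧸ L) →ₗ[k] N) (e i) = (H p : ((ι → B) ⧸ L) →ₗ[k] N) (l i • e i) := by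
      intro i
      have := hH2 1 (l i) p (e i)
      rw [one_smul, one_smul] at this
      exact this
    rw [Finset.sum_congr rfl fun i _ => this i]
    refine (map_sum (H p : ((ι → B) ⧸ L) →ₗ[k] N) _ _).symm.trans ?_
    rw [he, show L.mkQ l = 0 from (Submodule.Quotient.mk_eq_zero L).2 hl]
    exact LinearMap.map_zero _
  exact ⟨(PL L P).liftQ h0 h0k, fun x => rfl⟩

theorem Qf_proj (P : ModuleCat.{0} (B ⊗[k] Bᵐᵒᵖ))
    [Module.Projective (B ⊗[k] Bᵐᵒᵖ) P] : Module.Projective B (Qf L P) := by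
  classical
  apply Module.Projective.of_lifting_property
  intro N N' _ _ _ _ f g hf
  let : Module k N := Module.compHom N (algebraMap k B)
  have : IsScalarTower k B N := IsScalarTower.of_compHom k B N
  let : Module k N' := Module.compHom N' (algebraMap k B)
  have : IsScalarTower k B N' := IsScalarTower.of_compHom k B N'
  let m1 : Module (B ⊗[k] Bᵐᵒᵖ) (((ι → B) ⧸ L) →ₗ[k] N) := envMod
  let m2 : Module (B ⊗[k] Bᵐᵒᵖ) (((ι → B) ⧸ L) →ₗ[k] N') := envMod
  obtain ⟨G, hG⟩ := adj1 L g
  let F : (((ι → B) ⧸ L) →ₗ[k] N) →ₗ[B ⊗[k] Bᵐᵒᵖ] (((ι → B) ⧸ L) →ₗ[k] N') := mkEnv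
    (AddMonoidHom.mk' (fun u => (f.restrictScalars k) ∘ₗ u) (fun u v => LinearMap.comp_add _ _ _)) (by
      intro a b u
      refine LinearMap.ext fun m => ?_
      refine Eq.trans ?_ (envMod_smul a b _ m).symm
      refine (congrArg f (envMod_smul a b u m)).trans ?_
      exact f.map_smul _ _)
  have hF : Function.Surjective F := by
    intro u
    obtain ⟨s, hs⟩ := LinearMap.exists_rightInverse_of_surjective (f.restrictScalars k)
      (LinearMap.range_eq_top.2 hf)
    refine ⟨s ∘ₗ u, LinearMap.ext fun m => ?_⟩
    exact LinearMap.congr_fun hs (u m)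
  obtain ⟨H, hH⟩ := proj_lift F hF G
  have hH1 : ∀ (p : Lf P) m, f ((H p : ((ι → B) ⧸ L) →ₗ[k] N) m) = (G p : ((ι → B) ⧸ L) →ₗ[k] N') m :=
    fun p m => LinearMap.congr_fun (hH p) m
  obtain ⟨h, hh⟩ := adj2 L H
  refine ⟨h, LinearMap.ext fun x => ?_⟩
  obtain ⟨x, rfl⟩ := (PL L P).mkQ_surjective x
  rw [LinearMap.comp_apply, hh, map_sum]
  have : ∀ i, f ((H (x i) : ((ι → B) ⧸ L) →ₗ[k] N) (L.mkQ (Pi.single i 1))) = g ((PL L P).mkQ (Pi.single i (x i))) := by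
    intro i
    rw [hH1, hG]
    congr 2
    funext j
    by_cases hij : j = i
    · subst hij; rw [Pi.single_eq_same, Pi.single_eq_same, rm_one]
    · rw [Pi.single_eq_of_ne hij, Pi.single_eq_of_ne hij, rm_zero]
  rw [Finset.sum_congr rfl fun i _ => this i, ← map_sum, ← map_sum, Finset.univ_sum_single]

end W

end
end TE

namespace TE

noncomputable section

open Module TensorProduct MulOpposite

section QC

variable {k B : Type} [Field k] [Ring B] [Algebra k B]
variable {ι : Type} [Fintype ι] (L : Submodule B (ι → B))

theorem Q_ses {K P N : ModuleCat.{0} (B ⊗[k] Bᵐᵒᵖ)} [Module.Projective (B ⊗[k] Bᵐᵒᵖ) P]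
    (i : K →ₗ[B ⊗[k] Bᵐᵒᵖ] P) (p : P →ₗ[B ⊗[k] Bᵐᵒᵖ] N) (hi : Function.Injective i) (hp : Function.Surjective p)
    (h : ∀ x, p x = 0 ↔ ∃ y, i y = x) (hN : Module.Projective Bᵐᵒᵖ (rs (arr k B).toRingHom N)) :
    Module.Projective Bᵐᵒᵖ (rs (arr k B).toRingHom K) ∧ Function.Injective (Qm L i) := by
  have := proj_arr P
  obtain ⟨h1, r, hr⟩ := proj_ker (rsm (arr k B).toRingHom i) (rsm (arr k B).toRingHom p) hi hp h
  exact ⟨h1, Qm_inj L i r hr⟩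

theorem rproj (c : Chain (B ⊗[k] Bᵐᵒᵖ)) (h0 : Module.Projective Bᵐᵒᵖ (rs (arr k B).toRingHom (c.X 0))) (j : ℕ) :
    Module.Projective Bᵐᵒᵖ (rs (arr k B).toRingHom (c.X j)) := by
  induction j with
  | zero => exact h0
  | succ j ih => exact (Q_ses (⊥ : Submodule B (Unit → B)) (c.i j) (c.p j) (c.inj j) (c.surj j) (c.ex j) ih).1

theorem lproj (c : Chain (B ⊗[k] Bᵐᵒᵖ)) (h0 : Module.Projective B (Lf (c.X 0))) (j : ℕ) :
    Module.Projective B (Lf (c.X j)) := by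
  induction j with
  | zero => exact h0
  | succ j ih =>
    have := proj_ell (c.P j)
    exact (proj_ker (rsm (ell k B).toRingHom (c.i j)) (rsm (ell k B).toRingHom (c.p j))
      (c.inj j) (c.surj j) (c.ex j)).1

variable [FiniteDimensional k B]

instance finLf (P : ModuleCat.{0} (B ⊗[k] Bᵐᵒᵖ)) [Module.Finite (B ⊗[k] Bᵐᵒᵖ) P] : Module.Finite B (Lf P) :=
  fin_rs (ell k B) P

def QChain (c : Chain (B ⊗[k] Bᵐᵒᵖ)) (h0 : Module.Projective Bᵐᵒᵖ (rs (arr k B).toRingHom (c.X 0))) : Chain B where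
  X j := Qf L (c.X j)
  P j := Qf L (c.P j)
  i j := Qm L (c.i j)
  p j := Qm L (c.p j)
  inj j := (Q_ses L (c.i j) (c.p j) (c.inj j) (c.surj j) (c.ex j) (rproj c h0 j)).2
  surj j := Qm_surj L _ (c.surj j)
  ex j := Qm_exact L _ _ (c.surj j) (c.ex j)
  proj j := Qf_proj L _
  fin j := by infer_instance

theorem Q_tw {X : ModuleCat.{0} (B ⊗[k] Bᵐᵒᵖ)} (φ : B ≃ₐ[k] B) (u : B ≃ₗ[B] Lf X)
    (hu : ∀ b x, rm X b (u x) = u (x * φ b)) :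
    ∃ T : Qf L X ≃+ ((ι → B) ⧸ L), ∀ b x, T (b • x) = φ.symm b • T x := by
  let T0 : (ι → Lf X) →ₛₗ[φ.symm.toAlgHom.toRingHom] ((ι → B) ⧸ L) :=
    { toFun := fun x => L.mkQ fun i => φ.symm (u.symm (x i))
      map_add' := fun x y => by
        rw [← map_add]; congr 1; funext i
        show φ.symm (u.symm (x i + y i)) = φ.symm (u.symm (x i)) + φ.symm (u.symm (y i))
        rw [map_add, map_add]
      map_smul' := fun b x => by
        rw [← map_smul]; congr 1; funext i
        show φ.symm (u.symm (b • x i)) = φ.symm b * φ.symm (u.symm (x i))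
        rw [map_smul, smul_eq_mul, map_mul] }
  have hk : PL L X ≤ LinearMap.ker T0 := by
    intro x hx
    refine PL.ind T0.toAddMonoidHom ⊥ ?_ x hx
    intro l hl p
    show T0 _ = 0
    refine (Submodule.Quotient.mk_eq_zero L).2 ?_
    have : (fun i => φ.symm (u.symm (rm X (l i) p))) = φ.symm (u.symm p) • l := by
      funext i
      have h1 := hu (l i) (u.symm p)
      rw [LinearEquiv.apply_symm_apply] at h1
      show φ.symm (u.symm (rm X (l i) p)) = φ.symm (u.symm p) * l i
      rw [h1, LinearEquiv.symm_apply_apply, map_mul, AlgEquiv.symm_apply_apply]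
    rw [this]
    exact L.smul_mem _ hl
  let T := (PL L X).liftQ T0 hk
  have hb : Function.Bijective T := by
    constructor
    · rw [injective_iff_map_eq_zero]
      intro x hx
      obtain ⟨x, rfl⟩ := (PL L X).mkQ_surjective x
      have hx' : (fun i => φ.symm (u.symm (x i))) ∈ L := (Submodule.Quotient.mk_eq_zero L).1 hx
      refine (Submodule.Quotient.mk_eq_zero _).2 ?_
      convert PL.mem hx' (u 1) using 2 with i
      rw [hu, one_mul, AlgEquiv.apply_symm_apply, LinearEquiv.apply_symm_apply]
    · intro y
      obtain ⟨y, rfl⟩ := L.mkQ_surjective y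
      refine ⟨(PL L X).mkQ fun i => u (φ (y i)), ?_⟩
      show L.mkQ _ = _
      congr 1
      funext i
      rw [LinearEquiv.symm_apply_apply, AlgEquiv.symm_apply_apply]
  exact ⟨AddEquiv.ofBijective T hb, fun b x => T.map_smulₛₗ b x⟩

theorem kDim_tw {X : ModuleCat.{0} (B ⊗[k] Bᵐᵒᵖ)} (φ : B ≃ₐ[k] B) (u : B ≃ₗ[B] Lf X)
    (hu : ∀ b x, rm X b (u x) = u (x * φ b)) : kDim k B (Qf L X) = kDim k B ((ι → B) ⧸ L) := by
  obtain ⟨T, hT⟩ := Q_tw L φ u hu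
  unfold kDim
  let : Module k (Qf L X) := Module.compHom _ (algebraMap k B)
  let : Module k ((ι → B) ⧸ L) := Module.compHom _ (algebraMap k B)
  refine LinearEquiv.finrank_eq { T with map_smul' := fun c x => ?_ }
  show T (algebraMap k B c • x) = algebraMap k B c • T x
  rw [hT, AlgEquiv.commutes]

def uReg : B ≃ₗ[B] Lf (regularBimodule k B) where
  toFun x := show B from x
  invFun x := show B from x
  left_inv _ := rfl
  right_inv _ := rfl
  map_add' _ _ := rfl
  map_smul' a x := by
    show a * x = a • op (1 : B) • x
    rw [op_one, one_smul]; rfl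

def uTw (φ : B ≃ₐ[k] B) : B ≃ₗ[B] Lf (twistedBimodule k B φ) where
  toFun x := show B from x
  invFun x := show B from x
  left_inv _ := rfl
  right_inv _ := rfl
  map_add' _ _ := rfl
  map_smul' a x := by
    show a * x = a • op (φ 1) • x
    rw [map_one, op_one, one_smul]; rfl

theorem hReg (b x : B) : rm (regularBimodule k B) b (uReg x) = uReg (x * b) := by
  show (1 : B) • op b • x = x * b
  rw [one_smul]; rfl

theorem hTw (φ : B ≃ₐ[k] B) (b x : B) : rm (twistedBimodule k B φ) b (uTw φ x) = uTw φ (x * φ b) := by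
  show (1 : B) • op (φ b) • x = x * φ b
  rw [one_smul]; rfl

theorem Q_reg : Nonempty (Qf L (regularBimodule k B) ≃ₗ[B] ((ι → B) ⧸ L)) := by
  obtain ⟨T, hT⟩ := Q_tw L AlgEquiv.refl (uReg (k := k)) hReg
  exact ⟨{ T with map_smul' := hT }⟩

theorem reg_rproj : Module.Projective Bᵐᵒᵖ (rs (arr k B).toRingHom (regularBimodule k B)) := by
  let w : Bᵐᵒᵖ ≃ₗ[Bᵐᵒᵖ] rs (arr k B).toRingHom (regularBimodule k B) :=
    { toFun := fun x => show B from x.unop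
      invFun := fun x => op (show B from x)
      left_inv := fun _ => rfl
      right_inv := fun _ => rfl
      map_add' := fun _ _ => rfl
      map_smul' := fun a x => by
        show x.unop * a.unop = (1 : B) • a • x.unop
        rw [one_smul]; rfl }
  exact Module.Projective.of_equiv w

theorem reg_lproj : Module.Projective B (Lf (regularBimodule k B)) :=
  Module.Projective.of_equiv (uReg (k := k))

instance reg_fin : Module.Finite (B ⊗[k] Bᵐᵒᵖ) (regularBimodule k B) := by
  refine Module.Finite.of_surjective (LinearMap.toSpanSingleton (B ⊗[k] Bᵐᵒᵖ) (regularBimodule k B) (show B from 1)) ?_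
  rintro (x : B)
  refine ⟨x ⊗ₜ op 1, ?_⟩
  show x • op (1 : B) • (1 : B) = x
  rw [op_one, one_smul]; simp

variable (k B) in
def HJ : Prop := ∀ r ∈ Ring.jacobson (B ⊗[k] Bᵐᵒᵖ), r ∈ AddSubgroup.closure {y : B ⊗[k] Bᵐᵒᵖ |
  ∃ b c : B, (b ∈ Ring.jacobson B ∨ c ∈ Ring.jacobson B) ∧ y = b ⊗ₜ op c}

open Classical in
theorem Q_jac (hJ : HJ k B) (hL : ∀ b ∈ Ring.jacobson B, ∀ v : ι → B, b • v ∈ L) {P : ModuleCat.{0} (B ⊗[k] Bᵐᵒᵖ)} (t : ι) (x : P)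
    (hx : x ∈ Ring.jacobson (B ⊗[k] Bᵐᵒᵖ) • (⊤ : Submodule (B ⊗[k] Bᵐᵒᵖ) P)) :
    (PL L P).mkQ (Pi.single t (show Lf P from x)) ∈ Ring.jacobson B • (⊤ : Submodule B (Qf L P)) := by
  let F : Lf P →ₗ[B] Qf L P := (PL L P).mkQ ∘ₗ LinearMap.single B (fun _ => Lf P) t
  show F x ∈ _
  refine Submodule.smul_induction_on hx ?_ ?_
  · intro r hr p _
    have h1 := hJ r hr
    let G : (B ⊗[k] Bᵐᵒᵖ) →+ Qf L P := AddMonoidHom.mk' (fun r => F (show (P : Type) from r • p)) fun r s =>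
      (congrArg F (add_smul r s p)).trans (F.map_add _ _)
    have h2 : AddSubgroup.closure {y : B ⊗[k] Bᵐᵒᵖ | ∃ b c : B, (b ∈ Ring.jacobson B ∨ c ∈ Ring.jacobson B) ∧
        y = b ⊗ₜ op c} ≤ (Ring.jacobson B • (⊤ : Submodule B (Qf L P))).toAddSubgroup.comap G := by
      rw [AddSubgroup.closure_le]
      rintro _ ⟨b, c, h, rfl⟩
      show F (show (P : Type) from (b ⊗ₜ[k] op c) • p) ∈ Ring.jacobson B • (⊤ : Submodule B (Qf L P))
      rw [show F (show (P : Type) from (b ⊗ₜ[k] op c) • p) = b • F (rm P c p) from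
        (congrArg F (rm_lm b c (show Lf P from p))).trans (F.map_smul _ _)]
      rcases h with h | h
      · exact Submodule.smul_mem_smul h trivial
      · have h3 : F (rm P c p) = 0 := by
          refine (Submodule.Quotient.mk_eq_zero _).2 ?_
          convert PL.mem (hL c h (Pi.single t 1)) (show Lf P from p) using 1
          funext i
          show (Pi.single t (rm P c p) : ι → Lf P) i = rm P (c * (Pi.single t (1 : B) : ι → B) i) p
          by_cases hij : i = t
          · subst hij; rw [Pi.single_eq_same, Pi.single_eq_same, mul_one]
          · rw [Pi.single_eq_of_ne hij, Pi.single_eq_of_ne hij, mul_zero]; exact (rm_zero _).symm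
        rw [h3, smul_zero]; exact Submodule.zero_mem _
    exact h2 h1
  · intro x y hx hy
    exact (congrArg (· ∈ Ring.jacobson B • (⊤ : Submodule B (Qf L P))) (F.map_add x y)).mpr (Submodule.add_mem _ hx hy)

theorem QChain_min (hJ : HJ k B) (hL : ∀ b ∈ Ring.jacobson B, ∀ v : ι → B, b • v ∈ L) (c : Chain (B ⊗[k] Bᵐᵒᵖ)) (h0)
    (hc : c.Min) : (QChain L c h0).Min := by
  classical
  intro j x
  obtain ⟨x, rfl⟩ := (PL L _).mkQ_surjective x
  show (PL L (c.P j)).mkQ (cw (c.i j) x) ∈ _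
  rw [← Finset.univ_sum_single (cw (c.i j) x), map_sum]
  exact Submodule.sum_mem _ fun t _ => Q_jac L hJ hL t _ (hc j (x t))

end QC

end
end TE

namespace TE

noncomputable section

open Module TensorProduct MulOpposite

section Len

variable {R : Type} [Ring R] [IsArtinianRing R] {V W : Type} [AddCommGroup V] [Module R V]
  [AddCommGroup W] [Module R W] [Module.Finite R V] [Module.Finite R W]

variable (R V) in
def len : ℕ := (Module.length R V).toNat

theorem len_coe : (len R V : ℕ∞) = Module.length R V :=
  ENat.coe_toNat Module.length_ne_top

theorem len_equiv (e : V ≃ₗ[R] W) : len R V = len R W := by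
  unfold len; rw [e.length_eq]

theorem len_surj (f : V →ₗ[R] W) (hf : Function.Surjective f) : len R W ≤ len R V := by
  have := Module.length_le_of_surjective f hf
  rw [← len_coe, ← len_coe] at this
  exact_mod_cast this

theorem len_sub (U : Submodule R V) : len R V = len R U + len R (V ⧸ U) := by
  have := Module.length_eq_add_of_exact U.subtype U.mkQ U.injective_subtype U.mkQ_surjective
    (LinearMap.exact_subtype_mkQ U)
  rw [← len_coe, ← len_coe, ← len_coe] at this
  exact_mod_cast this

theorem len_top : len R (⊤ : Submodule R V) = len R V := len_equiv Submodule.topEquiv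

theorem len_zero (h : len R V = 0) : Subsingleton V := by
  rw [← Module.length_eq_zero_iff (R := R), ← len_coe, h]; rfl

theorem len_bot : len R (⊥ : Submodule R V) = 0 := by
  unfold len; rw [Module.length_eq_zero]; rfl

theorem len_le {U U' : Submodule R V} (h : U ≤ U') :
    len R U' = len R U + len R (U'.map U.mkQ) := by
  have := Module.length_eq_add_of_exact (Submodule.inclusion h) (U.mkQ.submoduleMap U')
    (Submodule.inclusion_injective h) (LinearMap.submoduleMap_surjective _ _) (by
      intro x
      constructor
      · intro hx
        have hx' : U.mkQ x = 0 := congrArg Subtype.val hx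
        exact ⟨⟨x, (Submodule.Quotient.mk_eq_zero U).1 hx'⟩, rfl⟩
      · rintro ⟨y, rfl⟩
        exact Subtype.ext ((Submodule.Quotient.mk_eq_zero U).2 y.2))
  rw [← len_coe, ← len_coe, ← len_coe] at this
  exact_mod_cast this

theorem len_mono {U U' : Submodule R V} (h : U ≤ U') : len R U ≤ len R U' := by
  rw [len_le h]; omega

theorem len_eq {U U' : Submodule R V} (h : U ≤ U') (h' : len R U = len R U') : U = U' := by
  have h1 := len_le h
  have h2 := len_zero (R := R) (V := U'.map U.mkQ) (by omega)
  refine le_antisymm h fun x hx => ?_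
  have h3 : (⟨U.mkQ x, ⟨x, hx, rfl⟩⟩ : U'.map U.mkQ) = 0 := Subsingleton.elim _ _
  exact (Submodule.Quotient.mk_eq_zero U).1 (congrArg Subtype.val h3)

theorem len_surj_inj (f : V →ₗ[R] W) (hf : Function.Surjective f) (h : len R V ≤ len R W) :
    Function.Injective f := by
  have h1 := len_sub (LinearMap.ker f)
  rw [len_equiv (f.quotKerEquivOfSurjective hf)] at h1
  have h2 := len_zero (R := R) (V := LinearMap.ker f) (by omega)
  rw [← LinearMap.ker_eq_bot]
  exact (Submodule.subsingleton_iff_eq_bot).1 h2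

theorem cov {U U' : Submodule R V} (h : U ⋖ U') : ∃ x ∈ U', U' ≤ U ⊔ R ∙ x ∧
    len R U' = len R U + 1 ∧ len R (R ⧸ Submodule.comap (LinearMap.toSpanSingleton R V x) U) = 1 ∧
    ∀ b ∈ Ring.jacobson R, b • x ∈ U := by
  obtain ⟨x, hx, hxU⟩ := SetLike.exists_of_lt h.lt
  have hU : U ⊔ R ∙ x = U' := by
    rcases h.eq_or_eq (le_sup_left : U ≤ U ⊔ R ∙ x) (sup_le h.le (by simpa using hx)) with h1 | h1
    · exact absurd (h1 ▸ (le_sup_right : R ∙ x ≤ U ⊔ R ∙ x) (Submodule.mem_span_singleton_self x)) hxU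
    · exact h1
  let g : R →ₗ[R] U'.map U.mkQ := LinearMap.toSpanSingleton R _ ⟨U.mkQ x, ⟨x, hx, rfl⟩⟩
  have hg : Function.Surjective g := by
    rintro ⟨_, y, hy, rfl⟩
    rw [SetLike.mem_coe, ← hU, Submodule.mem_sup] at hy
    obtain ⟨u, hu, z, hz, rfl⟩ := hy
    obtain ⟨r, rfl⟩ := Submodule.mem_span_singleton.1 hz
    refine ⟨r, Subtype.ext ?_⟩
    show r • U.mkQ x = U.mkQ (u + r • x)
    rw [map_add, map_smul, show U.mkQ u = 0 from (Submodule.Quotient.mk_eq_zero U).2 hu, zero_add]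
  have : IsSimpleModule R (U'.map U.mkQ) := by
    have := (covBy_iff_quot_is_simple h.le).1 h
    have hker : LinearMap.ker (U.mkQ.submoduleMap U') = U.comap U'.subtype := by
      ext y
      rw [LinearMap.mem_ker, Submodule.mem_comap, ← Submodule.Quotient.mk_eq_zero]
      exact Subtype.ext_iff
    exact IsSimpleModule.congr ((Submodule.quotEquivOfEq _ _ hker.symm).trans
      ((U.mkQ.submoduleMap U').quotKerEquivOfSurjective (LinearMap.submoduleMap_surjective _ _))).symm
  have hk : LinearMap.ker g = Submodule.comap (LinearMap.toSpanSingleton R V x) U := by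
    ext r
    rw [LinearMap.mem_ker, Submodule.mem_comap, ← Submodule.Quotient.mk_eq_zero]
    exact Subtype.ext_iff
  have h1 := Module.length_eq_one R (U'.map U.mkQ)
  rw [← len_coe] at h1
  have h2 : len R (U'.map U.mkQ) = 1 := by exact_mod_cast h1
  refine ⟨x, hx, hU.ge, ?_, ?_, ?_⟩
  · rw [len_le h.le, h2]
  · rw [← hk, len_equiv (g.quotKerEquivOfSurjective hg), h2]
  · intro b hb
    have h1 := IsSemisimpleModule.jacobson_le_annihilator R (U'.map U.mkQ) hb
    have h2 := Module.mem_annihilator.1 h1 ⟨U.mkQ x, ⟨x, hx, rfl⟩⟩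
    exact (Submodule.Quotient.mk_eq_zero U).1 (congrArg Subtype.val h2)

theorem climb (Q : Submodule R V → Submodule R V → Prop) (h0 : ∀ U, Q U U)
    (h1 : ∀ U M U', U ⋖ M → M ≤ U' → Q M U' → Q U U') (U U' : Submodule R V) (h : U ≤ U') : Q U U' := by
  induction hn : len R U' - len R U using Nat.strong_induction_on generalizing U with
  | _ n ih =>
    rcases h.eq_or_lt with rfl | hlt
    · exact h0 _
    · obtain ⟨M, hM, hM'⟩ := exists_covBy_le_of_lt hlt
      obtain ⟨_, _, _, h2, _⟩ := cov hM
      have h3 := len_mono hM'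
      exact h1 U M U' hM hM' (ih _ (by omega) M hM' rfl)

theorem len_compare (lam : Submodule R V → ℕ) (J : Submodule R V)
    (hJ : ∀ b ∈ Ring.jacobson R, ∀ v : V, b • v ∈ J)
    (hbot : lam ⊥ = 0) (htop : lam ⊤ = lam J + len R (V ⧸ J)) (hbig : len R V ≤ lam ⊤)
    (strict : ∀ U U', J ≤ U → U < U' → lam U < lam U')
    (step : ∀ U U' : Submodule R V, U ⋖ U' → ∀ x ∈ U', U' ≤ U ⊔ R ∙ x →
      len R (R ⧸ Submodule.comap (LinearMap.toSpanSingleton R V x) U) = 1 → (∀ b ∈ Ring.jacobson R, b • x ∈ U) →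
      (∀ M : Submodule R V, J ≤ M → len R V ≤ len R M + 1 → lam ⊤ ≤ lam M + 1) → lam U' ≤ lam U + 1)
    (U : Submodule R V) : lam U = len R U ∧ lam ⊤ = len R V := by
  have A : ∀ U U' : Submodule R V, U ≤ U' → (J ≤ U → lam U + len R U' ≤ lam U' + len R U) := by
    refine climb _ (fun U _ => le_rfl) ?_
    intro U M U' h1 h2 h3 h4
    have h5 := h3 (h4.trans h1.le)
    have h6 := strict U M h4 h1.lt
    obtain ⟨_, _, _, h7, _⟩ := cov h1
    omega
  have hmax : ∀ M : Submodule R V, J ≤ M → len R V ≤ len R M + 1 → lam ⊤ ≤ lam M + 1 := by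
    intro M h1 h2
    have h3 := A J M h1 le_rfl
    have h4 := len_sub J
    omega
  have C : ∀ U U' : Submodule R V, U ≤ U' → lam U' + len R U ≤ lam U + len R U' := by
    refine climb _ (fun U => le_rfl) ?_
    intro U M U' h1 h2 h3
    obtain ⟨x, hx, h4, h5, h6, h7⟩ := cov h1
    have h8 := step U M h1 x hx h4 h6 h7 hmax
    omega
  have c1 := C ⊥ U bot_le
  have c2 := C U ⊤ le_top
  rw [len_bot] at c1
  rw [len_top] at c2
  have c3 := C ⊥ ⊤ bot_le
  rw [len_bot, len_top] at c3
  omega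

end Len

section Splice

variable {R : Type} [Ring R]

theorem splice {M N X Q : ModuleCat.{0} R} [hQ : Module.Projective R Q] (i : X →ₗ[R] Q) (p : Q →ₗ[R] N)
    (hi : Function.Injective i) (hp : Function.Surjective p) (h : ∀ x, p x = 0 ↔ ∃ y, i y = x) (n : ℕ)
    (H : HasProjExactSeq R M X n) : HasProjExactSeq R M N (n + 1) := by
  obtain ⟨P, d, e0, em, h1, h2, h3, h4⟩ := H
  let P' : ℕ → ModuleCat.{0} R := fun | 0 => N | 1 => Q | j + 2 => P (j + 1)
  let d' : ∀ j, P' (j + 1) →ₗ[R] P' j := fun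
    | 0 => p
    | 1 => i ∘ₗ e0.toLinearMap ∘ₗ d 0
    | j + 2 => d (j + 1)
  have hie : Function.Injective (i ∘ₗ e0.toLinearMap) := hi.comp e0.injective
  refine ⟨P', d', LinearEquiv.refl R N, em, ?_, hp, ?_, ?_⟩
  · intro j hj hj'
    match j, hj, hj' with
    | 1, _, _ => exact hQ
    | j + 2, _, hj' => exact h1 (j + 1) (by omega) (by omega)
  · match n, h3 with
    | 0, h3 => exact hie.comp h3
    | n + 1, h3 => exact h3
  · intro j hj
    match j, hj with
    | 0, _ =>
      show LinearMap.range (i ∘ₗ e0.toLinearMap ∘ₗ d 0) = LinearMap.ker p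
      ext x
      rw [LinearMap.mem_ker, h, LinearMap.mem_range]
      constructor
      · rintro ⟨y, rfl⟩
        exact ⟨_, rfl⟩
      · rintro ⟨y, rfl⟩
        obtain ⟨z, hz⟩ := h2 (e0.symm y)
        exact ⟨z, by simp [hz]⟩
    | 1, hj =>
      show LinearMap.range (d 1) = LinearMap.ker ((i ∘ₗ e0.toLinearMap) ∘ₗ d 0)
      rw [h4 0 (by omega), LinearMap.ker_comp, LinearMap.ker_eq_bot.2 hie]; rfl
    | j + 2, hj => exact h4 (j + 1) (by omega)

theorem Chain.seq (n : ℕ) (c : Chain R) (M : ModuleCat.{0} R) (e : c.X n ≃ₗ[R] M) :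
    HasProjExactSeq R M (c.X 0) n := by
  induction n generalizing c with
  | zero =>
    exact ⟨fun _ => c.X 0, fun _ => LinearMap.id, LinearEquiv.refl R _, e.symm, fun i h h' => by omega,
      fun x => ⟨x, rfl⟩, fun _ _ h => h, fun i h => by omega⟩
  | succ n ih =>
    exact splice (c.i 0) (c.p 0) (c.inj 0) (c.surj 0) (c.ex 0) n (ih c.tail e)

end Splice

end
end TE

namespace TE

noncomputable section

open Module TensorProduct MulOpposite

section Back

variable {k B : Type} [Field k] [Ring B] [Algebra k B] [FiniteDimensional k B]

theorem tw_equiv {X Y : ModuleCat.{0} (B ⊗[k] Bᵐᵒᵖ)} (φ : B ≃ₐ[k] B) (u : B ≃ₗ[B] Lf X)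
    (hu : ∀ b x, rm X b (u x) = u (x * φ b)) (v : B ≃ₗ[B] Lf Y)
    (hv : ∀ b x, rm Y b (v x) = v (x * φ b)) : Nonempty (X ≃ₗ[B ⊗[k] Bᵐᵒᵖ] Y) := by
  let e : Lf X ≃ₗ[B] Lf Y := u.symm.trans v
  have he : ∀ b x, e (rm X b x) = rm Y b (e x) := by
    intro b x
    obtain ⟨x, rfl⟩ := u.surjective x
    show v (u.symm _) = rm Y b (v (u.symm _))
    rw [hu, LinearEquiv.symm_apply_apply, LinearEquiv.symm_apply_apply, hv]
  let f : X →ₗ[B ⊗[k] Bᵐᵒᵖ] Y := mkEnv (AddMonoidHom.mk' (fun x : X => (show (Y : Type) from e x)) (fun x y => e.map_add x y)) (by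
    intro a b x
    refine (congrArg e (rm_lm a b (show Lf X from x))).trans ((e.map_smul _ _).trans ?_)
    refine (congrArg (a • ·) (he b x)).trans ?_
    exact (rm_lm a b (e x)).symm)
  exact ⟨LinearEquiv.ofBijective f e.bijective⟩

theorem PL_mono {ι : Type} [Fintype ι] {L L' : Submodule B (ι → B)} (h : L ≤ L') (P : ModuleCat.{0} (B ⊗[k] Bᵐᵒᵖ)) :
    PL L P ≤ PL L' P := by
  intro x hx
  exact PL.ind (AddMonoidHom.id _) (PL L' P).toAddSubgroup (fun l hl p => PL.mem (h hl) p) x hx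

theorem PL_step (K : ModuleCat.{0} (B ⊗[k] Bᵐᵒᵖ)) [Module.Finite (B ⊗[k] Bᵐᵒᵖ) K]
    [IsArtinianRing B] (U U' : Submodule B (Unit → B)) (h : U ≤ U') (x : Unit → B) (hx : U' ≤ U ⊔ B ∙ x)
    (J' : Submodule B (Unit → B)) (hJ' : ∀ v ∈ J', v () • x ∈ U) :
    len B (PL U' K) ≤ len B (PL U K) + len B ((Unit → Lf K) ⧸ PL J' K) := by
  rw [len_le (PL_mono h K)]
  let Psi : (Unit → Lf K) →ₗ[B] (Unit → Lf K) :=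
    LinearMap.pi fun i => rm K (x i) ∘ₗ LinearMap.proj ()
  have h1 : PL J' K ≤ LinearMap.ker ((PL U K).mkQ ∘ₗ Psi) := by
    intro w hw
    refine PL.ind ((PL U K).mkQ ∘ₗ Psi).toAddMonoidHom ⊥ ?_ w hw
    intro l hl p
    show (PL U K).mkQ (Psi _) = 0
    refine (Submodule.Quotient.mk_eq_zero _).2 ?_
    convert PL.mem (hJ' l hl) p using 1
    funext i
    exact (rm_mul _ _ _).symm
  let Th := (PL J' K).liftQ _ h1
  have h2 : (PL U' K).map (PL U K).mkQ ≤ LinearMap.range Th := by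
    rintro _ ⟨w, hw, rfl⟩
    refine PL.ind (PL U K).mkQ.toAddMonoidHom (LinearMap.range Th).toAddSubgroup ?_ w hw
    intro l hl p
    obtain ⟨u, hu, z, hz, rfl⟩ := Submodule.mem_sup.1 (hx hl)
    obtain ⟨b, rfl⟩ := Submodule.mem_span_singleton.1 hz
    refine ⟨(PL J' K).mkQ fun _ => rm K b p, ?_⟩
    have h3 : (fun i => rm K ((u + b • x) i) p) = (fun i => rm K (u i) p) + Psi (fun _ => rm K b p) := by
      funext i
      exact (rm_add _ _ _).trans (congrArg (rm K (u i) p + ·) (rm_mul _ _ _))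
    show (PL U K).mkQ (Psi _) = (PL U K).mkQ _
    rw [h3, map_add, show (PL U K).mkQ (fun i => rm K (u i) p) = 0 from
      (Submodule.Quotient.mk_eq_zero _).2 (PL.mem hu p), zero_add]
  have h4 := len_mono h2
  have h5 := len_surj Th.rangeRestrict Th.surjective_rangeRestrict
  omega

def JV (B : Type) [Ring B] : Submodule B (Unit → B) :=
  Submodule.comap (LinearMap.proj () : (Unit → B) →ₗ[B] B) (Ring.jacobson B)

theorem JV_quot : Nonempty (((Unit → B) ⧸ JV B) ≃ₗ[B] SQ B) := by
  let f : (Unit → B) →ₗ[B] SQ B := (Ring.jacobson B).mkQ ∘ₗ LinearMap.proj ()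
  have hf : Function.Surjective f := fun y => by
    obtain ⟨y, rfl⟩ := (Ring.jacobson B).mkQ_surjective y
    exact ⟨fun _ => y, rfl⟩
  have : LinearMap.ker f = JV B := by
    ext v
    exact Submodule.Quotient.mk_eq_zero (Ring.jacobson B)
  exact ⟨(Submodule.quotEquivOfEq _ _ this.symm).trans (f.quotKerEquivOfSurjective hf)⟩

theorem JV_mem (b : B) (hb : b ∈ Ring.jacobson B) (v : Unit → B) : b • v ∈ JV B :=
  (Ring.jacobson B).mul_mem_right _ hb

theorem back_iso (hq : QF B) (hJ : HJ k B)
    (hR : ∀ L : Submodule B (Unit → B), JV B ≤ L → Red B ((Unit → B) ⧸ L))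
    (n : ℕ) (c0 : Chain B) (hc0 : c0.Min)
    (e0 : c0.X 0 ≃ₗ[B] SQ B) (en : c0.X n ≃ₗ[B] SQ B) (c : Chain (B ⊗[k] Bᵐᵒᵖ))
    (hcX : c.X 0 = regularBimodule k B) (hc : c.Min) :
    ∃ _ : Lf (c.X n) ≃ₗ[B] B, ∀ L : Submodule B (Unit → B), PL L (c.X n) = ⊥ → L = ⊥ := by
  have : IsArtinianRing B := IsArtinianRing.of_finite k B
  have hr0 : Module.Projective Bᵐᵒᵖ (rs (arr k B).toRingHom (c.X 0)) := by rw [hcX]; exact reg_rproj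
  have hl0 : Module.Projective B (Lf (c.X 0)) := by rw [hcX]; exact reg_lproj
  have hl := lproj c hl0 n
  have hX0 : ∀ L : Submodule B (Unit → B), Nonempty (Qf L (c.X 0) ≃ₗ[B] ((Unit → B) ⧸ L)) := by
    intro L; rw [hcX]; exact Q_reg L
  obtain ⟨eJ⟩ := JV_quot (B := B)
  obtain ⟨w⟩ := hX0 (JV B)
  obtain ⟨u⟩ := Chain.uniq hq (QChain_min (JV B) hJ JV_mem c hr0 hc) hc0 ((w.trans eJ).trans e0.symm) n
  let z : Qf (JV B) (c.X n) ≃ₗ[B] SQ B := LinearEquiv.trans u en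
  let W := Unit → Lf (c.X n)
  let F : Lf (c.X n) →ₗ[B] SQ B := z.toLinearMap ∘ₗ (PL (JV B) (c.X n)).mkQ ∘ₗ LinearMap.pi fun _ => LinearMap.id
  have hF : Function.Surjective F := by
    intro y
    obtain ⟨m, hm⟩ := (PL (JV B) (c.X n)).mkQ_surjective (z.symm y)
    refine ⟨m (), ?_⟩
    show z ((PL (JV B) (c.X n)).mkQ m) = y
    rw [hm, LinearEquiv.apply_symm_apply]
  obtain ⟨f, hf⟩ := proj_lift (Ring.jacobson B).mkQ (Ring.jacobson B).mkQ_surjective F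
  have hfs : Function.Surjective f := by
    rw [← LinearMap.range_eq_top]
    apply nak
    intro x
    obtain ⟨y, hy⟩ := hF ((Ring.jacobson B).mkQ x)
    refine ⟨f y, ⟨y, rfl⟩, ?_⟩
    have h1 : x - f y ∈ Ring.jacobson B := by
      rw [← Submodule.Quotient.mk_eq_zero]
      exact (map_sub (Ring.jacobson B).mkQ _ _).trans (sub_eq_zero.2 (by rw [hf, hy]))
    have h2 := Submodule.smul_mem_smul h1 (Submodule.mem_top (x := (1 : B)) (R := B))
    have h3 : (x - f y) • (1 : B) = x - f y := mul_one _
    rw [h3] at h2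
    exact h2
  have hV : len B (Unit → B) = len B B := len_equiv (LinearEquiv.funUnique Unit B B)
  have hW : len B W = len B (Lf (c.X n)) := len_equiv (LinearEquiv.funUnique Unit B (Lf (c.X n)))
  have htop : PL (⊤ : Submodule B (Unit → B)) (c.X n) = ⊤ := by
    rw [eq_top_iff]
    intro m _
    convert PL.mem (L := (⊤ : Submodule B (Unit → B))) (P := c.X n) (l := fun _ => 1) trivial (m ()) using 1
    funext i
    exact (rm_one _).symm
  have hbot : PL (⊥ : Submodule B (Unit → B)) (c.X n) = ⊥ := by
    rw [eq_bot_iff]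
    intro m hm
    refine PL.ind (AddMonoidHom.id _) ⊥ ?_ m hm
    intro l hl p
    rw [(Submodule.mem_bot B).1 hl]
    exact funext fun i => rm_zero p
  have main := len_compare (R := B) (V := Unit → B) (fun L => len B (PL L (c.X n))) (JV B) JV_mem ?_ ?_ ?_ ?_ ?_
  · have m1 := (main ⊤).2
    rw [htop, len_top, hV] at m1
    refine ⟨LinearEquiv.ofBijective f ⟨len_surj_inj f hfs (by rw [← hW]; exact m1.le), hfs⟩, ?_⟩
    intro L hL
    have m2 := (main L).1
    rw [hL, len_bot] at m2
    exact (len_eq bot_le (by rw [len_bot, m2])).symm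
  · rw [hbot, len_bot]
  · rw [htop, len_top, len_sub (PL (JV B) (c.X n)), len_equiv (z.trans eJ.symm)]
  · rw [htop, len_top, hV]
    exact (len_surj f hfs).trans hW.ge
  · intro U U' h1 h2
    refine lt_of_le_of_ne (len_mono (PL_mono h2.le _)) fun h3 => ?_
    have h4 := len_eq (PL_mono h2.le _) h3
    obtain ⟨w1⟩ := hX0 U
    obtain ⟨w2⟩ := hX0 U'
    obtain ⟨w3⟩ := Chain.stable_down hq (QChain U c hr0) (QChain U' c hr0) n (Submodule.quotEquivOfEq _ _ h4)
      ((hR U h1).congr w1.symm) ((hR U' (h1.trans h2.le)).congr w2.symm)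
    have h5 := len_equiv ((w1.symm.trans w3).trans w2)
    have h6 := len_sub U
    have h7 := len_sub U'
    exact h2.ne (len_eq h2.le (by omega))
  · intro U U' h x hx h1 h2 h3 h4
    let J' : Submodule B (Unit → B) := (Submodule.comap (LinearMap.toSpanSingleton B (Unit → B) x) U).comap
      (LinearMap.proj () : (Unit → B) →ₗ[B] B)
    have h5 := PL_step (c.X n) U U' h.le x h1 J' (fun v hv => hv)
    have h6 : len B ((Unit → B) ⧸ J') ≤ 1 := by
      rw [← h2]
      refine len_surj (Submodule.mapQ _ _ (LinearMap.pi fun _ => LinearMap.id) (fun r hr => hr)) ?_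
      intro y
      obtain ⟨y, rfl⟩ := J'.mkQ_surjective y
      exact ⟨Submodule.Quotient.mk (y ()), rfl⟩
    have h7 := len_sub J'
    have h8 := h4 J' (fun v hv => h3 _ hv) (by omega)
    rw [htop, len_top] at h8
    have h9 := len_sub (PL J' (c.X n))
    show len B (PL U' (c.X n)) ≤ len B (PL U (c.X n)) + 1
    omega

theorem back (hq : QF B) (hJ : HJ k B)
    (hR : ∀ L : Submodule B (Unit → B), JV B ≤ L → Red B ((Unit → B) ⧸ L))
    (n : ℕ) (hn : 1 ≤ n) (c0 : Chain B) (hc0 : c0.Min)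
    (e0 : c0.X 0 ≃ₗ[B] SQ B) (en : c0.X n ≃ₗ[B] SQ B) : IsTwistedPeriodicAlgebra k B := by
  have : IsArtinianRing (B ⊗[k] Bᵐᵒᵖ) := IsArtinianRing.of_finite k _
  obtain ⟨c, hcX, hc⟩ := ex_chain (R := B ⊗[k] Bᵐᵒᵖ) (regularBimodule k B)
  obtain ⟨e, he⟩ := back_iso hq hJ hR n c0 hc0 e0 en c hcX hc
  let K := c.X n
  let s : B → B := fun b => e (rm K b (e.symm 1))
  have hs : ∀ b x, rm K b (e.symm x) = e.symm (x * s b) := by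
    intro b x
    have h1 : e.symm x = x • e.symm 1 := by rw [← map_smul, smul_eq_mul, mul_one]
    have h2 : e.symm (x * s b) = x • e.symm (s b) := by rw [← map_smul, smul_eq_mul]
    rw [h1, map_smul, h2, LinearEquiv.symm_apply_apply]
  let σ : B →ₐ[k] B := AlgHom.ofLinearMap
    { toFun := s
      map_add' := fun a b => by show e _ = e _ + e _; rw [rm_add, map_add]
      map_smul' := fun r b => by
        show e _ = r • e _
        rw [rm_alg, map_smul, smul_eq_mul, Algebra.smul_def] }
    (by show e _ = 1; rw [rm_one, LinearEquiv.apply_symm_apply])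
    (by
      intro a b
      show e _ = s a * s b
      rw [rm_mul, hs, hs, one_mul, LinearEquiv.apply_symm_apply])
  have hi : Function.Injective σ := by
    rw [injective_iff_map_eq_zero]
    intro b hb
    have h1 := he (B ∙ (fun _ => b)) (by
      rw [eq_bot_iff]
      intro m hm
      refine PL.ind (AddMonoidHom.id _) ⊥ ?_ m hm
      intro l hl p
      obtain ⟨a, rfl⟩ := Submodule.mem_span_singleton.1 hl
      refine funext fun i => ?_
      show rm K (a * b) p = 0
      obtain ⟨y, hy⟩ := e.symm.surjective (rm K a p)
      rw [rm_mul, ← hy, hs, show s b = 0 from hb, mul_zero, map_zero])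
    exact congrFun (Submodule.span_singleton_eq_bot.1 h1) ()
  let φ : B ≃ₐ[k] B := AlgEquiv.ofBijective σ ⟨hi, (LinearMap.injective_iff_surjective (f := σ.toLinearMap)).1 hi⟩
  obtain ⟨v⟩ := tw_equiv (X := K) φ e.symm hs (uTw φ) (hTw φ)
  refine ⟨n, φ, hn, ?_⟩
  have := Chain.seq n c _ v
  rw [hcX] at this
  exact this

end Back

end
end TE

namespace TE

noncomputable section

open Module TensorProduct MulOpposite

section BackT

variable {k A : Type} [Field k] [Ring A] [Algebra k A] [FiniteDimensional k A]

local notation "𝔹" => TrivialExtension k A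

theorem inr_jac (g : Module.Dual k A) : (TrivSqZeroExt.inr g : 𝔹) ∈ Ring.jacobson 𝔹 := by
  rw [mem_jacB]; simp

theorem redT (L : Submodule 𝔹 (Unit → 𝔹)) (hL : JV 𝔹 ≤ L) : Red 𝔹 ((Unit → 𝔹) ⧸ L) := by
  have kill : ∀ (g : Module.Dual k A) (m : (Unit → 𝔹) ⧸ L), (TrivSqZeroExt.inr g : 𝔹) • m = 0 := by
    intro g m
    obtain ⟨m, rfl⟩ := L.mkQ_surjective m
    rw [← map_smul]
    exact (Submodule.Quotient.mk_eq_zero L).2 (hL (Ideal.mul_mem_right _ _ (inr_jac g)))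
  intro e he
  have he0 : e = 0 := by
    obtain ⟨P, _, _, a, b, hab⟩ := he
    obtain ⟨n, q, hq⟩ := Module.Finite.exists_fin' 𝔹 P
    obtain ⟨s, hs⟩ := proj_lift q hq LinearMap.id
    refine LinearMap.ext fun m => ?_
    have h1 : ∀ i, (s (a m) i).fst = 0 := by
      intro i
      by_contra h
      obtain ⟨g, hg⟩ : ∃ g : Module.Dual k A, g (s (a m) i).fst ≠ 0 := by
        by_contra! h'
        exact h ((Module.forall_dual_apply_eq_zero_iff k _).1 h')
      apply hg
      have h2 : (TrivSqZeroExt.inr g : 𝔹) * s (a m) i = 0 := by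
        have h3 : (TrivSqZeroExt.inr g : 𝔹) • s (a m) = 0 := by
          rw [← map_smul, ← map_smul, kill, map_zero, map_zero]
        exact congrFun h3 i
      have h4 := congrArg (fun z : 𝔹 => z.snd 1) h2
      have h5 : (op (s (a m) i).fst • g) 1 = 0 := by
        simpa [TrivSqZeroExt.snd_mul] using h4
      change g ((s (a m) i).fst * 1) = 0 at h5
      rwa [mul_one] at h5
    rw [hab, ← show q (s (a m)) = a m from hs _]
    have h6 : s (a m) = ∑ i, (TrivSqZeroExt.inr (s (a m) i).snd : 𝔹) • (Pi.single i (1 : 𝔹) : Fin n → 𝔹) := by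
      funext j
      rw [Finset.sum_apply]
      simp only [Pi.smul_apply, smul_eq_mul, Pi.single_apply, mul_ite, mul_one, mul_zero, Finset.sum_ite_eq, Finset.mem_univ, if_true]
      exact TrivSqZeroExt.ext (by rw [h1 j, TrivSqZeroExt.fst_inr]) (by rw [TrivSqZeroExt.snd_inr])
    rw [h6, map_sum, map_sum]
    refine Finset.sum_eq_zero fun i _ => ?_
    rw [map_smul, map_smul, kill]
  rw [he0, sub_zero]
  exact Function.bijective_id

theorem HJT (hsep : ∀ (S : Type) [Ring S] [Algebra k S] (π : A →ₐ[k] S),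
      Function.Surjective π → RingHom.ker π = Ideal.jacobson (⊥ : Ideal A) →
      ∀ (K : Type) [Field K] [Algebra k K], IsSemisimpleRing (K ⊗[k] S)) :
    haveI : FiniteDimensional k 𝔹 := Module.Finite.equiv (eGR k A).symm.toLinearEquiv
    HJ k 𝔹 := by
  have : FiniteDimensional k 𝔹 := Module.Finite.equiv (eGR k A).symm.toLinearEquiv
  let S := A ⧸ Ring.jacobson A
  let π0 : A →ₐ[k] S := Ideal.Quotient.mkₐ k (Ring.jacobson A)
  have h0 : Function.Surjective π0 := Ideal.Quotient.mkₐ_surjective k _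
  have : FiniteDimensional k S := Module.Finite.of_surjective π0.toLinearMap h0
  have hS := hsep S π0 h0 ((Ideal.Quotient.mkₐ_ker k _).trans Ideal.jacobson_bot.symm) (AlgebraicClosure k)
  intro r hr
  refine jac_env (π0.comp (TrivSqZeroExt.fstHom k A (Module.Dual k A)))
    (h0.comp fun a => ⟨TrivSqZeroExt.inl a, rfl⟩) (fun x hx => ?_) hS r hr
  rw [mem_jacB]
  exact Ideal.Quotient.eq_zero_iff_mem.1 hx

theorem backT (hsep : ∀ (S : Type) [Ring S] [Algebra k S] (π : A →ₐ[k] S),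
      Function.Surjective π → RingHom.ker π = Ideal.jacobson (⊥ : Ideal A) →
      ∀ (K : Type) [Field K] [Algebra k K], IsSemisimpleRing (K ⊗[k] S))
    (hB : ∀ (M : Type) [AddCommGroup M] [Module 𝔹 M], Module.Finite 𝔹 M → ComplexityLeOne k 𝔹 M) :
    IsTwistedPeriodicAlgebra k 𝔹 := by
  have : FiniteDimensional k 𝔹 := Module.Finite.equiv (eGR k A).symm.toLinearEquiv
  obtain ⟨n, c, hn, hc, ⟨e0⟩, ⟨en⟩⟩ := rad_periodic hB
  exact back (qfB k A) (HJT hsep) redT n hn c hc e0 en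

end BackT

end
end TE

namespace TE

noncomputable section

open Module TensorProduct MulOpposite

section Fwd

theorem unsplice {R : Type} [Ring R] {M N : ModuleCat.{0} R} (n : ℕ) (H : HasProjExactSeq R M N (n + 1)) :
    ∃ (X Q : ModuleCat.{0} R) (i : X →ₗ[R] Q) (p : Q →ₗ[R] N), Module.Projective R Q ∧
      Function.Injective i ∧ Function.Surjective p ∧ (∀ x, p x = 0 ↔ ∃ y, i y = x) ∧ HasProjExactSeq R M X n := by
  obtain ⟨P, d, e0, em, h1, h2, h3, h4⟩ := H
  let X : ModuleCat.{0} R := ModuleCat.of R (LinearMap.ker (d 0))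
  have h5 : ∀ x, d 1 x ∈ LinearMap.ker (d 0) := fun x => by rw [← h4 0 (by omega)]; exact ⟨x, rfl⟩
  let P' : ℕ → ModuleCat.{0} R := fun | 0 => X | j + 1 => P (j + 2)
  let d0 : P 2 →ₗ[R] X := (d 1).codRestrict _ h5
  let d' : ∀ j, P' (j + 1) →ₗ[R] P' j := fun
    | 0 => d0
    | j + 1 => d (j + 2)
  refine ⟨X, P 1, Submodule.subtype _, e0.toLinearMap ∘ₗ d 0, h1 1 le_rfl (by omega), Subtype.val_injective,
    e0.surjective.comp h2, ?_, P', d', LinearEquiv.refl R X, em, ?_, ?_, ?_, ?_⟩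
  · intro x
    refine (e0.map_eq_zero_iff (x := d 0 x)).trans ⟨fun h => ⟨⟨x, h⟩, rfl⟩, ?_⟩
    rintro ⟨y, rfl⟩
    exact y.2
  · intro j hj hj'
    match j, hj, hj' with
    | j + 1, _, hj' => exact h1 (j + 2) (by omega) (by omega)
  · intro y
    have hy : (y : P 1) ∈ LinearMap.range (d 1) := by rw [h4 0 (by omega)]; exact y.2
    obtain ⟨x, hx⟩ := hy
    exact ⟨x, Subtype.ext hx⟩
  · match n, h3 with
    | 0, h3 => exact fun x y h => h3 (congrArg Subtype.val h)
    | n + 1, h3 => exact h3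
  · intro j hj
    match j, hj with
    | 0, hj =>
      show LinearMap.range (d 2) = LinearMap.ker d0
      rw [h4 1 (by omega), LinearMap.ker_codRestrict]
    | j + 1, hj => exact h4 (j + 2) (by omega)

variable {k B : Type} [Field k] [Ring B] [Algebra k B] [FiniteDimensional k B]
variable {ι : Type} [Fintype ι] (L : Submodule B (ι → B))

def StRet (X D : ModuleCat.{0} B) : Prop :=
  ∃ (a : X →ₗ[B] D) (b : D →ₗ[B] X), SZ (LinearMap.id - b ∘ₗ a)

theorem StRet.step (c : Chain B) {D0 Q D1 : ModuleCat.{0} B} [Module.Projective B Q]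
    (i : D1 →ₗ[B] Q) (p : Q →ₗ[B] D0) (hi : Function.Injective i) (hp : Function.Surjective p)
    (h : ∀ x, p x = 0 ↔ ∃ y, i y = x) (H : StRet (c.X 0) D0) : StRet (c.X 1) D1 := by
  obtain ⟨a, b, hab⟩ := H
  obtain ⟨F, hF⟩ := proj_lift p hp (a ∘ₗ c.p 0)
  obtain ⟨G, hG⟩ := proj_lift (c.p 0) (c.surj 0) (b ∘ₗ p)
  obtain ⟨a1, ha1⟩ := ex_lift i hi (F ∘ₗ c.i 0) (fun x => (h _).1 (by simp [hF, c.pi]))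
  obtain ⟨b1, hb1⟩ := ex_lift (c.i 0) (c.inj 0) (G ∘ₗ i) (fun x => (c.ex 0 _).1 (by
    rw [LinearMap.comp_apply, hG, LinearMap.comp_apply, (h _).2 ⟨x, rfl⟩, map_zero]))
  have hr : Chain.Rel c c 0 (b ∘ₗ a) (b1 ∘ₗ a1) :=
    ⟨G ∘ₗ F, fun x => by simp [hG, hF], fun x => by simp [hb1, ha1]⟩
  exact ⟨a1, b1, Chain.Rel.sz_right ((Chain.Rel.id 0).sub hr) hab⟩

theorem Qm_comp {X Y Z : ModuleCat.{0} (B ⊗[k] Bᵐᵒᵖ)} (f : X →ₗ[B ⊗[k] Bᵐᵒᵖ] Y) (g : Y →ₗ[B ⊗[k] Bᵐᵒᵖ] Z)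
    (x : Qf L X) : Qm L g (Qm L f x) = Qm L (g ∘ₗ f) x := by
  obtain ⟨x, rfl⟩ := (PL L X).mkQ_surjective x
  rfl

theorem Qm_id {X : ModuleCat.{0} (B ⊗[k] Bᵐᵒᵖ)} (x : Qf L X) : Qm L (LinearMap.id : X →ₗ[B ⊗[k] Bᵐᵒᵖ] X) x = x := by
  obtain ⟨x, rfl⟩ := (PL L X).mkQ_surjective x
  rfl

theorem StRet.seq (M : ModuleCat.{0} (B ⊗[k] Bᵐᵒᵖ)) (n : ℕ) (N : ModuleCat.{0} (B ⊗[k] Bᵐᵒᵖ))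
    (hN : Module.Projective Bᵐᵒᵖ (rs (arr k B).toRingHom N)) (H : HasProjExactSeq (B ⊗[k] Bᵐᵒᵖ) M N n)
    (c : Chain B) (hc : StRet (c.X 0) (Qf L N)) : StRet (c.X n) (Qf L M) := by
  induction n generalizing N c with
  | zero =>
    obtain ⟨P, d, e0, em, h1, h2, h3, h4⟩ := H
    let e : M ≃ₗ[B ⊗[k] Bᵐᵒᵖ] N := (em.trans (LinearEquiv.ofBijective (d 0) ⟨h3, h2⟩)).trans e0
    obtain ⟨a, b, hab⟩ := hc
    refine ⟨Qm L e.symm.toLinearMap ∘ₗ a, b ∘ₗ Qm L e.toLinearMap, ?_⟩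
    have : (b ∘ₗ Qm L e.toLinearMap) ∘ₗ Qm L e.symm.toLinearMap ∘ₗ a = b ∘ₗ a := by
      refine LinearMap.ext fun x => ?_
      show b (Qm L e.toLinearMap (Qm L e.symm.toLinearMap (a x))) = b (a x)
      rw [Qm_comp, LinearEquiv.comp_coe, LinearEquiv.symm_trans_self]
      exact congrArg b (Qm_id L (a x))
    rw [this]
    exact hab
  | succ n ih =>
    obtain ⟨X, Q, i, p, hQ, hi, hp, hx, H'⟩ := unsplice n H
    obtain ⟨h1, h2⟩ := Q_ses L i p hi hp hx hN
    have := Qf_proj L Q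
    exact ih X h1 H' c.tail (StRet.step c (Qm L i) (Qm L p) h2 (Qm_surj L p hp) (Qm_exact L i p hp hx) hc)

theorem fwd_le (hq : QF B) {n : ℕ} (φ : B ≃ₐ[k] B) (hn : 1 ≤ n)
    (H : HasProjExactSeq (B ⊗[k] Bᵐᵒᵖ) (twistedBimodule k B φ) (regularBimodule k B) n)
    (c : Chain B) (hc : c.Min) : kDim k B (c.X n) ≤ kDim k B (c.X 0) := by
  have : IsNoetherianRing B := IsNoetherianRing.of_finite k B
  obtain ⟨m, q, hqs⟩ := Module.Finite.exists_fin' B (c.X 0)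
  let L := LinearMap.ker q
  let e : ((Fin m → B) ⧸ L) ≃ₗ[B] c.X 0 := q.quotKerEquivOfSurjective hqs
  obtain ⟨w⟩ := Q_reg (k := k) L
  let z : Qf L (regularBimodule k B) ≃ₗ[B] c.X 0 := LinearEquiv.trans w e
  obtain ⟨a, b, hab⟩ := StRet.seq L _ n _ reg_rproj H c ⟨z.symm.toLinearMap, z.toLinearMap, by
    have : z.toLinearMap ∘ₗ z.symm.toLinearMap = LinearMap.id := LinearMap.ext fun x => z.apply_symm_apply x
    rw [this, sub_self]; exact SZ.zero⟩
  have : Module.Finite B (Lf (twistedBimodule k B φ)) := Module.Finite.equiv (uTw φ)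
  have hr : Red B (c.X n) := by
    obtain ⟨j, rfl⟩ : ∃ j, n = j + 1 := ⟨n - 1, by omega⟩
    exact Chain.red hq hc j
  have h1 := kDim_inj k a (hr.inj a b hab)
  rw [kDim_tw L φ (uTw φ) (hTw φ)] at h1
  exact h1.trans (kDim_inj k e.toLinearMap e.injective)

theorem kDim_P (c : Chain B) (j : ℕ) : kDim k B (c.P j) = kDim k B (c.X (j + 1)) + kDim k B (c.X j) := by
  unfold kDim
  let : Module k (c.P j) := Module.compHom _ (algebraMap k B)
  let : Module k (c.X j) := Module.compHom _ (algebraMap k B)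
  let : Module k (c.X (j + 1)) := Module.compHom _ (algebraMap k B)
  have : IsScalarTower k B (c.P j) := IsScalarTower.of_compHom k B _
  have : IsScalarTower k B (c.X j) := IsScalarTower.of_compHom k B _
  have : IsScalarTower k B (c.X (j + 1)) := IsScalarTower.of_compHom k B _
  have : Module.Finite k (c.P j) := Module.Finite.trans B _
  let f : c.X (j + 1) →ₗ[k] c.P j := (c.i j).restrictScalars k
  let g : c.P j →ₗ[k] c.X j := (c.p j).restrictScalars k
  have h1 := LinearMap.finrank_range_add_finrank_ker g
  have h2 : LinearMap.range f = LinearMap.ker g := by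
    ext x
    exact (c.ex j x).symm
  have h3 : LinearMap.range g = ⊤ := LinearMap.range_eq_top.2 (c.surj j)
  have h4 : finrank k (LinearMap.range f) = finrank k (c.X (j + 1)) :=
    LinearMap.finrank_range_of_inj (f := f) (c.inj j)
  rw [h3, finrank_top, ← h2, h4] at h1
  omega

theorem fwd (hq : QF B) (H : IsTwistedPeriodicAlgebra k B) (M : Type) [AddCommGroup M] [Module B M]
    [Module.Finite B M] : ComplexityLeOne k B M := by
  obtain ⟨n, φ, hn, H⟩ := H
  have : IsArtinianRing B := IsArtinianRing.of_finite k B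
  obtain ⟨c, hcX, hc⟩ := ex_chain (R := B) M
  have e : c.X 0 ≃ₗ[B] M := by
    have : Nonempty (c.X 0 ≃ₗ[B] ModuleCat.of B M) := by rw [hcX]; exact ⟨LinearEquiv.refl _ _⟩
    exact this.some
  let C := ∑ r ∈ Finset.range n, kDim k B (c.X r)
  have hX : ∀ j, kDim k B (c.X j) ≤ C := by
    intro j
    induction j using Nat.strong_induction_on with
    | _ j ih =>
      by_cases hj : j < n
      · exact Finset.single_le_sum (f := fun r => kDim k B (c.X r)) (fun _ _ => Nat.zero_le _) (Finset.mem_range.2 hj)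
      · obtain ⟨r, rfl⟩ : ∃ r, j = r + n := ⟨j - n, by omega⟩
        exact (fwd_le hq φ hn H (c.drop r) (hc.drop r)).trans (ih r (by omega))
  refine ⟨C + C, c.P, fun j => c.i j ∘ₗ c.p (j + 1), e.toLinearMap ∘ₗ c.p 0, c.proj, c.fin, fun j => ?_,
    e.surjective.comp (c.surj 0), ?_, fun j => ?_⟩
  · rw [kDim_P]
    exact add_le_add (hX _) (hX _)
  · rw [LinearMap.range_comp, LinearMap.range_eq_top.2 (c.surj 1), Submodule.map_top]
    ext x
    exact ((c.ex 0 x).symm).trans (e.map_eq_zero_iff (x := c.p 0 x)).symm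
  · rw [LinearMap.range_comp, LinearMap.range_eq_top.2 (c.surj (j + 2)), Submodule.map_top]
    ext x
    refine ((c.ex (j + 1) x).symm).trans ?_
    exact (map_eq_zero_iff (c.i j) (c.inj j)).symm

end Fwd

end
end TE

section DualBimodule

variable (k A : Type) [Field k] [Ring A] [Algebra k A]

/-- Let `A` be a finite-dimensional `k`-algebra such that `A/rad A` is a
separable `k`-algebra. Then the trivial extension algebra `T(A)` is twisted periodic if and
only if every finitely generated `T(A)`-module has complexity at most one. -/
theorem trivialExtension_twistedPeriodic_iff_complexity
    [FiniteDimensional k A]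
    (hsep : ∀ (S : Type) [Ring S] [Algebra k S] (π : A →ₐ[k] S),
      Function.Surjective π → RingHom.ker π = Ideal.jacobson (⊥ : Ideal A) →
      ∀ (K : Type) [Field K] [Algebra k K], IsSemisimpleRing (K ⊗[k] S)) :
    IsTwistedPeriodicAlgebra k (TrivialExtension k A) ↔
      ∀ (M : Type) [AddCommGroup M] [Module (TrivialExtension k A) M],
        Module.Finite (TrivialExtension k A) M →
        ComplexityLeOne k (TrivialExtension k A) M := by
  have : FiniteDimensional k (TrivialExtension k A) :=
    Module.Finite.equiv (TE.eGR k A).symm.toLinearEquiv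
  exact ⟨fun H M _ _ hM => by
    have := hM
    exact TE.fwd (TE.qfB k A) H M, fun H => TE.backT hsep H⟩

end DualBimodule
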